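/- For every homeomorphism η : [0,∞) → [0,∞) there exists H ≥ 1 with the following property: if S and S̃ are relative Schottky sets in domains Ω, Ω̃ ⊆ ℂ respectively and f : S → S̃ is an η-quasisymmetric homeomorphism, then there exists a homeomorphism F : Ω → Ω̃ with F(z) = f(z) for every z ∈ S and with dilatation H_F(z) ≤ H for every z ∈ Ω. -/

import Mathlib

open Set Metric MeasureTheory Filter
open scoped NNReal ENNReal Topology

noncomputable section

/-- A (nonempty, open, connected) domain in the complex plane. -/
def IsPlaneDomain (Ω : Set ℂ) : Prop := IsOpen Ω ∧ IsConnected Ω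

/-- A family of open round discs (given by centers `c` and radii `r`) whose closures
are contained in `Ω` and are pairwise disjoint. -/
def IsSchottkyFamily {I : Type*} (Ω : Set ℂ) (c : I → ℂ) (r : I → ℝ) : Prop :=
  (∀ i, 0 < r i) ∧ (∀ i, closedBall (c i) (r i) ⊆ Ω) ∧
    Pairwise fun i j => Disjoint (closedBall (c i) (r i)) (closedBall (c j) (r j))

/-- `S` is a relative Schottky set in the domain `Ω`. -/
def IsRelativeSchottkySet (Ω S : Set ℂ) : Prop :=
  IsPlaneDomain Ω ∧
    ∃ (I : Type) (c : I → ℂ) (r : I → ℝ),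
      IsSchottkyFamily Ω c r ∧ S = Ω \ ⋃ i, ball (c i) (r i)

/-- A Jordan domain: a bounded domain whose boundary is an embedded circle, and which is
a connected component of the complement of its boundary. -/
def IsJordanDomain (Ω : Set ℂ) : Prop :=
  IsPlaneDomain Ω ∧ Bornology.IsBounded Ω ∧
    (∃ γ : ℂ → ℂ, ContinuousOn γ (sphere (0 : ℂ) 1) ∧ InjOn γ (sphere (0 : ℂ) 1) ∧
      γ '' sphere (0 : ℂ) 1 = frontier Ω) ∧
    ∀ p ∈ Ω, connectedComponentIn (frontier Ω)ᶜ p = Ω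

/-- `f : ℂ → ℂ` restricts to a homeomorphism from `S` onto `T`. -/
def IsHomeoOn (f : ℂ → ℂ) (S T : Set ℂ) : Prop :=
  ∃ e : S ≃ₜ T, ∀ z : S, (e z : ℂ) = f (z : ℂ)

/-- `f` is `η`-quasisymmetric on `X`. -/
def QuasisymmetricWith (η : ℝ≥0 ≃ₜ ℝ≥0) (f : ℂ → ℂ) (X : Set ℂ) : Prop :=
  ∀ p ∈ X, ∀ q ∈ X, ∀ s ∈ X, ∀ t : ℝ≥0,
    dist p q ≤ (t : ℝ) * dist p s → dist (f p) (f q) ≤ (η t : ℝ) * dist (f p) (f s)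

/-- `f` is locally quasisymmetric on `X`: its restriction to every compact subset of `X`
is quasisymmetric. -/
def LocallyQuasisymmetricOn (f : ℂ → ℂ) (X : Set ℂ) : Prop :=
  ∀ K ⊆ X, IsCompact K → ∃ η : ℝ≥0 ≃ₜ ℝ≥0, QuasisymmetricWith η f K

/-- `f` is locally bi-Lipschitz on `S`. -/
def LocallyBiLipschitzOn (f : ℂ → ℂ) (S : Set ℂ) : Prop :=
  ∀ p ∈ S, ∃ U ∈ 𝓝[S] p, ∃ L : ℝ, 1 ≤ L ∧
    ∀ x ∈ U, ∀ y ∈ U,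
      dist x y / L ≤ dist (f x) (f y) ∧ dist (f x) (f y) ≤ L * dist x y

/-- `L_F(p,r)`: sup of distances of images of points of `Ω` at distance `≤ r` from `p`. -/
noncomputable def supDistImage (F : ℂ → ℂ) (Ω : Set ℂ) (p : ℂ) (r : ℝ) : ℝ≥0∞ :=
  ⨆ q ∈ {q | q ∈ Ω ∧ dist p q ≤ r}, edist (F p) (F q)

/-- `l_F(p,r)`: inf of distances of images of points of `Ω` at distance `≥ r` from `p`. -/
noncomputable def infDistImage (F : ℂ → ℂ) (Ω : Set ℂ) (p : ℂ) (r : ℝ) : ℝ≥0∞ :=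
  ⨅ q ∈ {q | q ∈ Ω ∧ r ≤ dist p q}, edist (F p) (F q)

/-- The dilatation `H_F(p) = limsup_{r → 0+} L_F(p,r) / l_F(p,r)` of `F` (viewed as a map
of `Ω`) at the point `p`. -/
noncomputable def dilatationOn (F : ℂ → ℂ) (Ω : Set ℂ) (p : ℂ) : ℝ≥0∞ :=
  Filter.limsup (fun r : ℝ => supDistImage F Ω p r / infDistImage F Ω p r) (𝓝[>] (0 : ℝ))

lemma abs_sub_le_pi_div_two_of_cos_nonneg {θ : ℝ → ℝ} {a : ℝ} (hθ : Continuous θ)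
    (hcos : ∀ s ∈ Icc (0 : ℝ) 1, 0 ≤ Real.cos (θ s - a)) {p q : ℝ} (hp : p ∈ Icc (0 : ℝ) 1)
    (hq : q ∈ Icc (0 : ℝ) 1) (h : |θ p - a| ≤ Real.pi / 2) : |θ q - a| ≤ Real.pi / 2 := by
  by_contra! hc
  have hpi := Real.pi_pos
  set v := min |θ q - a| Real.pi with hv
  have hv1 : Real.pi / 2 < v := lt_min hc (by linarith)
  have hcont : ContinuousOn (fun s => |θ s - a|) (Icc 0 1) := by fun_prop
  obtain ⟨s, hs, hsv⟩ := isPreconnected_Icc.intermediate_value hp hq hcont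
    ⟨h.trans hv1.le, min_le_left _ _⟩
  have h1 := hcos s hs
  rw [← Real.cos_abs] at h1
  have hsv' : |θ s - a| = v := hsv
  rw [hsv'] at h1
  exact absurd h1 (not_le.2 (Real.cos_neg_of_pi_div_two_lt_of_lt hv1
    ((min_le_right _ _).trans_lt (by linarith))))

/-- A curve joining the left side of a rectangle to the right side meets a curve joining
the bottom side to the top side. -/
lemma exists_eq_of_crossing {h v : ℝ → ℂ} (hh : Continuous h) (hv : Continuous v)
    (hl : ∀ t ∈ Icc (0 : ℝ) 1, (h 0 - v t).re ≤ 0) (hr : ∀ t ∈ Icc (0 : ℝ) 1, 0 ≤ (h 1 - v t).re)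
    (hb : ∀ s ∈ Icc (0 : ℝ) 1, 0 ≤ (h s - v 0).im) (ht : ∀ s ∈ Icc (0 : ℝ) 1, (h s - v 1).im ≤ 0) :
    ∃ s ∈ Icc (0 : ℝ) 1, ∃ t ∈ Icc (0 : ℝ) 1, h s = v t := by
  by_contra! hne
  let π₁ : ℝ → ℝ := fun x => projIcc (0 : ℝ) 1 zero_le_one x
  have hπ₁ : Continuous π₁ := continuous_subtype_val.comp continuous_projIcc
  have hπm : ∀ x, π₁ x ∈ Icc (0 : ℝ) 1 := fun x => (projIcc (0 : ℝ) 1 zero_le_one x).2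
  have hπe : ∀ x ∈ Icc (0 : ℝ) 1, π₁ x = x := fun x hx => by
    simp only [π₁, projIcc_of_mem _ hx]
  let D : ℝ × ℝ → ℂ := fun x => h (π₁ x.1) - v (π₁ x.2)
  have hD : Continuous D := by fun_prop
  have hD0 : ∀ x, D x ≠ 0 := fun x => sub_ne_zero.2 (hne _ (hπm _) _ (hπm _))
  have hsc : IsSimplyConnected (univ : Set (ℝ × ℝ)) := by
    have : ContractibleSpace (univ : Set (ℝ × ℝ)) :=
      Convex.contractibleSpace convex_univ univ_nonempty
    exact SimplyConnectedSpace.ofContractible _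
  obtain ⟨L, hLc, hL⟩ := Complex.exists_continuousOn_eqOn_exp_comp hsc isOpen_univ
    hD.continuousOn (by rintro ⟨x, -, hx⟩; exact hD0 x hx)
  rw [continuousOn_univ] at hLc
  have hL' : ∀ x, Complex.exp (L x) = D x := fun x => hL (mem_univ x)
  have hpi := Real.pi_pos
  -- normalise the argument at the corner `(1, 0)`
  have h0 : (0 : ℝ) ∈ Icc (0 : ℝ) 1 := by simp
  have h1 : (1 : ℝ) ∈ Icc (0 : ℝ) 1 := by simp
  let k : ℝ := (D (1, 0)).arg - (L (1, 0)).im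
  let θ : ℝ → ℝ → ℝ := fun s t => (L (s, t)).im + k
  have hk : Complex.exp (k * Complex.I) = 1 := by
    have e1 : D (1, 0) = ‖D (1, 0)‖ * Complex.exp ((D (1, 0)).arg * Complex.I) :=
      (Complex.norm_mul_exp_arg_mul_I _).symm
    have e2 : D (1, 0) = ‖D (1, 0)‖ * Complex.exp ((L (1, 0)).im * Complex.I) := by
      rw [← hL', Complex.norm_exp, Complex.ofReal_exp, ← Complex.exp_add, Complex.re_add_im]
    have hn : (‖D (1, 0)‖ : ℂ) ≠ 0 := by simpa using hD0 (1, 0)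
    have e3 := mul_left_cancel₀ hn (e1.symm.trans e2)
    simp only [k]
    push_cast
    rw [sub_mul, Complex.exp_sub, e3, div_self (Complex.exp_ne_zero _)]
  have hpolar : ∀ s t, D (s, t) = ‖D (s, t)‖ * Complex.exp (θ s t * Complex.I) := by
    intro s t
    simp only [θ]
    push_cast
    rw [add_mul, Complex.exp_add, hk, mul_one, ← hL', Complex.norm_exp, Complex.ofReal_exp,
      ← Complex.exp_add, Complex.re_add_im]
  have hre : ∀ s t, (D (s, t)).re = ‖D (s, t)‖ * Real.cos (θ s t) := by
    intro s t
    conv_lhs => rw [hpolar]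
    rw [Complex.re_ofReal_mul, Complex.exp_ofReal_mul_I_re]
  have him : ∀ s t, (D (s, t)).im = ‖D (s, t)‖ * Real.sin (θ s t) := by
    intro s t
    conv_lhs => rw [hpolar]
    rw [Complex.im_ofReal_mul, Complex.exp_ofReal_mul_I_im]
  have hpos : ∀ s t, 0 < ‖D (s, t)‖ := fun s t => norm_pos_iff.2 (hD0 _)
  have cr : ∀ t ∈ Icc (0 : ℝ) 1, 0 ≤ Real.cos (θ 1 t) := by
    intro t htt
    have := hr t htt
    have h2 := hre 1 t
    simp only [D, hπe t htt, hπe 1 h1] at h2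
    by_contra! hc
    have := hpos 1 t
    simp only [D, hπe t htt, hπe 1 h1] at this
    nlinarith
  have cl : ∀ t ∈ Icc (0 : ℝ) 1, Real.cos (θ 0 t) ≤ 0 := by
    intro t htt
    have := hl t htt
    have h2 := hre 0 t
    simp only [D, hπe t htt, hπe 0 h0] at h2
    by_contra! hc
    have := hpos 0 t
    simp only [D, hπe t htt, hπe 0 h0] at this
    nlinarith
  have cb : ∀ s ∈ Icc (0 : ℝ) 1, 0 ≤ Real.sin (θ s 0) := by
    intro t htt
    have := hb t htt
    have h2 := him t 0
    simp only [D, hπe t htt, hπe 0 h0] at h2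
    by_contra! hc
    have := hpos t 0
    simp only [D, hπe t htt, hπe 0 h0] at this
    nlinarith
  have ct : ∀ s ∈ Icc (0 : ℝ) 1, Real.sin (θ s 1) ≤ 0 := by
    intro t htt
    have := ht t htt
    have h2 := him t 1
    simp only [D, hπe t htt, hπe 1 h1] at h2
    by_contra! hc
    have := hpos t 1
    simp only [D, hπe t htt, hπe 1 h1] at this
    nlinarith
  have hθ10 : θ 1 0 = (D (1, 0)).arg := by simp [θ, k]
  have hD10re : 0 ≤ (D (1, 0)).re := by rw [hre]; exact mul_nonneg (hpos _ _).le (cr 0 h0)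
  have hD10im : 0 ≤ (D (1, 0)).im := by rw [him]; exact mul_nonneg (hpos _ _).le (cb 1 h1)
  have a1 : 0 ≤ θ 1 0 := by rw [hθ10]; exact Complex.arg_nonneg_iff.2 hD10im
  have a2 : |θ 1 0| ≤ Real.pi / 2 := by
    rw [hθ10]; exact Complex.abs_arg_le_pi_div_two_iff.2 hD10re
  have a3 := (abs_le.1 a2).2
  have b1 : |θ 0 0 - Real.pi / 2| ≤ Real.pi / 2 := by
    refine abs_sub_le_pi_div_two_of_cos_nonneg (θ := fun s => θ s 0) (by fun_prop) ?_ h1 h0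
      (abs_le.2 ⟨by linarith, by linarith⟩)
    intro s hs
    rw [Real.cos_sub_pi_div_two]; exact cb s hs
  rw [abs_le] at b1
  have b2 : Real.pi / 2 ≤ θ 0 0 := by
    by_contra! hc
    exact absurd (cl 0 h0) (not_le.2 (Real.cos_pos_of_mem_Ioo ⟨by linarith, hc⟩))
  have c1 : |θ 0 1 - Real.pi| ≤ Real.pi / 2 := by
    refine abs_sub_le_pi_div_two_of_cos_nonneg (θ := fun t => θ 0 t) (by fun_prop) ?_ h0 h1
      (abs_le.2 ⟨by linarith, by linarith⟩)
    intro s hs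
    rw [Real.cos_sub_pi]; linarith [cl s hs]
  rw [abs_le] at c1
  have c2 : Real.pi ≤ θ 0 1 := by
    by_contra! hc
    exact absurd (ct 0 h0) (not_le.2 (Real.sin_pos_of_pos_of_lt_pi (by linarith) hc))
  have d1 : |θ 1 1 - (Real.pi / 2 + Real.pi)| ≤ Real.pi / 2 := by
    refine abs_sub_le_pi_div_two_of_cos_nonneg (θ := fun s => θ s 1) (by fun_prop) ?_ h0 h1
      (abs_le.2 ⟨by linarith, by linarith⟩)
    intro s hs
    rw [← sub_sub, Real.cos_sub_pi, Real.cos_sub_pi_div_two]; linarith [ct s hs]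
  rw [abs_le] at d1
  have e1 : |θ 1 1 - 0| ≤ Real.pi / 2 := by
    refine abs_sub_le_pi_div_two_of_cos_nonneg (θ := fun t => θ 1 t) (by fun_prop) ?_ h0 h1
      (by simpa using a2)
    intro s hs
    simpa using cr s hs
  rw [abs_le] at e1
  linarith

lemma JoinedIn.inter_nonempty_of_crossing {X Y : Set ℂ} {a b p q : ℂ} (hX : JoinedIn X a b)
    (hY : JoinedIn Y p q) (hYre : ∀ z ∈ Y, a.re ≤ z.re ∧ z.re ≤ b.re)
    (hXim : ∀ z ∈ X, p.im ≤ z.im ∧ z.im ≤ q.im) : (X ∩ Y).Nonempty := by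
  obtain ⟨h, hh⟩ := hX
  obtain ⟨v, hv⟩ := hY
  have hh' : ∀ s ∈ Icc (0 : ℝ) 1, h.extend s ∈ X := fun s hs => by
    rw [Path.extend_apply _ hs]; exact hh _
  have hv' : ∀ s ∈ Icc (0 : ℝ) 1, v.extend s ∈ Y := fun s hs => by
    rw [Path.extend_apply _ hs]; exact hv _
  obtain ⟨s, hs, t, ht, hst⟩ := exists_eq_of_crossing h.continuous_extend v.continuous_extend
    (fun t ht => by
      rw [Path.extend_zero, Complex.sub_re]; linarith [(hYre _ (hv' t ht)).1])
    (fun t ht => by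
      rw [Path.extend_one, Complex.sub_re]; linarith [(hYre _ (hv' t ht)).2])
    (fun t ht => by
      rw [Path.extend_zero, Complex.sub_im]; linarith [(hXim _ (hh' t ht)).1])
    (fun t ht => by
      rw [Path.extend_one, Complex.sub_im]; linarith [(hXim _ (hh' t ht)).2])
  exact ⟨_, hh' s hs, hst ▸ hv' t ht⟩

lemma joinedIn_vertical {x a b : ℝ} {z w : ℂ} (hz : z.re = x) (hw : w.re = x)
    (hz' : z.im ∈ Icc a b) (hw' : w.im ∈ Icc a b) :
    JoinedIn {u : ℂ | u.re = x ∧ u.im ∈ Icc a b} z w := by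
  have hc : Convex ℝ {u : ℂ | u.re = x ∧ u.im ∈ Icc a b} := by
    intro u hu v hv s t hs ht hst
    refine ⟨?_, ?_⟩
    · simp [hu.1, hv.1, ← add_mul, hst]
    · have := (convex_Icc a b) hu.2 hv.2 hs ht hst
      simpa using this
  exact JoinedIn.of_segment_subset (hc.segment_subset ⟨hz, hz'⟩ ⟨hw, hw'⟩)

lemma joinedIn_horizontal {y a b : ℝ} {z w : ℂ} (hz : z.im = y) (hw : w.im = y)
    (hz' : z.re ∈ Icc a b) (hw' : w.re ∈ Icc a b) :
    JoinedIn {u : ℂ | u.im = y ∧ u.re ∈ Icc a b} z w := by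
  have hc : Convex ℝ {u : ℂ | u.im = y ∧ u.re ∈ Icc a b} := by
    intro u hu v hv s t hs ht hst
    refine ⟨?_, ?_⟩
    · simp [hu.1, hv.1, ← add_mul, hst]
    · have := (convex_Icc a b) hu.2 hv.2 hs ht hst
      simpa using this
  exact JoinedIn.of_segment_subset (hc.segment_subset ⟨hz, hz'⟩ ⟨hw, hw'⟩)

lemma re_im_bounds_of_norm_le_two {z : ℂ} (h1 : ‖z - 1‖ ≤ 2) (h2 : ‖z + 1‖ ≤ 2) :
    (-1 ≤ z.re ∧ z.re ≤ 1) ∧ (-2 < z.im ∧ z.im < 2) ∧ (z.re = 1 ∨ z.re = -1 → z.im = 0) := by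
  have e1 : (z.re - 1) ^ 2 + z.im ^ 2 ≤ 4 := by
    have : ‖z - 1‖ ^ 2 ≤ 2 ^ 2 := by gcongr
    rw [← Complex.normSq_eq_norm_sq, Complex.normSq_apply] at this
    simp at this; nlinarith
  have e2 : (z.re + 1) ^ 2 + z.im ^ 2 ≤ 4 := by
    have : ‖z + 1‖ ^ 2 ≤ 2 ^ 2 := by gcongr
    rw [← Complex.normSq_eq_norm_sq, Complex.normSq_apply] at this
    simp at this; nlinarith
  refine ⟨⟨by nlinarith [sq_nonneg z.im], by nlinarith [sq_nonneg z.im]⟩,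
    ⟨by nlinarith [sq_nonneg z.re], by nlinarith [sq_nonneg z.re]⟩, ?_⟩
  rintro (h | h) <;> rw [h] at e1 e2 <;> nlinarith [sq_nonneg z.im]

/-- A path in the complement of `J` leaving the open rectangle `(-1, 1) × (-2, 2)` can be cut at
its first exit from the rectangle. -/
lemma exists_exit_point {J : Set ℂ} {z₀ z₁ : ℂ} (hα : JoinedIn J z₀ z₁)
    (hz₀ : |z₀.re| < 1 ∧ |z₀.im| < 2) (hz₁ : ¬ (|z₁.re| < 1 ∧ |z₁.im| < 2)) :
    ∃ w ∈ J, (|w.re| ≤ 1 ∧ |w.im| ≤ 2) ∧ ¬ (|w.re| < 1 ∧ |w.im| < 2) ∧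
      JoinedIn {z | (|z.re| ≤ 1 ∧ |z.im| ≤ 2) ∧ z ∈ J} z₀ w := by
  obtain ⟨α, hαJ⟩ := hα
  let β := α.extend
  have hβ : Continuous β := α.continuous_extend
  have hβJ : ∀ t ∈ Icc (0 : ℝ) 1, β t ∈ J := fun s hs => by
    simp only [β]; rw [Path.extend_apply _ hs]; exact hαJ _
  let T : Set ℝ := {t | t ∈ Icc (0 : ℝ) 1 ∧ ¬ (|(β t).re| < 1 ∧ |(β t).im| < 2)}
  have hopen : IsOpen {t : ℝ | |(β t).re| < 1 ∧ |(β t).im| < 2} :=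
    (isOpen_lt (f := fun t => |(β t).re|) (by fun_prop) continuous_const).inter
      (isOpen_lt (f := fun t => |(β t).im|) (by fun_prop) continuous_const)
  have hTc : IsCompact T := isCompact_Icc.inter_right hopen.isClosed_compl
  have hTn : T.Nonempty := ⟨1, by simp, by simpa [β] using hz₁⟩
  obtain ⟨t₀, ⟨ht₀, hex⟩, hmin⟩ := hTc.exists_isLeast hTn
  have hlt : ∀ t ∈ Icc (0 : ℝ) 1, t < t₀ → |(β t).re| < 1 ∧ |(β t).im| < 2 := by
    intro t ht htt
    by_contra hc
    exact absurd (hmin ⟨ht, hc⟩) (not_le.2 htt)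
  have ht₀pos : 0 < t₀ := by
    rcases ht₀.1.eq_or_lt with h | h
    · exact absurd hz₀ (by rw [← h] at hex; simpa [β] using hex)
    · exact h
  have hcl : |(β t₀).re| ≤ 1 ∧ |(β t₀).im| ≤ 2 := by
    have hclosed : IsClosed {t : ℝ | |(β t).re| ≤ 1 ∧ |(β t).im| ≤ 2} :=
      (isClosed_le (f := fun t => |(β t).re|) (by fun_prop) continuous_const).inter
        (isClosed_le (f := fun t => |(β t).im|) (by fun_prop) continuous_const)
    have hsub : Ico 0 t₀ ⊆ {t : ℝ | |(β t).re| ≤ 1 ∧ |(β t).im| ≤ 2} := fun t ht => by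
      have := hlt t ⟨ht.1, ht.2.le.trans ht₀.2⟩ ht.2
      exact ⟨this.1.le, this.2.le⟩
    have := closure_minimal hsub hclosed
    rw [closure_Ico ht₀pos.ne] at this
    exact this ⟨ht₀pos.le, le_rfl⟩
  refine ⟨β t₀, hβJ _ ht₀, hcl, hex, ?_⟩
  have hpc : IsPathConnected (β '' Icc 0 t₀) :=
    ((convex_Icc 0 t₀).isPathConnected ⟨0, le_rfl, ht₀pos.le⟩).image hβ
  have := hpc.joinedIn (β 0) ⟨0, ⟨le_rfl, ht₀pos.le⟩, rfl⟩ (β t₀) ⟨t₀, ⟨ht₀pos.le, le_rfl⟩, rfl⟩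
  simp only [β, Path.extend_zero] at this
  refine this.mono ?_
  rintro _ ⟨t, ht, rfl⟩
  refine ⟨?_, hβJ t ⟨ht.1, ht.2.trans ht₀.2⟩⟩
  rcases ht.2.eq_or_lt with h | h
  · rw [h]; exact hcl
  · have := hlt t ⟨ht.1, h.le.trans ht₀.2⟩ h
    exact ⟨this.1.le, this.2.le⟩

lemma exists_isLeast_im {K : Set ℂ} (hK : IsCompact K) (hne : K.Nonempty) :
    ∃ m ∈ K, ∀ z ∈ K, m.im ≤ z.im :=
  hK.exists_isMinOn hne Complex.continuous_im.continuousOn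

lemma exists_isGreatest_im {K : Set ℂ} (hK : IsCompact K) (hne : K.Nonempty) :
    ∃ m ∈ K, ∀ z ∈ K, z.im ≤ m.im :=
  hK.exists_isMaxOn hne Complex.continuous_im.continuousOn

lemma not_isPreconnected_compl_of_arcs_aux {J₁ J₂ : Set ℂ} (hJ₁ : IsCompact J₁) (hJ₂ : IsCompact J₂)
    (hj₁ : JoinedIn J₁ (-1) 1) (hj₂ : JoinedIn J₂ (-1) 1)
    (hinter : ∀ z ∈ J₁, z ∈ J₂ → z = -1 ∨ z = 1)
    (hp₁ : IsPathConnected (J₁ \ {-1, 1})) 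
    (hb : ∀ z ∈ J₁ ∪ J₂, ‖z - 1‖ ≤ 2 ∧ ‖z + 1‖ ≤ 2) {l : ℂ} (hl : l ∈ J₁) (hlre : l.re = 0)
    (hltop : ∀ z ∈ J₁ ∪ J₂, z.re = 0 → z.im ≤ l.im) : ¬ IsPreconnected (J₁ ∪ J₂)ᶜ := by
  intro hcon
  have hbd : ∀ z ∈ J₁ ∪ J₂, (-1 ≤ z.re ∧ z.re ≤ 1) ∧ (-2 < z.im ∧ z.im < 2) ∧
      (z.re = 1 ∨ z.re = -1 → z.im = 0) := fun z hz =>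
    re_im_bounds_of_norm_le_two (hb z hz).1 (hb z hz).2
  have hvcl : IsClosed {z : ℂ | z.re = 0} := isClosed_eq Complex.continuous_re continuous_const
  obtain ⟨m, ⟨hm, hmre : m.re = 0⟩, hmbot⟩ := exists_isLeast_im (hJ₁.inter_right hvcl) ⟨l, hl, hlre⟩
  have hlm : m.im ≤ l.im := hmbot l ⟨hl, hlre⟩
  have hlb := (hbd l (Or.inl hl)).2.1
  have hmb := (hbd m (Or.inl hm)).2.1
  have hne : ∀ z : ℂ, z.re = 0 → z ∉ ({-1, 1} : Set ℂ) := by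
    rintro z hz (h | h) <;> rw [h] at hz <;> norm_num at hz
  have hlm_join : JoinedIn (J₁ \ {-1, 1}) l m :=
    hp₁.joinedIn _ ⟨hl, hne _ hlre⟩ _ ⟨hm, hne _ hmre⟩
  have htop_l : JoinedIn {u : ℂ | u.re = 0 ∧ u.im ∈ Icc l.im 2} (⟨0, 2⟩ : ℂ) l :=
    joinedIn_vertical rfl hlre ⟨hlb.2.le, le_rfl⟩ ⟨le_rfl, hlb.2.le⟩
  -- the curve from the top through `l` and `m` to anything avoids `J₂` up to `m`
  have hA : ∀ z ∈ J₂, z ∉ {u : ℂ | u.re = 0 ∧ u.im ∈ Icc l.im 2} ∪ J₁ \ {-1, 1} := by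
    rintro z hz (⟨h1, h2⟩ | ⟨h1, h2⟩)
    · have h3 : z = l := Complex.ext (by rw [h1, hlre])
        (le_antisymm (hltop z (Or.inr hz) h1) h2.1)
      rw [h3] at hz
      exact hne l hlre (hinter l hl hz)
    · exact h2 (hinter z h1 hz)
  have hA_join : JoinedIn ({u : ℂ | u.re = 0 ∧ u.im ∈ Icc l.im 2} ∪ J₁ \ {-1, 1}) ⟨0, 2⟩ m :=
    (htop_l.mono subset_union_left).trans (hlm_join.mono subset_union_right)
  have hA_re : ∀ z ∈ {u : ℂ | u.re = 0 ∧ u.im ∈ Icc l.im 2} ∪ J₁ \ {-1, 1},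
      -1 ≤ z.re ∧ z.re ≤ 1 := by
    rintro z (⟨h1, h2⟩ | ⟨h1, h2⟩)
    · rw [h1]; norm_num
    · exact (hbd z (Or.inl h1)).1
  have hJ₂im : ∀ z ∈ J₂, (-2 : ℝ) ≤ z.im ∧ z.im ≤ 2 := fun z hz =>
    ⟨(hbd z (Or.inr hz)).2.1.1.le, (hbd z (Or.inr hz)).2.1.2.le⟩
  have hJ₁im : ∀ z ∈ J₁, (-2 : ℝ) ≤ z.im ∧ z.im ≤ 2 := fun z hz =>
    ⟨(hbd z (Or.inl hz)).2.1.1.le, (hbd z (Or.inl hz)).2.1.2.le⟩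
  obtain ⟨p', hp'J, hp're, hp'm⟩ : ∃ p ∈ J₂, p.re = 0 ∧ p.im ≤ m.im := by
    have h1 : JoinedIn {u : ℂ | u.re = 0 ∧ u.im ∈ Icc (-2) m.im} m ⟨0, -2⟩ :=
      joinedIn_vertical hmre rfl ⟨hmb.1.le, le_rfl⟩ ⟨le_rfl, hmb.1.le⟩
    obtain ⟨z, hzJ, hz | hz⟩ := hj₂.inter_nonempty_of_crossing
      ((hA_join.mono subset_union_left).trans (h1.mono subset_union_right)).symm
      (by
        rintro z (hz | hz)
        · simpa using hA_re z hz
        · rw [hz.1]; norm_num) (by simpa using hJ₂im)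
    · exact absurd hz (hA z hzJ)
    · exact ⟨z, hzJ, hz.1, hz.2.2⟩
  have hicl : IsClosed {z : ℂ | z.re = 0 ∧ z.im ≤ m.im} :=
    hvcl.inter (isClosed_le Complex.continuous_im continuous_const)
  obtain ⟨p, ⟨hpJ, hpre, hpm⟩, hptop⟩ := exists_isGreatest_im (hJ₂.inter_right hicl)
    ⟨p', hp'J, hp're, hp'm⟩
  have hplt : p.im < m.im := by
    refine lt_of_le_of_ne hpm fun h => ?_
    have : p = m := Complex.ext (by rw [hpre, hmre]) h
    rw [this] at hpJ
    exact hne m hmre (hinter m hm hpJ)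
  have hpb := (hbd p (Or.inr hpJ)).2.1
  let z₀ : ℂ := ⟨0, (p.im + m.im) / 2⟩
  have hz₀1 : p.im < z₀.im := by simp only [z₀]; linarith
  have hz₀2 : z₀.im < m.im := by simp only [z₀]; linarith
  have hz₀J : z₀ ∈ (J₁ ∪ J₂)ᶜ := by
    rintro (h | h)
    · exact absurd (hmbot z₀ ⟨h, rfl⟩) (not_le.2 hz₀2)
    · exact absurd (hptop z₀ ⟨h, rfl, hz₀2.le⟩) (not_le.2 hz₀1)
  have h3 : (3 : ℂ) ∈ (J₁ ∪ J₂)ᶜ := by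
    intro h
    have := (hbd _ h).1.2
    norm_num at this
  have hpc : IsPathConnected (J₁ ∪ J₂)ᶜ :=
    ((hJ₁.union hJ₂).isClosed.isOpen_compl.isConnected_iff_isPathConnected).1 ⟨⟨_, hz₀J⟩, hcon⟩
  obtain ⟨w, hwJ, ⟨hwre, hwim⟩, hwex, hzw⟩ := exists_exit_point (hpc.joinedIn _ hz₀J _ h3)
    ⟨by simp [z₀], abs_lt.2 ⟨by linarith, by linarith⟩⟩ (by norm_num)
  rw [abs_le] at hwre hwim
  set Ec : Set ℂ := {z | (|z.re| ≤ 1 ∧ |z.im| ≤ 2) ∧ z ∈ (J₁ ∪ J₂)ᶜ} with hEc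
  have hw1 : -2 < w.im → w.im < 2 → w.re = 1 ∨ w.re = -1 := by
    intro h1 h2
    by_contra! hc
    exact hwex ⟨abs_lt.2 ⟨lt_of_le_of_ne hwre.1 hc.2.symm, lt_of_le_of_ne hwre.2 hc.1⟩,
      abs_lt.2 ⟨h1, h2⟩⟩
  have hwim0 : w.im ≠ 0 := by
    intro h
    have hm1 := hj₁.source_mem
    have hm2 := hj₁.target_mem
    rcases hw1 (by rw [h]; norm_num) (by rw [h]; norm_num) with h' | h'
    · exact hwJ (Or.inl (by rwa [
      show w = 1 from Complex.ext (by simpa using h') (by simpa using h)]))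
    · exact hwJ (Or.inl (by rwa [
      show w = -1 from Complex.ext (by simpa using h') (by simpa using h)]))
  rcases lt_or_gt_of_ne hwim0 with hneg | hpos
  · -- exit through the lower half
    have hv : JoinedIn Ec w ⟨w.re, -2⟩ := by
      refine (joinedIn_vertical (x := w.re) (a := -2) (b := w.im) (z := w) (w := ⟨w.re, -2⟩) rfl rfl
        ⟨hwim.1, le_rfl⟩ ⟨le_rfl, hwim.1⟩).mono ?_
      rintro z ⟨h1, h2, h4⟩
      refine ⟨⟨by rw [h1]; exact abs_le.2 hwre, abs_le.2 ⟨h2, by linarith⟩⟩, fun hz => ?_⟩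
      obtain ⟨-, h5, h6⟩ := hbd z hz
      have := h6 (by rw [h1]; exact hw1 (by linarith) (by linarith))
      linarith
    have hh : JoinedIn Ec ⟨w.re, -2⟩ ⟨0, -2⟩ := by
      refine (joinedIn_horizontal (y := -2) (a := -1) (b := 1) (z := ⟨w.re, -2⟩) (w := ⟨0, -2⟩) rfl rfl
        hwre (by norm_num)).mono ?_
      rintro z ⟨h1, h2⟩
      refine ⟨⟨abs_le.2 h2, by rw [h1]; norm_num⟩, fun hz => ?_⟩
      have := (hbd z hz).2.1.1
      linarith
    have hmz : JoinedIn {u : ℂ | u.re = 0 ∧ u.im ∈ Icc z₀.im m.im} m z₀ :=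
      joinedIn_vertical hmre rfl ⟨hz₀2.le, le_rfl⟩ ⟨le_rfl, hz₀2.le⟩
    have hfull := ((hA_join.mono subset_union_left).trans (hmz.mono subset_union_right)).mono
      (subset_union_left (t := Ec)) |>.trans
        (((hzw.trans hv).trans hh).mono subset_union_right)
    obtain ⟨z, hzJ, (hz | hz) | hz⟩ := hj₂.inter_nonempty_of_crossing hfull.symm
      (by
        rintro z ((hz | hz) | hz)
        · simpa using hA_re z hz
        · rw [hz.1]; norm_num
        · simpa using abs_le.1 hz.1.1) (by simpa using hJ₂im)
    · exact hA z hzJ hz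
    · have := hptop z ⟨hzJ, hz.1, hz.2.2⟩
      have := hz.2.1
      linarith
    · exact hz.2 (Or.inr hzJ)
  · have hv : JoinedIn Ec w ⟨w.re, 2⟩ := by
      refine (joinedIn_vertical (x := w.re) (a := w.im) (b := 2) (z := w) (w := ⟨w.re, 2⟩) rfl rfl
        ⟨le_rfl, hwim.2⟩ ⟨hwim.2, le_rfl⟩).mono ?_
      rintro z ⟨h1, h2, h4⟩
      refine ⟨⟨by rw [h1]; exact abs_le.2 hwre, abs_le.2 ⟨by linarith, h4⟩⟩, fun hz => ?_⟩
      obtain ⟨-, h5, h6⟩ := hbd z hz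
      have := h6 (by rw [h1]; exact hw1 (by linarith) (by linarith))
      linarith
    have hh : JoinedIn Ec ⟨w.re, 2⟩ ⟨0, 2⟩ := by
      refine (joinedIn_horizontal (y := 2) (a := -1) (b := 1) (z := ⟨w.re, 2⟩) (w := ⟨0, 2⟩) rfl rfl
        hwre (by norm_num)).mono ?_
      rintro z ⟨h1, h2⟩
      refine ⟨⟨abs_le.2 h2, by rw [h1]; norm_num⟩, fun hz => ?_⟩
      have := (hbd z hz).2.1.2
      linarith
    have hsz : JoinedIn {u : ℂ | u.re = 0 ∧ u.im ∈ Icc (-2) z₀.im} ⟨0, -2⟩ z₀ :=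
      joinedIn_vertical rfl rfl ⟨le_rfl, by linarith⟩ ⟨by linarith, le_rfl⟩
    have hfull := (hsz.mono subset_union_left).trans
      (((hzw.trans hv).trans hh).mono subset_union_right)
    obtain ⟨z, hzJ, hz | hz⟩ := hj₁.inter_nonempty_of_crossing hfull
      (by
        rintro z (hz | hz)
        · rw [hz.1]; norm_num
        · simpa using abs_le.1 hz.1.1) (by simpa using hJ₁im)
    · have := hmbot z ⟨hzJ, hz.1⟩
      have := hz.2.2
      linarith
    · exact hz.2 (Or.inl hzJ)

lemma not_isPreconnected_compl_of_arcs {J₁ J₂ : Set ℂ} (hJ₁ : IsCompact J₁) (hJ₂ : IsCompact J₂)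
    (hj₁ : JoinedIn J₁ (-1) 1) (hj₂ : JoinedIn J₂ (-1) 1)
    (hinter : ∀ z ∈ J₁, z ∈ J₂ → z = -1 ∨ z = 1)
    (hp₁ : IsPathConnected (J₁ \ {-1, 1})) (hp₂ : IsPathConnected (J₂ \ {-1, 1}))
    (hb : ∀ z ∈ J₁ ∪ J₂, ‖z - 1‖ ≤ 2 ∧ ‖z + 1‖ ≤ 2) : ¬ IsPreconnected (J₁ ∪ J₂)ᶜ := by
  have hvcl : IsClosed {z : ℂ | z.re = 0} := isClosed_eq Complex.continuous_re continuous_const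
  have hne : ((J₁ ∪ J₂) ∩ {z : ℂ | z.re = 0}).Nonempty := by
    obtain ⟨z, hz, hz'⟩ := hj₁.inter_nonempty_of_crossing
      (joinedIn_vertical (x := 0) (a := -2) (b := 2) (z := ⟨0, -2⟩) (w := ⟨0, 2⟩) rfl rfl
        (by norm_num) (by norm_num))
      (by rintro z ⟨h, -⟩; rw [h]; norm_num)
      (fun z hz => by
        have := (re_im_bounds_of_norm_le_two (hb z (Or.inl hz)).1 (hb z (Or.inl hz)).2).2.1
        exact ⟨this.1.le, this.2.le⟩)
    exact ⟨z, Or.inl hz, hz'.1⟩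
  obtain ⟨l, ⟨hl, hlre⟩, hltop⟩ := exists_isGreatest_im ((hJ₁.union hJ₂).inter_right hvcl) hne
  rcases hl with hl | hl
  · exact not_isPreconnected_compl_of_arcs_aux hJ₁ hJ₂ hj₁ hj₂ hinter hp₁ hb hl hlre
      fun z hz h => hltop z ⟨hz, h⟩
  · rw [union_comm]
    exact not_isPreconnected_compl_of_arcs_aux hJ₂ hJ₁ hj₂ hj₁ (fun z h1 h2 => hinter z h2 h1) hp₂
      (fun z hz => hb z (Or.symm hz)) hl hlre fun z hz h => hltop z ⟨Or.symm hz, h⟩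

lemma not_isPreconnected_compl_of_curve_aux {γ : ℝ → ℂ} {τ : ℝ} (hγ : Continuous γ)
    (hτ : τ ∈ Ioo (0 : ℝ) 1) (hinj : InjOn γ (Ico 0 1)) (h0 : γ 0 = -1) (h1 : γ 1 = -1)
    (hτ1 : γ τ = 1) (hb : ∀ z ∈ γ '' Icc 0 1, ‖z - 1‖ ≤ 2 ∧ ‖z + 1‖ ≤ 2) :
    ¬ IsPreconnected (γ '' Icc 0 1)ᶜ := by
  have hU : γ '' Icc 0 1 = γ '' Icc 0 τ ∪ γ '' Icc τ 1 := by
    rw [← image_union, Icc_union_Icc_eq_Icc hτ.1.le hτ.2.le]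
  have hd1 : γ '' Icc 0 τ \ {-1, 1} = γ '' Ioo 0 τ := by
    ext z; constructor
    · rintro ⟨⟨t, ht, rfl⟩, hz⟩
      refine ⟨t, ⟨lt_of_le_of_ne ht.1 ?_, lt_of_le_of_ne ht.2 ?_⟩, rfl⟩
      · rintro rfl; exact hz (Or.inl h0)
      · rintro rfl; exact hz (Or.inr hτ1)
    · rintro ⟨t, ht, rfl⟩
      refine ⟨⟨t, Ioo_subset_Icc_self ht, rfl⟩, ?_⟩
      have ht' : t ∈ Ico (0 : ℝ) 1 := ⟨ht.1.le, ht.2.trans hτ.2⟩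
      rintro (h | h)
      · exact ht.1.ne' (hinj ht' (by simp) (h.trans h0.symm))
      · exact ht.2.ne (hinj ht' ⟨hτ.1.le, hτ.2⟩ (Eq.trans h hτ1.symm))
  have hd2 : γ '' Icc τ 1 \ {-1, 1} = γ '' Ioo τ 1 := by
    ext z; constructor
    · rintro ⟨⟨t, ht, rfl⟩, hz⟩
      refine ⟨t, ⟨lt_of_le_of_ne ht.1 ?_, lt_of_le_of_ne ht.2 ?_⟩, rfl⟩
      · rintro rfl; exact hz (Or.inr hτ1)
      · rintro rfl; exact hz (Or.inl h1)
    · rintro ⟨t, ht, rfl⟩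
      refine ⟨⟨t, Ioo_subset_Icc_self ht, rfl⟩, ?_⟩
      have ht' : t ∈ Ico (0 : ℝ) 1 := ⟨hτ.1.le.trans ht.1.le, ht.2⟩
      rintro (h | h)
      · exact (hτ.1.trans ht.1).ne' (hinj ht' (by simp) (h.trans h0.symm))
      · exact ht.1.ne' (hinj ht' ⟨hτ.1.le, hτ.2⟩ (Eq.trans h hτ1.symm))
  have hpc : ∀ {a b : ℝ}, a ≤ b → IsPathConnected (γ '' Icc a b) := fun {a b} h =>
    ((convex_Icc a b).isPathConnected (nonempty_Icc.2 h)).image hγ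
  have hpo : ∀ {a b : ℝ}, a < b → IsPathConnected (γ '' Ioo a b) := fun {a b} h =>
    ((convex_Ioo a b).isPathConnected (nonempty_Ioo.2 h)).image hγ
  rw [hU]
  refine not_isPreconnected_compl_of_arcs (isCompact_Icc.image hγ) (isCompact_Icc.image hγ)
    ?_ ?_ ?_ ?_ ?_ (by rwa [← hU])
  · exact (hpc hτ.1.le).joinedIn _ ⟨0, ⟨le_rfl, hτ.1.le⟩, h0⟩ _ ⟨τ, ⟨hτ.1.le, le_rfl⟩, hτ1⟩
  · exact (hpc hτ.2.le).joinedIn _ ⟨1, ⟨hτ.2.le, le_rfl⟩, h1⟩ _ ⟨τ, ⟨le_rfl, hτ.2.le⟩, hτ1⟩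
  · rintro _ ⟨s, hs, rfl⟩ ⟨t, ht, hst⟩
    rcases ht.2.eq_or_lt with rfl | ht1
    · left; rw [← hst, h1]
    · have := hinj ⟨hτ.1.le.trans ht.1, ht1⟩ ⟨hs.1, hs.2.trans_lt hτ.2⟩ hst
      have : s = τ := le_antisymm hs.2 (this ▸ ht.1)
      right; rw [this, hτ1]
  · rw [hd1]; exact hpo hτ.1
  · rw [hd2]; exact hpo hτ.2

/-- A simple closed curve separates the plane. -/
lemma not_isPreconnected_compl_of_closed_curve {γ : ℝ → ℂ} (hγ : Continuous γ)
    (hper : Function.Periodic γ 1) (hinj : InjOn γ (Ico 0 1)) :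
    ¬ IsPreconnected (range γ)ᶜ := by
  have himg : ∀ a, γ '' Icc a (a + 1) = range γ := fun a => hper.image_Icc one_pos a
  have hinj' : ∀ a, InjOn γ (Ico a (a + 1)) := by
    intro a s hs t ht hst
    have key : ∀ x, γ (Int.fract x) = γ x := fun x => by
      have := hper.sub_int_mul_eq (x := x) (n := ⌊x⌋)
      rwa [mul_one] at this
    have h1 := hinj ⟨Int.fract_nonneg s, Int.fract_lt_one s⟩ ⟨Int.fract_nonneg t, Int.fract_lt_one t⟩
      ((key s).trans (hst.trans (key t).symm))
    obtain ⟨n, hn⟩ := Int.fract_eq_fract.1 h1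
    have h2 : (n : ℝ) < 1 := by linarith [hs.2, ht.1]
    have h3 : (-1 : ℝ) < n := by linarith [hs.1, ht.2]
    have h4 : n = 0 := by
      have h2' : n < 1 := by exact_mod_cast h2
      have h3' : -1 < n := by exact_mod_cast h3
      omega
    rw [h4] at hn; simp at hn; linarith
  have hcomp : IsCompact (range γ) := himg 0 ▸ isCompact_Icc.image hγ
  obtain ⟨⟨a, b⟩, ⟨⟨s, rfl⟩, hbm⟩, hmax⟩ := (hcomp.prod hcomp).exists_isMaxOn
    ⟨(γ 0, γ 0), mem_range_self _, mem_range_self _⟩ (f := fun x : ℂ × ℂ => dist x.1 x.2)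
    (by fun_prop)
  have hmax' : ∀ x y, dist (γ x) (γ y) ≤ dist (γ s) b := fun x y =>
    hmax (show (γ x, γ y) ∈ range γ ×ˢ range γ from ⟨mem_range_self _, mem_range_self _⟩)
  rw [← himg s] at hbm
  obtain ⟨t, ht, rfl⟩ := hbm
  have hd : 0 < dist (γ s) (γ t) := by
    refine lt_of_lt_of_le (dist_pos.2 fun h => ?_) (hmax' 0 (1 / 2))
    have := hinj (by simp) ⟨by norm_num, by norm_num⟩ h
    norm_num at this
  have hne : γ s ≠ γ t := dist_pos.1 hd
  have hts : t ≠ s := fun h => hne (by rw [h])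
  have hts' : t ≠ s + 1 := fun h => hne (by rw [h, hper])
  set a := γ s with ha
  set b := γ t with hb
  have hba : b - a ≠ 0 := sub_ne_zero.2 hne.symm
  let φ : ℂ → ℂ := fun z => (2 * z - (a + b)) / (b - a)
  have hφ : Continuous φ := by fun_prop
  let ψ : ℂ → ℂ := fun w => (w * (b - a) + (a + b)) / 2
  have hψ : Continuous ψ := by fun_prop
  have hψφ : ∀ z, ψ (φ z) = z := fun z => by simp only [φ, ψ]; field_simp; ring
  have hφψ : ∀ z, φ (ψ z) = z := fun z => by simp only [φ, ψ]; field_simp; ring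
  have hφa : φ a = -1 := by simp only [φ]; field_simp; ring
  have hφb : φ b = 1 := by simp only [φ]; field_simp; ring
  have hdist : ∀ z w, ‖φ z - φ w‖ = 2 * dist z w / dist a b := fun z w => by
    have : φ z - φ w = 2 * (z - w) / (b - a) := by simp only [φ]; field_simp; ring
    rw [this, norm_div, norm_mul, dist_eq_norm, dist_comm, dist_eq_norm]; norm_num
  have hle : ∀ x y, ‖φ (γ x) - φ (γ y)‖ ≤ 2 := fun x y => by
    rw [hdist, div_le_iff₀ hd]
    linarith [hmax' x y]
  intro hcon
  have himφ : (fun x => φ (γ (s + x))) '' Icc 0 1 = φ '' range γ := by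
    rw [← himg s, image_image, show Icc s (s + 1) = (fun x => s + x) '' Icc 0 1 by simp [add_comm],
      image_image]
  refine not_isPreconnected_compl_of_curve_aux (γ := fun x => φ (γ (s + x))) (τ := t - s)
    (by fun_prop) ⟨sub_pos.2 (lt_of_le_of_ne ht.1 hts.symm), ?_⟩ ?_ ?_ ?_ ?_ ?_ ?_
  · linarith [lt_of_le_of_ne ht.2 hts']
  · intro x hx y hy hxy
    have h1 : γ (s + x) = γ (s + y) := by
      have := congrArg ψ hxy
      simpa [hψφ] using this
    have := hinj' s ⟨by linarith [hx.1], by linarith [hx.2]⟩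
      ⟨by linarith [hy.1], by linarith [hy.2]⟩ h1
    linarith
  · simpa using hφa
  · simpa [hper s] using hφa
  · simpa using hφb
  · rw [himφ]
    rintro _ ⟨_, ⟨x, rfl⟩, rfl⟩
    refine ⟨by rw [← hφb]; exact hle _ _, ?_⟩
    have := hle x s
    rwa [← ha, hφa, sub_neg_eq_add] at this
  · rw [himφ]
    have : (φ '' range γ)ᶜ = φ '' (range γ)ᶜ :=
      (image_compl_eq ⟨Function.LeftInverse.injective hψφ, Function.RightInverse.surjective hφψ⟩).symm
    rw [this]
    exact hcon.image _ hφ.continuousOn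

/-- Lifts to the line of orientation preserving homeomorphisms of the circle. -/
structure IsCircleLift (h : ℝ → ℝ) : Prop where
  continuous : Continuous h
  strictMono : StrictMono h
  add_two_pi : ∀ x, h (x + 2 * Real.pi) = h x + 2 * Real.pi

lemma exp_mul_I_eq_exp_mul_I_iff {x y : ℝ} :
    Complex.exp (x * Complex.I) = Complex.exp (y * Complex.I) ↔
      ∃ n : ℤ, x = y + n * (2 * Real.pi) := by
  rw [Complex.exp_eq_exp_iff_exists_int]
  refine exists_congr fun n => ⟨fun h => ?_, fun h => ?_⟩
  · have := congrArg Complex.im h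
    simpa using this
  · rw [h]; push_cast; ring

namespace IsCircleLift

variable {h : ℝ → ℝ}

lemma add_int_mul (H : IsCircleLift h) (x : ℝ) (n : ℤ) :
    h (x + n * (2 * Real.pi)) = h x + n * (2 * Real.pi) := by
  have hp : Function.Periodic (fun x => h x - x) (2 * Real.pi) := fun x => by
    simp only [H.add_two_pi]; ring
  have := hp.int_mul n x
  linarith

lemma exists_floor (H : IsCircleLift h) (a : ℝ) : ∃ n : ℤ, h (n * (2 * Real.pi)) ≤ a ∧
    a ≤ h ((n + 1 : ℤ) * (2 * Real.pi)) := by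
  have hpi := Real.two_pi_pos
  refine ⟨⌊(a - h 0) / (2 * Real.pi)⌋, ?_, ?_⟩
  · have h1 := H.add_int_mul 0 ⌊(a - h 0) / (2 * Real.pi)⌋
    rw [zero_add] at h1
    rw [h1]
    have h2 := Int.floor_le ((a - h 0) / (2 * Real.pi))
    rw [le_div_iff₀ hpi] at h2
    linarith
  · have h1 := H.add_int_mul 0 (⌊(a - h 0) / (2 * Real.pi)⌋ + 1)
    rw [zero_add] at h1
    rw [h1]
    have h2 := (Int.lt_floor_add_one ((a - h 0) / (2 * Real.pi))).le
    rw [div_le_iff₀ hpi] at h2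
    push_cast
    linarith

lemma surjective (H : IsCircleLift h) : Function.Surjective h := by
  intro a
  obtain ⟨n, h1, h2⟩ := H.exists_floor a
  exact mem_range_of_exists_le_of_exists_ge H.continuous ⟨_, h1⟩ ⟨_, h2⟩

lemma abs_sub_sub_le (H : IsCircleLift h) (a b : ℝ) :
    |h a - h b - (a - b)| ≤ 2 * Real.pi := by
  have hpi := Real.two_pi_pos
  set n := ⌊(a - b) / (2 * Real.pi)⌋
  have h1 := Int.floor_le ((a - b) / (2 * Real.pi))
  have h2 := (Int.lt_floor_add_one ((a - b) / (2 * Real.pi))).le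
  rw [le_div_iff₀ hpi] at h1
  rw [div_le_iff₀ hpi] at h2
  have h3 : h (b + n * (2 * Real.pi)) ≤ h a := H.strictMono.monotone (by linarith)
  have h4 : h a ≤ h (b + (n + 1 : ℤ) * (2 * Real.pi)) :=
    H.strictMono.monotone (by push_cast; linarith)
  rw [H.add_int_mul] at h3 h4
  push_cast at h4
  rw [abs_le]; constructor <;> linarith

end IsCircleLift

lemma isCircleLift_of_lt {h : ℝ → ℝ} (hc : Continuous h)
    (hiff : ∀ x y, (∃ n : ℤ, h x = h y + n * (2 * Real.pi)) ↔
      ∃ n : ℤ, x = y + n * (2 * Real.pi))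
    (hlt : ∀ x s, s ∈ Ioo 0 (2 * Real.pi) → h x < h (x + s)) : IsCircleLift h := by
  have hpi := Real.pi_pos
  have key : ∀ n : ℕ, ∀ x s, 0 < s → s ≤ (n + 1) * Real.pi → h x < h (x + s) := by
    intro n
    induction n with
    | zero => intro x s hs hs'; exact hlt x s ⟨hs, by push_cast at hs'; linarith⟩
    | succ n ih =>
      intro x s hs hs'
      rcases le_or_gt s Real.pi with h1 | h1
      · exact hlt x s ⟨hs, by linarith⟩
      · have h2 := ih (x + Real.pi) (s - Real.pi) (by linarith) (by push_cast at hs'; linarith)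
        have h3 := hlt x Real.pi ⟨hpi, by linarith⟩
        rw [show x + Real.pi + (s - Real.pi) = x + s by ring] at h2
        exact h3.trans h2
  have hmono : StrictMono h := by
    intro x y hxy
    obtain ⟨n, hn⟩ := exists_nat_gt ((y - x) / Real.pi)
    rw [div_lt_iff₀ hpi] at hn
    have := key n x (y - x) (by linarith) (by linarith)
    rwa [add_sub_cancel] at this
  refine ⟨hc, hmono, fun x => ?_⟩
  obtain ⟨n, hn⟩ := (hiff (x + 2 * Real.pi) x).2 ⟨1, by simp⟩
  have h1 : h x < h (x + 2 * Real.pi) := hmono (by linarith)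
  have hn0 : 0 < n := by
    have : (0 : ℝ) < n * (2 * Real.pi) := by linarith
    have := pos_of_mul_pos_left this Real.two_pi_pos.le
    exact_mod_cast this
  rcases (show n = 1 ∨ 2 ≤ n by omega) with rfl | hn2
  · simpa using hn
  · exfalso
    have hn2' : (2 : ℝ) ≤ n := by exact_mod_cast hn2
    have h2 : h x + 2 * Real.pi < h (x + 2 * Real.pi) := by rw [hn]; nlinarith
    obtain ⟨y, hy, hyx⟩ := intermediate_value_Ioo (show x ≤ x + 2 * Real.pi by linarith)
      hc.continuousOn ⟨show h x < h x + 2 * Real.pi by linarith, h2⟩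
    obtain ⟨k, hk⟩ := (hiff y x).1 ⟨1, by rw [hyx]; simp⟩
    have k1 : (0 : ℝ) < k := by
      have : (0 : ℝ) < k * (2 * Real.pi) := by linarith [hy.1]
      exact pos_of_mul_pos_left this Real.two_pi_pos.le
    have k2 : (k : ℝ) < 1 := by
      have : (k : ℝ) * (2 * Real.pi) < 1 * (2 * Real.pi) := by linarith [hy.2]
      exact lt_of_mul_lt_mul_right this Real.two_pi_pos.le
    have k1' : 0 < k := by exact_mod_cast k1
    have k2' : k < 1 := by exact_mod_cast k2
    omega

lemma exp_mul_I_mem_sphere (x : ℝ) : Complex.exp (x * Complex.I) ∈ sphere (0 : ℂ) 1 := by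
  simp [Complex.norm_exp_ofReal_mul_I]

lemma exists_exp_mul_I_eq {z : ℂ} (hz : z ∈ sphere (0 : ℂ) 1) :
    ∃ x : ℝ, Complex.exp (x * Complex.I) = z := by
  refine ⟨z.arg, ?_⟩
  have := Complex.norm_mul_exp_arg_mul_I z
  rwa [mem_sphere_zero_iff_norm.1 hz, Complex.ofReal_one, one_mul] at this

/-- An injective continuous self-map of the circle lifts to a homeomorphism of the line. -/
lemma exists_circleLift {g : ℂ → ℂ} (hg : ContinuousOn g (sphere 0 1))
    (hmaps : MapsTo g (sphere 0 1) (sphere 0 1)) (hinj : InjOn g (sphere 0 1)) :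
    ∃ h : ℝ → ℝ, (∀ x : ℝ, g (Complex.exp (x * Complex.I)) = Complex.exp (h x * Complex.I)) ∧
      (IsCircleLift h ∨ IsCircleLift fun x => -h x) := by
  have hcontD : Continuous fun x : ℝ => g (Complex.exp (x * Complex.I)) :=
    hg.comp_continuous (by fun_prop) exp_mul_I_mem_sphere
  have hnorm : ∀ x : ℝ, ‖g (Complex.exp (x * Complex.I))‖ = 1 := fun x =>
    mem_sphere_zero_iff_norm.1 (hmaps (exp_mul_I_mem_sphere x))
  have hsc : IsSimplyConnected (univ : Set ℝ) := by
    have : ContractibleSpace (univ : Set ℝ) := Convex.contractibleSpace convex_univ univ_nonempty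
    exact SimplyConnectedSpace.ofContractible _
  obtain ⟨L, hLc, hL⟩ := Complex.exists_continuousOn_eqOn_exp_comp hsc isOpen_univ
    hcontD.continuousOn (by
      rintro ⟨x, -, hx⟩
      have := hnorm x
      simp only at hx
      rw [hx] at this; simp at this)
  rw [continuousOn_univ] at hLc
  have hL' : ∀ x, Complex.exp (L x) = g (Complex.exp (x * Complex.I)) := fun x => hL (mem_univ x)
  let h : ℝ → ℝ := fun x => (L x).im
  have hh : Continuous h := by fun_prop
  have hgh : ∀ x : ℝ, g (Complex.exp (x * Complex.I)) = Complex.exp (h x * Complex.I) := by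
    intro x
    have h1 : (L x).re = 0 := by
      have := hnorm x
      rwa [← hL', Complex.norm_exp, Real.exp_eq_one_iff] at this
    rw [← hL', ← Complex.re_add_im (L x), h1]
    simp [h]
  have hiff : ∀ x y, (∃ n : ℤ, h x = h y + n * (2 * Real.pi)) ↔
      ∃ n : ℤ, x = y + n * (2 * Real.pi) := by
    intro x y
    rw [← exp_mul_I_eq_exp_mul_I_iff, ← exp_mul_I_eq_exp_mul_I_iff, ← hgh, ← hgh]
    exact hinj.eq_iff (exp_mul_I_mem_sphere x) (exp_mul_I_mem_sphere y)
  refine ⟨h, hgh, ?_⟩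
  have hne : ∀ x s, s ∈ Ioo 0 (2 * Real.pi) → h (x + s) - h x ≠ 0 := by
    intro x s hs h0
    obtain ⟨k, hk⟩ := (hiff (x + s) x).1 ⟨0, by simp; linarith⟩
    have k1 : (0 : ℝ) < k := by
      have : (0 : ℝ) < k * (2 * Real.pi) := by linarith [hs.1]
      exact pos_of_mul_pos_left this Real.two_pi_pos.le
    have k2 : (k : ℝ) < 1 := by
      have : (k : ℝ) * (2 * Real.pi) < 1 * (2 * Real.pi) := by linarith [hs.2]
      exact lt_of_mul_lt_mul_right this Real.two_pi_pos.le
    have k1' : 0 < k := by exact_mod_cast k1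
    have k2' : k < 1 := by exact_mod_cast k2
    omega
  have hpre : IsPreconnected ((univ : Set ℝ) ×ˢ Ioo 0 (2 * Real.pi)) :=
    isPreconnected_univ.prod isPreconnected_Ioo
  have hP : ContinuousOn (fun p : ℝ × ℝ => h (p.1 + p.2) - h p.1)
      ((univ : Set ℝ) ×ˢ Ioo 0 (2 * Real.pi)) := by fun_prop
  have hsign : (∀ x s, s ∈ Ioo 0 (2 * Real.pi) → 0 < h (x + s) - h x) ∨
      (∀ x s, s ∈ Ioo 0 (2 * Real.pi) → h (x + s) - h x < 0) := by
    by_contra! hcon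
    obtain ⟨⟨x, s, hs, h1⟩, y, t, ht, h2⟩ := hcon
    obtain ⟨⟨z, u⟩, ⟨-, hu⟩, hz⟩ := hpre.intermediate_value (a := (x, s)) (b := (y, t))
      ⟨mem_univ _, hs⟩ ⟨mem_univ _, ht⟩ hP ⟨h1, h2⟩
    exact hne z u hu hz
  rcases hsign with hs | hs
  · exact Or.inl (isCircleLift_of_lt hh hiff fun x s hss => by linarith [hs x s hss])
  · refine Or.inr (isCircleLift_of_lt (h := fun x => -h x) hh.neg (fun x y => ?_) fun x s hss => by
      linarith [hs x s hss])
    rw [← hiff x y]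
    constructor
    · rintro ⟨n, hn⟩; exact ⟨-n, by push_cast; linarith⟩
    · rintro ⟨n, hn⟩; exact ⟨-n, by push_cast; linarith⟩

lemma surjOn_sphere_of_injOn {g : ℂ → ℂ} (hg : ContinuousOn g (sphere 0 1))
    (hmaps : MapsTo g (sphere 0 1) (sphere 0 1)) (hinj : InjOn g (sphere 0 1)) :
    SurjOn g (sphere 0 1) (sphere 0 1) := by
  obtain ⟨h, hgh, hh⟩ := exists_circleLift hg hmaps hinj
  intro z hz
  obtain ⟨a, rfl⟩ := exists_exp_mul_I_eq hz
  obtain ⟨x, hx⟩ : ∃ x, h x = a := by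
    rcases hh with hh | hh
    · exact hh.surjective a
    · obtain ⟨x, hx⟩ := hh.surjective (-a)
      exact ⟨x, neg_injective hx⟩
  exact ⟨_, exp_mul_I_mem_sphere x, by rw [hgh, hx]⟩

/-- A map is weakly quasisymmetric on `X` with constant `M`. -/
def WeaklyQuasisymmetricOn (M : ℝ) (f : ℂ → ℂ) (X : Set ℂ) : Prop :=
  ∀ p ∈ X, ∀ q ∈ X, ∀ s ∈ X, dist p q ≤ dist p s → dist (f p) (f q) ≤ M * dist (f p) (f s)

/-- Circle lifts satisfying the Beurling-Ahlfors condition with constant `M`. -/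
structure IsQuasisymmetricLift (M : ℝ) (h : ℝ → ℝ) : Prop extends IsCircleLift h where
  forward_le : ∀ x t, 0 ≤ t → h (x + t) - h x ≤ M * (h x - h (x - t))
  backward_le : ∀ x t, 0 ≤ t → h x - h (x - t) ≤ M * (h (x + t) - h x)

lemma dist_exp_mul_I (a b : ℝ) :
    dist (Complex.exp (a * Complex.I)) (Complex.exp (b * Complex.I)) =
      |2 * Real.sin ((a - b) / 2)| := by
  have h1 : Complex.exp (a * Complex.I) - Complex.exp (b * Complex.I) =
      Complex.exp (b * Complex.I) * (Complex.exp (Complex.I * ((a - b : ℝ) : ℂ)) - 1) := by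
    rw [mul_sub, ← Complex.exp_add, mul_one]
    congr 2
    push_cast; ring
  rw [dist_eq_norm, h1, norm_mul, Complex.norm_exp_ofReal_mul_I, one_mul,
    Complex.norm_exp_I_mul_ofReal_sub_one, Real.norm_eq_abs]

lemma dist_exp_mul_I_le (a b : ℝ) :
    dist (Complex.exp (a * Complex.I)) (Complex.exp (b * Complex.I)) ≤ |a - b| := by
  rw [dist_exp_mul_I, abs_mul, abs_two]
  have := Real.abs_sin_le_abs (x := (a - b) / 2)
  rw [abs_div, abs_two] at this
  linarith

lemma dist_exp_add_mul_I (x : ℝ) {t : ℝ} (ht0 : 0 ≤ t) (ht : t ≤ 2 * Real.pi) :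
    dist (Complex.exp ((x + t : ℝ) * Complex.I)) (Complex.exp (x * Complex.I)) =
      2 * Real.sin (t / 2) := by
  rw [dist_exp_mul_I, add_sub_cancel_left, abs_of_nonneg]
  have := Real.sin_nonneg_of_nonneg_of_le_pi (x := t / 2) (by linarith) (by linarith)
  linarith

lemma le_dist_exp_add_mul_I (x : ℝ) {t : ℝ} (ht0 : 0 ≤ t) (ht : t ≤ Real.pi) :
    t ≤ Real.pi / 2 *
      dist (Complex.exp ((x + t : ℝ) * Complex.I)) (Complex.exp (x * Complex.I)) := by
  have hpi := Real.pi_pos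
  rw [dist_exp_add_mul_I x ht0 (by linarith)]
  have := Real.mul_le_sin (x := t / 2) (by linarith) (by linarith)
  calc t = Real.pi / 2 * (2 * (2 / Real.pi * (t / 2))) := by field_simp
    _ ≤ _ := by gcongr

lemma dist_exp_add_mul_I_mono (x : ℝ) {s t : ℝ} (hs : 0 ≤ s) (hst : s ≤ t) (ht : t ≤ Real.pi) :
    dist (Complex.exp ((x + s : ℝ) * Complex.I)) (Complex.exp (x * Complex.I)) ≤
    dist (Complex.exp ((x + t : ℝ) * Complex.I)) (Complex.exp (x * Complex.I)) := by
  have hpi := Real.pi_pos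
  rw [dist_exp_add_mul_I x hs (by linarith), dist_exp_add_mul_I x (by linarith) (by linarith)]
  have := Real.sin_le_sin_of_le_of_le_pi_div_two (x := s / 2) (y := t / 2) (by linarith)
    (by linarith) (by linarith)
  linarith

/-- The length of an image arc is controlled by its chord. -/
lemma IsCircleLift.sub_le_mul_dist {h : ℝ → ℝ} (H : IsCircleLift h) {g : ℂ → ℂ} {M : ℝ}
    (hM : 1 ≤ M) (hgh : ∀ x : ℝ, g (Complex.exp (x * Complex.I)) = Complex.exp (h x * Complex.I))
    (hg : WeaklyQuasisymmetricOn M g (sphere 0 1)) (x : ℝ) {t : ℝ} (ht0 : 0 ≤ t)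
    (ht : t ≤ Real.pi) :
    h (x + t) - h x ≤ Real.pi * M * dist (g (Complex.exp ((x + t : ℝ) * Complex.I)))
      (g (Complex.exp (x * Complex.I))) := by
  have hpi := Real.pi_pos
  have hD0 : h x ≤ h (x + t) := H.strictMono.monotone (by linarith)
  have hD1 : h (x + t) ≤ h x + 2 * Real.pi := by
    rw [← H.add_two_pi]; exact H.strictMono.monotone (by linarith)
  set d := dist (g (Complex.exp ((x + t : ℝ) * Complex.I))) (g (Complex.exp (x * Complex.I)))
    with hd
  have hd0 : 0 ≤ d := dist_nonneg
  rcases le_or_gt (h (x + t) - h x) Real.pi with hle | hgt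
  · have := le_dist_exp_add_mul_I (h x) (t := h (x + t) - h x) (by linarith) hle
    rw [add_sub_cancel, ← hgh, ← hgh, ← hd] at this
    nlinarith [mul_nonneg hpi.le hd0, mul_nonneg (mul_nonneg hpi.le hd0) (sub_nonneg.2 hM)]
  · obtain ⟨m, hm, hmx⟩ := intermediate_value_Icc (show x ≤ x + t by linarith)
      H.continuous.continuousOn (show (h x + h (x + t)) / 2 ∈ Icc (h x) (h (x + t)) by
        constructor <;> linarith)
    have h1 := le_dist_exp_add_mul_I (h x) (t := h m - h x) (by linarith) (by linarith)
    rw [add_sub_cancel, ← hgh, ← hgh] at h1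
    have h2 := dist_exp_add_mul_I_mono x (s := m - x) (t := t) (by linarith [hm.1])
      (by linarith [hm.2]) ht
    rw [add_sub_cancel] at h2
    have h3 := hg _ (exp_mul_I_mem_sphere x) _ (exp_mul_I_mem_sphere m) _
      (exp_mul_I_mem_sphere (x + t)) (by rwa [dist_comm, dist_comm _ (Complex.exp ((x + t : ℝ) * _))])
    rw [dist_comm, dist_comm _ (g (Complex.exp ((x + t : ℝ) * _))), ← hd] at h3
    nlinarith [mul_le_mul_of_nonneg_left h3 hpi.le]

/-- Lifts of weakly quasisymmetric circle maps satisfy the Beurling-Ahlfors condition. -/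
lemma IsCircleLift.isQuasisymmetricLift {h : ℝ → ℝ} (H : IsCircleLift h) {g : ℂ → ℂ} {M : ℝ}
    (hM : 1 ≤ M) (hgh : ∀ x : ℝ, g (Complex.exp (x * Complex.I)) = Complex.exp (h x * Complex.I))
    (hg : WeaklyQuasisymmetricOn M g (sphere 0 1)) :
    IsQuasisymmetricLift (6 * (1 + Real.pi * M ^ 2)) h := by
  have hpi := Real.pi_pos
  have hpiM : 0 < Real.pi * M := by positivity
  have hmono : Monotone h := H.strictMono.monotone
  have heq : ∀ x t : ℝ, dist (Complex.exp (x * Complex.I))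
      (Complex.exp ((x + t : ℝ) * Complex.I)) = dist (Complex.exp (x * Complex.I))
      (Complex.exp ((x - t : ℝ) * Complex.I)) := fun x t => by
    rw [dist_exp_mul_I, dist_exp_mul_I, ← abs_neg, ← mul_neg, ← Real.sin_neg]; congr 3; ring
  have f1 : ∀ x t, 0 ≤ t → t ≤ Real.pi →
      h (x + t) - h x ≤ Real.pi * M ^ 2 * (h x - h (x - t)) := by
    intro x t h0 h1
    have a1 := H.sub_le_mul_dist hM hgh hg x h0 h1
    have a2 := hg _ (exp_mul_I_mem_sphere x) _ (exp_mul_I_mem_sphere (x + t)) _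
      (exp_mul_I_mem_sphere (x - t)) (heq x t).le
    have a3 := dist_exp_mul_I_le (h x) (h (x - t))
    rw [← hgh, ← hgh, abs_of_nonneg (by linarith [hmono (show x - t ≤ x by linarith)])] at a3
    rw [dist_comm] at a1
    calc _ ≤ _ := a1
      _ ≤ Real.pi * M * (M * (h x - h (x - t))) := by gcongr; exact a2.trans (by gcongr)
      _ = _ := by ring
  have f2 : ∀ x t, 0 ≤ t → t ≤ Real.pi →
      h x - h (x - t) ≤ Real.pi * M ^ 2 * (h (x + t) - h x) := by
    intro x t h0 h1
    have a1 := H.sub_le_mul_dist hM hgh hg (x - t) h0 h1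
    rw [sub_add_cancel] at a1
    have a2 := hg _ (exp_mul_I_mem_sphere x) _ (exp_mul_I_mem_sphere (x - t)) _
      (exp_mul_I_mem_sphere (x + t)) (heq x t).ge
    have a3 := dist_exp_mul_I_le (h x) (h (x + t))
    rw [← hgh, ← hgh, abs_sub_comm,
      abs_of_nonneg (by linarith [hmono (show x ≤ x + t by linarith)])] at a3
    calc _ ≤ _ := a1
      _ ≤ Real.pi * M * (M * (h (x + t) - h x)) := by gcongr; exact a2.trans (by gcongr)
      _ = _ := by ring
  set M' := Real.pi * M ^ 2 with hM'
  have hM'0 : 0 ≤ M' := by positivity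
  have hper : ∀ x, h (x + Real.pi) = h (x - Real.pi) + 2 * Real.pi := fun x => by
    rw [← H.add_two_pi]; congr 1; ring
  have up : ∀ x t, h (x + t) - h x ≤ t + 2 * Real.pi ∧ t - 2 * Real.pi ≤ h (x + t) - h x := by
    intro x t
    have := abs_le.1 (H.abs_sub_sub_le (x + t) x)
    constructor <;> linarith
  have up' : ∀ x t, h x - h (x - t) ≤ t + 2 * Real.pi ∧ t - 2 * Real.pi ≤ h x - h (x - t) := by
    intro x t
    have := up (x - t) t
    rwa [sub_add_cancel] at this
  refine ⟨H, fun x t ht => ?_, fun x t ht => ?_⟩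
  · rcases le_total t Real.pi with h1 | h1
    · have := f1 x t ht h1
      have h3 : 0 ≤ h x - h (x - t) := by linarith [hmono (show x - t ≤ x by linarith)]
      nlinarith [mul_nonneg hM'0 h3]
    · have h2 := f1 x _ hpi.le le_rfl
      have h3 := hmono (show x - t ≤ x - Real.pi by linarith)
      rw [hper] at h2
      have h4 : 2 * Real.pi ≤ (1 + M') * (h x - h (x - t)) := by nlinarith
      have h5 := (up x t).1
      have h6 := (up' x t).2
      rcases le_total t (4 * Real.pi) with h7 | h7
      · linarith
      · nlinarith
  · rcases le_total t Real.pi with h1 | h1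
    · have := f2 x t ht h1
      have h3 : 0 ≤ h (x + t) - h x := by linarith [hmono (show x ≤ x + t by linarith)]
      nlinarith [mul_nonneg hM'0 h3]
    · have h2 := f2 x _ hpi.le le_rfl
      have h3 := hmono (show x + Real.pi ≤ x + t by linarith)
      have h8 := hper x
      have h4 : 2 * Real.pi ≤ (1 + M') * (h (x + t) - h x) := by nlinarith
      have h5 := (up' x t).1
      have h6 := (up x t).2
      rcases le_total t (4 * Real.pi) with h7 | h7
      · linarith
      · nlinarith

/-- The average of `h` over the segment from `x` to `x + y`. -/
def segmentAverage (h : ℝ → ℝ) (x y : ℝ) : ℝ := ∫ t in (0 : ℝ)..1, h (x + t * y)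

/-- The Beurling-Ahlfors extension of `h`. -/
def beurlingAhlfors (h : ℝ → ℝ) (ζ : ℂ) : ℂ :=
  ⟨(segmentAverage h ζ.re ζ.im + segmentAverage h ζ.re (-ζ.im)) / 2,
    segmentAverage h ζ.re ζ.im - segmentAverage h ζ.re (-ζ.im)⟩

section SegmentAverage

variable {h : ℝ → ℝ}

lemma segmentAverage_zero_right (x : ℝ) : segmentAverage h x 0 = h x := by
  simp [segmentAverage]

lemma continuous_segmentAverage (hc : Continuous h) :
    Continuous fun p : ℝ × ℝ => segmentAverage h p.1 p.2 := by
  unfold segmentAverage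
  exact intervalIntegral.continuous_parametric_intervalIntegral_of_continuous' (by fun_prop) _ _

lemma segmentAverage_eq_sub (hc : Continuous h) (x y : ℝ) {a : ℝ} (hy : y ≠ 0) :
    segmentAverage h x y = ((∫ t in a..(x + y), h t) - ∫ t in a..x, h t) / y := by
  have h1 : segmentAverage h x y = y⁻¹ * ∫ t in x..(x + y), h t := by
    have := intervalIntegral.integral_comp_add_mul h hy x (a := 0) (b := 1)
    simp only [mul_zero, add_zero, mul_one, smul_eq_mul] at this
    rw [← this, segmentAverage]
    simp_rw [mul_comm y]
  rw [h1, intervalIntegral.integral_interval_sub_left (hc.intervalIntegrable _ _)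
    (hc.intervalIntegrable _ _), div_eq_inv_mul]

lemma segmentAverage_add_two_pi (H : IsCircleLift h) (x y : ℝ) :
    segmentAverage h (x + 2 * Real.pi) y = segmentAverage h x y + 2 * Real.pi := by
  have hc := H.continuous
  unfold segmentAverage
  have : ∀ t : ℝ, h (x + 2 * Real.pi + t * y) = h (x + t * y) + 2 * Real.pi := fun t => by
    rw [← H.add_two_pi]; congr 1; ring
  simp_rw [this]
  rw [intervalIntegral.integral_add (Continuous.intervalIntegrable (by fun_prop) _ _) (by simp)]
  simp

lemma abs_segmentAverage_sub_le (H : IsCircleLift h) (x y : ℝ) :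
    |segmentAverage h x y - h x - y / 2| ≤ 2 * Real.pi := by
  have hc := H.continuous
  have h1 : segmentAverage h x y - h x - y / 2 =
      ∫ t in (0 : ℝ)..1, (h (x + t * y) - h x - t * y) := by
    rw [intervalIntegral.integral_sub (Continuous.intervalIntegrable (by fun_prop) _ _)
      (Continuous.intervalIntegrable (by fun_prop) _ _),
      intervalIntegral.integral_sub (Continuous.intervalIntegrable (by fun_prop) _ _)
      (Continuous.intervalIntegrable (by fun_prop) _ _)]
    simp [segmentAverage]; ring
  rw [h1]
  have := intervalIntegral.norm_integral_le_of_norm_le_const (a := 0) (b := 1)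
    (f := fun t => h (x + t * y) - h x - t * y) (C := 2 * Real.pi) (fun t _ => by
      have := H.abs_sub_sub_le (x + t * y) x
      rwa [add_sub_cancel_left] at this)
  simpa using this

lemma segmentAverage_mono (hc : Continuous h) (hm : Monotone h) {x y x' y' : ℝ} (hx : x ≤ x')
    (hy : x + y ≤ x' + y') : segmentAverage h x y ≤ segmentAverage h x' y' := by
  refine intervalIntegral.integral_mono_on zero_le_one
    (Continuous.intervalIntegrable (by fun_prop) _ _)
    (Continuous.intervalIntegrable (by fun_prop) _ _) fun t ht => hm ?_
  nlinarith [ht.1, ht.2]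

lemma segmentAverage_strictMono (hc : Continuous h) (hm : StrictMono h) {x y x' y' : ℝ}
    (hx : x ≤ x') (hy : x + y < x' + y') : segmentAverage h x y < segmentAverage h x' y' := by
  refine intervalIntegral.integral_lt_integral_of_continuousOn_of_le_of_exists_lt zero_lt_one
    (Continuous.continuousOn (by fun_prop)) (Continuous.continuousOn (by fun_prop))
    (fun t ht => hm.monotone ?_) ⟨1, by simp, hm (by linarith)⟩
  nlinarith [ht.1, ht.2]

lemma le_segmentAverage (hc : Continuous h) {x y a b : ℝ}
    (h1 : ∀ t ∈ Icc (0 : ℝ) (1 / 2), a ≤ h (x + t * y))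
    (h2 : ∀ t ∈ Icc (1 / 2 : ℝ) 1, b ≤ h (x + t * y)) :
    (a + b) / 2 ≤ segmentAverage h x y := by
  have i1 := intervalIntegral.integral_mono_on (a := 0) (b := 1 / 2) (by norm_num)
    (f := fun _ => a) (g := fun t => h (x + t * y)) (μ := volume) (by simp)
    (Continuous.intervalIntegrable (by fun_prop) _ _) h1
  have i2 := intervalIntegral.integral_mono_on (a := 1 / 2) (b := 1) (by norm_num)
    (f := fun _ => b) (g := fun t => h (x + t * y)) (μ := volume) (by simp)
    (Continuous.intervalIntegrable (by fun_prop) _ _) h2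
  have i3 := intervalIntegral.integral_add_adjacent_intervals (μ := volume) (a := 0) (b := 1 / 2)
    (c := 1) (f := fun t => h (x + t * y))
    (Continuous.intervalIntegrable (by fun_prop) _ _)
    (Continuous.intervalIntegrable (by fun_prop) _ _)
  rw [segmentAverage, ← i3]
  simp only [intervalIntegral.integral_const, smul_eq_mul] at i1 i2
  linarith

lemma segmentAverage_le (hc : Continuous h) {x y a b : ℝ}
    (h1 : ∀ t ∈ Icc (0 : ℝ) (1 / 2), h (x + t * y) ≤ a)
    (h2 : ∀ t ∈ Icc (1 / 2 : ℝ) 1, h (x + t * y) ≤ b) :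
    segmentAverage h x y ≤ (a + b) / 2 := by
  have := le_segmentAverage (h := fun t => -h t) (x := x) (y := y) (a := -a) (b := -b) hc.neg
    (fun t ht => neg_le_neg (h1 t ht)) (fun t ht => neg_le_neg (h2 t ht))
  simp only [segmentAverage, intervalIntegral.integral_neg] at this ⊢
  linarith

end SegmentAverage

namespace IsCircleLift

variable {h : ℝ → ℝ}

lemma continuous_beurlingAhlfors (H : IsCircleLift h) : Continuous (beurlingAhlfors h) := by
  have hc := continuous_segmentAverage H.continuous
  have h1 : Continuous fun ζ : ℂ => segmentAverage h ζ.re ζ.im :=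
    hc.comp (Complex.continuous_re.prodMk Complex.continuous_im)
  have h2 : Continuous fun ζ : ℂ => segmentAverage h ζ.re (-ζ.im) :=
    hc.comp (Complex.continuous_re.prodMk Complex.continuous_im.neg)
  have : beurlingAhlfors h = fun ζ => Complex.equivRealProdCLM.symm
      ((segmentAverage h ζ.re ζ.im + segmentAverage h ζ.re (-ζ.im)) / 2,
    segmentAverage h ζ.re ζ.im - segmentAverage h ζ.re (-ζ.im)) := by
    ext ζ
    simp [beurlingAhlfors, Complex.ext_iff]
  rw [this]
  fun_prop

lemma beurlingAhlfors_ofReal (x : ℝ) : beurlingAhlfors h x = h x := by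
  apply Complex.ext <;> simp [beurlingAhlfors, segmentAverage_zero_right]

lemma beurlingAhlfors_add_two_pi (H : IsCircleLift h) (ζ : ℂ) :
    beurlingAhlfors h (ζ + 2 * Real.pi) = beurlingAhlfors h ζ + 2 * Real.pi := by
  apply Complex.ext
  · simp [beurlingAhlfors, segmentAverage_add_two_pi H]; ring
  · simp [beurlingAhlfors, segmentAverage_add_two_pi H]

lemma beurlingAhlfors_add_int_mul (H : IsCircleLift h) (ζ : ℂ) (n : ℤ) :
    beurlingAhlfors h (ζ + n * (2 * Real.pi)) = beurlingAhlfors h ζ + n * (2 * Real.pi) := by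
  have hp : Function.Periodic (fun x => beurlingAhlfors h x - x) (2 * Real.pi) := fun x => by
    simp only [H.beurlingAhlfors_add_two_pi]; ring
  have := hp.int_mul n ζ
  linear_combination this

lemma abs_im_beurlingAhlfors_sub_le (H : IsCircleLift h) (ζ : ℂ) :
    |(beurlingAhlfors h ζ).im - ζ.im| ≤ 4 * Real.pi := by
  have h1 := abs_le.1 (abs_segmentAverage_sub_le H ζ.re ζ.im)
  have h2 := abs_le.1 (abs_segmentAverage_sub_le H ζ.re (-ζ.im))
  rw [abs_le]
  simp only [beurlingAhlfors]
  constructor <;> linarith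

lemma im_beurlingAhlfors_pos (H : IsCircleLift h) {ζ : ℂ} (hζ : 0 < ζ.im) :
    0 < (beurlingAhlfors h ζ).im :=
  sub_pos.2 (segmentAverage_strictMono H.continuous H.strictMono le_rfl (by linarith))

lemma im_beurlingAhlfors_nonneg (H : IsCircleLift h) {ζ : ℂ} (hζ : 0 ≤ ζ.im) :
    0 ≤ (beurlingAhlfors h ζ).im :=
  sub_nonneg.2 (segmentAverage_mono H.continuous H.strictMono.monotone le_rfl (by linarith))

lemma injective_aux (H : IsCircleLift h) {x y x' y' : ℝ}
    (h1 : segmentAverage h x y = segmentAverage h x' y')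
    (h2 : segmentAverage h x (-y) = segmentAverage h x' (-y')) (hxx : x ≤ x') :
    x = x' ∧ y = y' := by
  have hs := @segmentAverage_strictMono h H.continuous H.strictMono
  have hx : x = x' := by
    by_contra hne
    have hlt := lt_of_le_of_ne hxx hne
    have a1 : x' + y' ≤ x + y := by
      by_contra! hcon
      exact (hs hxx hcon).ne h1
    have a2 : x' + -y' ≤ x + -y := by
      by_contra! hcon
      exact (hs hxx hcon).ne h2
    linarith
  subst hx
  refine ⟨rfl, ?_⟩
  rcases lt_trichotomy y y' with hlt | heq | hlt
  · exact absurd h1 (hs le_rfl (by linarith)).ne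
  · exact heq
  · exact absurd h1 (hs le_rfl (by linarith)).ne'

lemma injective_beurlingAhlfors (H : IsCircleLift h) :
    Function.Injective (beurlingAhlfors h) := by
  intro ζ ζ' heq
  have e1 := congrArg Complex.re heq
  have e2 := congrArg Complex.im heq
  simp only [beurlingAhlfors] at e1 e2
  have a1 : segmentAverage h ζ.re ζ.im = segmentAverage h ζ'.re ζ'.im := by linarith
  have a2 : segmentAverage h ζ.re (-ζ.im) = segmentAverage h ζ'.re (-ζ'.im) := by linarith
  rcases le_total ζ.re ζ'.re with hle | hle
  · obtain ⟨b1, b2⟩ := H.injective_aux a1 a2 hle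
    exact Complex.ext b1 b2
  · obtain ⟨b1, b2⟩ := H.injective_aux a1.symm a2.symm hle
    exact Complex.ext b1.symm b2.symm

lemma exists_beurlingAhlfors_eq (H : IsCircleLift h) {ω : ℂ} (hω : 0 ≤ ω.im) :
    ∃ ζ : ℂ, 0 ≤ ζ.im ∧ beurlingAhlfors h ζ = ω := by
  have hpi := Real.pi_pos
  have hc := continuous_segmentAverage H.continuous
  have hs := @segmentAverage_strictMono h H.continuous H.strictMono
  set A := ω.re + ω.im / 2 with hA
  set B := ω.re - ω.im / 2 with hB
  have hb : ∀ x y, |segmentAverage h x y - h 0 - x - y / 2| ≤ 4 * Real.pi := by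
    intro x y
    have h1 := abs_le.1 (abs_segmentAverage_sub_le H x y)
    have h2 := abs_le.1 (H.abs_sub_sub_le x 0)
    rw [abs_le]; constructor <;> linarith
  have hX : ∀ y, ∃ x, segmentAverage h x y = A := by
    intro y
    have b1 := abs_le.1 (hb (A - h 0 - y / 2 - 4 * Real.pi) y)
    have b2 := abs_le.1 (hb (A - h 0 - y / 2 + 4 * Real.pi) y)
    exact mem_range_of_exists_le_of_exists_ge (f := fun x => segmentAverage h x y)
      (hc.comp (by fun_prop : Continuous fun x : ℝ => (x, y)))
      ⟨_, show segmentAverage h (A - h 0 - y / 2 - 4 * Real.pi) y ≤ A by linarith⟩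
      ⟨_, show A ≤ segmentAverage h (A - h 0 - y / 2 + 4 * Real.pi) y by linarith⟩
  choose X hX using hX
  have hXc : Continuous X := by
    rw [continuous_iff_continuousAt]
    intro y
    rw [ContinuousAt, Metric.tendsto_nhds]
    intro ε hε
    have c1 : ∀ᶠ z in 𝓝 y, segmentAverage h (X y - ε) z < A := by
      refine Tendsto.eventually_lt_const ?_
        (hc.comp (by fun_prop : Continuous fun z : ℝ => (X y - ε, z))).continuousAt
      rw [← hX y]; exact hs (by linarith) (by simp; linarith)
    have c2 : ∀ᶠ z in 𝓝 y, A < segmentAverage h (X y + ε) z := by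
      refine Tendsto.eventually_const_lt ?_
        (hc.comp (by fun_prop : Continuous fun z : ℝ => (X y + ε, z))).continuousAt
      rw [← hX y]; exact hs (by linarith) (by simp; linarith)
    filter_upwards [c1, c2] with z h1 h2
    rw [← hX z] at h1 h2
    rw [Real.dist_eq, abs_lt]
    constructor
    · by_contra! hcon
      exact absurd (segmentAverage_mono H.continuous H.strictMono.monotone
        (show X z ≤ X y - ε by linarith) (show X z + z ≤ X y - ε + z by linarith)) (not_le.2 h1)
    · by_contra! hcon
      exact absurd (segmentAverage_mono H.continuous H.strictMono.monotone
        (show X y + ε ≤ X z by linarith) (show X y + ε + z ≤ X z + z by linarith)) (not_le.2 h2)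
  have hcont : Continuous fun y => segmentAverage h (X y) (-y) :=
    hc.comp (by fun_prop : Continuous fun y : ℝ => (X y, -y))
  have hω0 : (0 : ℝ) ≤ ω.im + 8 * Real.pi := by linarith
  obtain ⟨y, hy, hyB⟩ := intermediate_value_Icc' hω0 hcont.continuousOn
    (show B ∈ Icc _ _ by
      constructor
      · have b1 := abs_le.1 (hb (X (ω.im + 8 * Real.pi)) (ω.im + 8 * Real.pi))
        have b2 := abs_le.1 (hb (X (ω.im + 8 * Real.pi)) (-(ω.im + 8 * Real.pi)))
        rw [hX] at b1
        linarith
      · have := hX 0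
        rw [neg_zero, this]; linarith)
  refine ⟨⟨X y, y⟩, hy.1, ?_⟩
  simp only at hyB
  apply Complex.ext
  · simp only [beurlingAhlfors, hX, hyB]; linarith
  · simp only [beurlingAhlfors, hX, hyB]; linarith

end IsCircleLift

/-- `F` is real differentiable at `w` and its derivative has linear dilatation at most `K`. -/
def HasQuasiconformalDerivAt (K : ℝ) (F : ℂ → ℂ) (w : ℂ) : Prop :=
  ∃ (A : ℂ →L[ℝ] ℂ) (m : ℝ), 0 < m ∧ HasFDerivAt F A w ∧ ∀ v, m * ‖v‖ ≤ ‖A v‖ ∧ ‖A v‖ ≤ K * m * ‖v‖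

lemma HasQuasiconformalDerivAt.exists_dist_le {K : ℝ} {F : ℂ → ℂ} {w : ℂ}
    (hF : HasQuasiconformalDerivAt K F w) (hK : 0 ≤ K) :
    ∃ r > 0, ∀ q ∈ ball w r, ∀ s ∈ ball w r, dist w q ≤ dist w s →
      dist (F w) (F q) ≤ (2 * K + 1) * dist (F w) (F s) := by
  obtain ⟨A, m, hm, hA, hAm⟩ := hF
  have h1 := hA.isLittleO.def (half_pos hm)
  obtain ⟨r, hr, hball⟩ := Metric.eventually_nhds_iff_ball.1 h1
  refine ⟨r, hr, fun q hq s hs hqs => ?_⟩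
  have hq' := hball q hq
  have hs' := hball s hs
  rw [dist_comm w, dist_comm w, dist_eq_norm, dist_eq_norm] at hqs
  rw [dist_comm (F w), dist_comm (F w), dist_eq_norm, dist_eq_norm]
  have q1 := norm_le_norm_add_norm_sub' (F q - F w) (A (q - w))
  have s1 := norm_le_norm_add_norm_sub (F s - F w) (A (s - w))
  have q2 := (hAm (q - w)).2
  have s2 := (hAm (s - w)).1
  have hKm : 0 ≤ K * m := by positivity
  have q3 : ‖F q - F w‖ ≤ (K * m + m / 2) * ‖s - w‖ := by
    nlinarith [mul_le_mul_of_nonneg_left hqs hKm, mul_le_mul_of_nonneg_left hqs hm.le]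
  have s3 : m / 2 * ‖s - w‖ ≤ ‖F s - F w‖ := by linarith
  calc _ ≤ _ := q3
    _ = (2 * K + 1) * (m / 2 * ‖s - w‖) := by ring
    _ ≤ _ := by gcongr

lemma hasFDerivAt_segmentAverage {h : ℝ → ℝ} (hc : Continuous h) {x y : ℝ} (hy : y ≠ 0) :
    HasFDerivAt (fun p : ℝ × ℝ => segmentAverage h p.1 p.2)
      (((h (x + y) - h x) / y) • ContinuousLinearMap.fst ℝ ℝ ℝ +
        ((h (x + y) - segmentAverage h x y) / y) • ContinuousLinearMap.snd ℝ ℝ ℝ) (x, y) := by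
  have hH : ∀ z, HasDerivAt (fun z => ∫ t in (0 : ℝ)..z, h t) (h z) z := fun z =>
    (hc.integral_hasStrictDerivAt 0 z).hasDerivAt
  have h1 : HasFDerivAt (fun p : ℝ × ℝ => ∫ t in (0 : ℝ)..(p.1 + p.2), h t)
      (h (x + y) • (ContinuousLinearMap.fst ℝ ℝ ℝ + ContinuousLinearMap.snd ℝ ℝ ℝ)) (x, y) :=
    HasDerivAt.comp_hasFDerivAt (f := fun p : ℝ × ℝ => p.1 + p.2) (x, y) (hH (x + y))
      (hasFDerivAt_fst.add hasFDerivAt_snd)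
  have h2 : HasFDerivAt (fun p : ℝ × ℝ => ∫ t in (0 : ℝ)..p.1, h t)
      (h x • ContinuousLinearMap.fst ℝ ℝ ℝ) (x, y) :=
    HasDerivAt.comp_hasFDerivAt (f := fun p : ℝ × ℝ => p.1) (x, y) (hH x) hasFDerivAt_fst
  have h3 : HasFDerivAt (fun p : ℝ × ℝ => p.2⁻¹)
      ((-(y ^ 2)⁻¹) • ContinuousLinearMap.snd ℝ ℝ ℝ) (x, y) :=
    HasDerivAt.comp_hasFDerivAt (f := fun p : ℝ × ℝ => p.2) (x, y) (hasDerivAt_inv hy)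
      hasFDerivAt_snd
  have h4 := (h1.sub h2).mul h3
  have h5 : (fun p : ℝ × ℝ => segmentAverage h p.1 p.2) =ᶠ[𝓝 (x, y)] fun p : ℝ × ℝ =>
      ((∫ t in (0 : ℝ)..(p.1 + p.2), h t) - ∫ t in (0 : ℝ)..p.1, h t) * p.2⁻¹ := by
    have : ∀ᶠ p : ℝ × ℝ in 𝓝 (x, y), p.2 ≠ 0 :=
      continuous_snd.continuousAt.eventually_ne hy
    filter_upwards [this] with p hp
    rw [segmentAverage_eq_sub hc _ _ hp (a := 0), div_eq_mul_inv]
  refine (h4.congr_of_eventuallyEq h5).congr_fderiv ?_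
  rw [segmentAverage_eq_sub hc _ _ hy (a := 0)]
  ext <;> simp <;> field_simp
  ring

lemma norm_bounds_of_comparable {M a b a' b' p q : ℝ} (hM : 1 ≤ M) (ha : 0 < a) (hb : 0 < b)
    (hab : a ≤ M * b) (hba : b ≤ M * a) (ha1 : a ≤ 2 * (1 + M) * a') (ha2 : a' ≤ a)
    (hb1 : b ≤ 2 * (1 + M) * b') (hb2 : b' ≤ b) :
    a / (5 * (1 + M) ^ 2) * ‖(⟨p, q⟩ : ℂ)‖ ≤
      ‖(⟨((a * p + a' * q) + (b * p - b' * q)) / 2, (a * p + a' * q) - (b * p - b' * q)⟩ : ℂ)‖ ∧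
    ‖(⟨((a * p + a' * q) + (b * p - b' * q)) / 2, (a * p + a' * q) - (b * p - b' * q)⟩ : ℂ)‖ ≤
      15 * (1 + M) ^ 3 * (a / (5 * (1 + M) ^ 2)) * ‖(⟨p, q⟩ : ℂ)‖ := by
  set A := a * p + a' * q with hA
  set B := b * p - b' * q with hB
  have hM0 : 0 < 1 + M := by linarith
  have ha' : 0 < a' := pos_of_mul_pos_right (by linarith : 0 < 2 * (1 + M) * a') (by linarith)
  have hb' : 0 < b' := pos_of_mul_pos_right (by linarith : 0 < 2 * (1 + M) * b') (by linarith)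
  have n1 := Complex.abs_re_le_norm ⟨p, q⟩
  have n2 := Complex.abs_im_le_norm ⟨p, q⟩
  have n3 := Complex.norm_le_abs_re_add_abs_im ⟨p, q⟩
  have n4 := Complex.abs_re_le_norm ⟨(A + B) / 2, A - B⟩
  have n5 := Complex.abs_im_le_norm ⟨(A + B) / 2, A - B⟩
  have n6 := Complex.norm_le_abs_re_add_abs_im ⟨(A + B) / 2, A - B⟩
  simp only at n1 n2 n3 n4 n5 n6
  set V := ‖(⟨p, q⟩ : ℂ)‖
  set N := ‖(⟨(A + B) / 2, A - B⟩ : ℂ)‖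
  have hV : 0 ≤ V := norm_nonneg _
  have hN : 0 ≤ N := norm_nonneg _
  constructor
  · have n4' := abs_le.1 n4
    have n5' := abs_le.1 n5
    have A1 : |A| ≤ 3 / 2 * N := abs_le.2 ⟨by linarith, by linarith⟩
    have B1 : |B| ≤ 3 / 2 * N := abs_le.2 ⟨by linarith, by linarith⟩
    have e1 : (b * a' + a * b') * q = b * A - a * B := by rw [hA, hB]; ring
    have e2 : (b * a' + a * b') * |q| ≤ (b + a) * (3 / 2 * N) := by
      rw [← abs_of_pos (show 0 < b * a' + a * b' by positivity), ← abs_mul, e1]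
      refine (abs_sub _ _).trans ?_
      rw [abs_mul, abs_mul, abs_of_pos hb, abs_of_pos ha, add_mul]
      gcongr
    have e3 : a * b ≤ (1 + M) * (b * a' + a * b') := by nlinarith
    have e4 : b * (a * |q|) ≤ b * (3 / 2 * (1 + M) ^ 2 * N) := by
      calc b * (a * |q|) = a * b * |q| := by ring
        _ ≤ (1 + M) * (b * a' + a * b') * |q| := by gcongr
        _ = (1 + M) * ((b * a' + a * b') * |q|) := by ring
        _ ≤ (1 + M) * ((b + a) * (3 / 2 * N)) := by gcongr
        _ ≤ (1 + M) * ((b + M * b) * (3 / 2 * N)) := by gcongr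
        _ = _ := by ring
    have e5 := le_of_mul_le_mul_left e4 hb
    have e6 : a * |p| ≤ 3 / 2 * N + a * |q| := by
      have : a * p = A - a' * q := by rw [hA]; ring
      rw [← abs_of_pos ha, ← abs_mul, abs_of_pos ha, this]
      refine (abs_sub _ _).trans ?_
      rw [abs_mul, abs_of_pos ha']
      gcongr
    have e7 : a * V ≤ 5 * (1 + M) ^ 2 * N := by
      have : (1 : ℝ) ≤ (1 + M) ^ 2 := by nlinarith
      nlinarith [mul_le_mul_of_nonneg_left n3 ha.le, mul_le_mul_of_nonneg_right this hN]
    rw [div_mul_eq_mul_div, div_le_iff₀ (by positivity)]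
    linarith
  · have A1 : |A| ≤ 2 * a * V := by
      refine (abs_add_le _ _).trans ?_
      rw [abs_mul, abs_mul, abs_of_pos ha, abs_of_pos ha']
      nlinarith [mul_le_mul ha2 n2 (abs_nonneg q) ha.le, mul_le_mul_of_nonneg_left n1 ha.le]
    have B1 : |B| ≤ 2 * b * V := by
      refine (abs_sub _ _).trans ?_
      rw [abs_mul, abs_mul, abs_of_pos hb, abs_of_pos hb']
      nlinarith [mul_le_mul hb2 n2 (abs_nonneg q) hb.le, mul_le_mul_of_nonneg_left n1 hb.le]
    have c1 := abs_add_le A B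
    have c2 := abs_sub A B
    rw [abs_div, abs_two] at n6
    have c3 : 15 * (1 + M) ^ 3 * (a / (5 * (1 + M) ^ 2)) = 3 * (1 + M) * a := by
      field_simp; ring
    rw [c3]
    nlinarith [mul_le_mul_of_nonneg_right hba hV]

namespace IsQuasisymmetricLift

variable {M : ℝ} {h : ℝ → ℝ}

lemma doubling (H : IsQuasisymmetricLift M h) (y : ℝ) {s : ℝ} (hs : 0 ≤ s) :
    h (y + 2 * s) - h y ≤ (1 + M) * (h (y + s) - h y) := by
  have := H.forward_le (y + s) s hs
  rw [add_sub_cancel_right, show y + s + s = y + 2 * s by ring] at this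
  linarith

lemma doubling_symm (H : IsQuasisymmetricLift M h) (y : ℝ) {s : ℝ} (hs : 0 ≤ s) :
    h (y + 2 * s) - h (y - 2 * s) ≤ (1 + M) * (h (y + s) - h (y - s)) := by
  have h1 := H.forward_le (y + s) s hs
  have h2 := H.backward_le (y - s) s hs
  rw [add_sub_cancel_right, show y + s + s = y + 2 * s by ring] at h1
  rw [sub_add_cancel, show y - s - s = y - 2 * s by ring] at h2
  linarith

lemma hasQuasiconformalDerivAt (H : IsQuasisymmetricLift M h) (hM : 1 ≤ M) {ζ : ℂ}
    (hζ : 0 < ζ.im) :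
    HasQuasiconformalDerivAt (15 * (1 + M) ^ 3) (beurlingAhlfors h) ζ := by
  obtain ⟨x, y⟩ := ζ
  simp only at hζ
  have hm := H.strictMono
  have hM0 : 0 < 1 + M := by linarith
  set a := (h (x + y) - h x) / y with ha
  set a' := (h (x + y) - segmentAverage h x y) / y with ha'
  set b := (h x - h (x - y)) / y with hb
  set b' := (segmentAverage h x (-y) - h (x - y)) / y with hb'
  have s1 : segmentAverage h x y ≤ (h (x + y / 2) + h (x + y)) / 2 :=
    segmentAverage_le H.continuous (fun t ht => hm.monotone (by nlinarith [ht.2]))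
        (fun t ht => hm.monotone (by nlinarith [ht.2]))
  have s2 : (h (x - y / 2) + h (x - y)) / 2 ≤ segmentAverage h x (-y) :=
    le_segmentAverage H.continuous (fun t ht => hm.monotone (by nlinarith [ht.2]))
        (fun t ht => hm.monotone (by nlinarith [ht.2]))
  have s3 := segmentAverage_mono H.continuous hm.monotone (x := x) (y := 0) (x' := x) (y' := y)
    le_rfl (by linarith)
  have s4 := segmentAverage_mono H.continuous hm.monotone (x := x) (y := -y) (x' := x) (y' := 0)
    le_rfl (by linarith)
  rw [segmentAverage_zero_right] at s3 s4
  have ha0 : 0 < a := div_pos (sub_pos.2 (hm (by linarith))) hζ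
  have hb0 : 0 < b := div_pos (sub_pos.2 (hm (by linarith))) hζ
  have hab : a ≤ M * b := by
    rw [ha, hb, ← mul_div_assoc]; gcongr; exact H.forward_le x y hζ.le
  have hba : b ≤ M * a := by
    rw [ha, hb, ← mul_div_assoc]; gcongr; exact H.backward_le x y hζ.le
  have ha1 : a ≤ 2 * (1 + M) * a' := by
    rw [ha, ha', ← mul_div_assoc]; gcongr
    have := H.backward_le (x + y / 2) (y / 2) (by linarith)
    rw [add_sub_cancel_right, show x + y / 2 + y / 2 = x + y by ring] at this
    nlinarith
  have hb1 : b ≤ 2 * (1 + M) * b' := by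
    rw [hb, hb', ← mul_div_assoc]; gcongr
    have := H.forward_le (x - y / 2) (y / 2) (by linarith)
    rw [sub_add_cancel, show x - y / 2 - y / 2 = x - y by ring] at this
    nlinarith
  have ha2 : a' ≤ a := by rw [ha, ha']; gcongr
  have hb2 : b' ≤ b := by rw [hb, hb']; gcongr
  have d1 : HasFDerivAt (fun ζ : ℂ => segmentAverage h ζ.re ζ.im)
      (a • Complex.reCLM + a' • Complex.imCLM) ⟨x, y⟩ := by
    have := (hasFDerivAt_segmentAverage H.continuous (x := x) hζ.ne').comp (⟨x, y⟩ : ℂ)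
      (f := fun ζ : ℂ => (ζ.re, ζ.im))
      (Complex.reCLM.hasFDerivAt.prodMk Complex.imCLM.hasFDerivAt)
    exact this.congr_fderiv (by ext v; simp [ha, ha'])
  have d2 : HasFDerivAt (fun ζ : ℂ => segmentAverage h ζ.re (-ζ.im))
      (b • Complex.reCLM - b' • Complex.imCLM) ⟨x, y⟩ := by
    have := (hasFDerivAt_segmentAverage H.continuous (x := x) (neg_ne_zero.2 hζ.ne')).comp
      (⟨x, y⟩ : ℂ) (f := fun ζ : ℂ => (ζ.re, -ζ.im))
      (Complex.reCLM.hasFDerivAt.prodMk Complex.imCLM.hasFDerivAt.neg)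
    refine this.congr_fderiv ?_
    ext v
    simp [hb, hb']
    field_simp
    ring_nf
  have d3 := Complex.equivRealProdCLM.symm.hasFDerivAt.comp (⟨x, y⟩ : ℂ)
    (((d1.add d2).const_smul (1 / 2 : ℝ)).prodMk (d1.sub d2))
  have d4 : beurlingAhlfors h = Complex.equivRealProdCLM.symm ∘ fun ζ : ℂ =>
      ((1 / 2 : ℝ) • (segmentAverage h ζ.re ζ.im + segmentAverage h ζ.re (-ζ.im)),
      segmentAverage h ζ.re ζ.im - segmentAverage h ζ.re (-ζ.im)) := by
    funext ζ
    apply Complex.ext <;> simp [beurlingAhlfors]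
    ring
  refine ⟨_, a / (5 * (1 + M) ^ 2), by positivity, d4 ▸ d3, fun v => ?_⟩
  have key := norm_bounds_of_comparable (p := v.re) (q := v.im) hM ha0 hb0 hab hba ha1 ha2 hb1 hb2
  convert key using 3
  · apply Complex.ext <;> simp
    ring
  · apply Complex.ext <;> simp
    ring

lemma norm_beurlingAhlfors_sub_le (H : IsQuasisymmetricLift M h) (ζ : ℂ)
    (hζ : 0 ≤ ζ.im) (ξ : ℝ) :
    ‖beurlingAhlfors h ζ - h ξ‖ ≤
      2 * (1 + M) * (h (ξ + (|ζ.re - ξ| + ζ.im)) - h ξ) := by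
  obtain ⟨x, y⟩ := ζ
  simp only at hζ
  set ρ := |x - ξ| + y with hρ
  have hm := H.strictMono.monotone
  have hx := abs_le.1 (le_refl |x - ξ|)
  have hb := H.backward_le ξ ρ (by positivity)
  have hseg : ∀ z, segmentAverage h z 0 = h z := segmentAverage_zero_right
  have sm := @segmentAverage_mono h H.continuous hm
  have a1 := sm (x := ξ - ρ) (y := 0) (x' := x) (y' := y) (by linarith) (by linarith)
  have a2 := sm (x := x) (y := y) (x' := ξ + ρ) (y' := 0) (by linarith) (by linarith)
  have a3 := sm (x := ξ - ρ) (y := 0) (x' := x) (y' := -y) (by linarith) (by linarith)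
  have a4 := sm (x := x) (y := -y) (x' := ξ + ρ) (y' := 0) (by linarith) (by linarith)
  rw [hseg] at a1 a2 a3 a4
  have b1 := hm (show ξ - ρ ≤ ξ by linarith [abs_nonneg (x - ξ)])
  have b2 := hm (show ξ ≤ ξ + ρ by linarith [abs_nonneg (x - ξ)])
  have c1 := Complex.norm_le_abs_re_add_abs_im (beurlingAhlfors h ⟨x, y⟩ - h ξ)
  have c2 : |(beurlingAhlfors h ⟨x, y⟩ - h ξ).re| ≤ h (ξ + ρ) - h (ξ - ρ) := by
    simp only [beurlingAhlfors, Complex.sub_re, Complex.ofReal_re]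
    rw [abs_le]; constructor <;> linarith
  have c3 : |(beurlingAhlfors h ⟨x, y⟩ - h ξ).im| ≤ h (ξ + ρ) - h (ξ - ρ) := by
    simp only [beurlingAhlfors, Complex.sub_im, Complex.ofReal_im]
    rw [abs_le]; constructor <;> linarith
  show _ ≤ 2 * (1 + M) * (h (ξ + ρ) - h ξ)
  nlinarith

lemma le_norm_beurlingAhlfors_sub (H : IsQuasisymmetricLift M h) (hM : 1 ≤ M) (ζ : ℂ)
    (hζ : 0 ≤ ζ.im) (ξ : ℝ) :
    h (ξ + (|ζ.re - ξ| + ζ.im)) - h ξ ≤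
      2 * (1 + M) ^ 3 * max |(beurlingAhlfors h ζ).re - h ξ| (beurlingAhlfors h ζ).im := by
  obtain ⟨x, y⟩ := ζ
  simp only at hζ
  set a := |x - ξ| with ha
  have ha0 : 0 ≤ a := abs_nonneg _
  have hm := H.strictMono.monotone
  have hx := abs_le.1 (le_refl |x - ξ|)
  have hM0 : 0 < 1 + M := by linarith
  have hMsq : (1 + M) ^ 2 ≤ (1 + M) ^ 3 := pow_le_pow_right₀ (by linarith) (by norm_num)
  show h (ξ + (a + y)) - h ξ ≤ _
  rcases le_or_gt a y with hay | hay
  · have d1 := H.doubling_symm x (s := 2 * y) (by linarith)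
    have d2 := H.doubling_symm x (s := y) (by linarith)
    have d3 := H.doubling_symm x (s := y / 2) (by linarith)
    rw [show 2 * (y / 2) = y by ring] at d3
    have e1 := hm (show ξ + (a + y) ≤ x + 2 * (2 * y) by linarith)
    have e2 := hm (show x - 2 * (2 * y) ≤ ξ by linarith)
    have v1 : (h x + h (x + y / 2)) / 2 ≤ segmentAverage h x y :=
      le_segmentAverage H.continuous (fun t ht => hm (by nlinarith [ht.1]))
        (fun t ht => hm (by nlinarith [ht.1]))
    have v2 : segmentAverage h x (-y) ≤ (h x + h (x - y / 2)) / 2 :=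
      segmentAverage_le H.continuous (fun t ht => hm (by nlinarith [ht.1]))
        (fun t ht => hm (by nlinarith [ht.1]))
    have v3 : (h (x + y / 2) - h (x - y / 2)) / 2 ≤ (beurlingAhlfors h ⟨x, y⟩).im := by
      simp only [beurlingAhlfors]; linarith
    have v4 := v3.trans (le_max_right |(beurlingAhlfors h ⟨x, y⟩).re - h ξ| _)
    have v5 : h (x + 2 * (2 * y)) - h (x - 2 * (2 * y)) ≤
        (1 + M) ^ 3 * (h (x + y / 2) - h (x - y / 2)) := by
      calc _ ≤ (1 + M) * ((1 + M) * ((1 + M) * (h (x + y / 2) - h (x - y / 2)))) := by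
            refine d1.trans ?_
            gcongr
            refine d2.trans ?_
            gcongr
        _ = _ := by ring
    have v6 := mul_le_mul_of_nonneg_left v4 (by positivity : 0 ≤ 2 * (1 + M) ^ 3)
    linarith
  · have d1 := H.doubling ξ ha0
    have e1 := hm (show ξ + (a + y) ≤ ξ + 2 * a by linarith)
    have sm := @segmentAverage_mono h H.continuous hm
    have hseg : ∀ z, segmentAverage h z 0 = h z := segmentAverage_zero_right
    have key : h (ξ + a) - h ξ ≤ 2 * M * |(beurlingAhlfors h ⟨x, y⟩).re - h ξ| := by
      have hab := abs_nonneg ((beurlingAhlfors h ⟨x, y⟩).re - h ξ)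
      rcases le_total ξ x with hle | hle
      · have hax : ξ + a = x := by rw [ha, abs_of_nonneg (by linarith)]; ring
        have a1 := sm (x := x) (y := 0) (x' := x) (y' := y) (by linarith) (by linarith)
        have a2 := sm (x := ξ) (y := 0) (x' := x) (y' := -y) (by linarith) (by linarith)
        rw [hseg] at a1 a2
        have a3 : h x - h ξ ≤ 2 * ((beurlingAhlfors h ⟨x, y⟩).re - h ξ) := by
          simp only [beurlingAhlfors]; linarith
        have a4 := le_abs_self ((beurlingAhlfors h ⟨x, y⟩).re - h ξ)
        rw [hax]
        nlinarith
      · have hax : ξ - a = x := by rw [ha, abs_of_nonpos (by linarith)]; ring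
        have a1 := sm (x := x) (y := y) (x' := ξ) (y' := 0) (by linarith) (by linarith)
        have a2 := sm (x := x) (y := -y) (x' := x) (y' := 0) (by linarith) (by linarith)
        rw [hseg] at a1 a2
        have a3 : h ξ - h x ≤ 2 * -((beurlingAhlfors h ⟨x, y⟩).re - h ξ) := by
          simp only [beurlingAhlfors]; linarith
        have a4 := neg_le_abs ((beurlingAhlfors h ⟨x, y⟩).re - h ξ)
        have a5 := H.forward_le ξ a ha0
        rw [hax] at a5
        nlinarith
    have v4 := le_max_left |(beurlingAhlfors h ⟨x, y⟩).re - h ξ| (beurlingAhlfors h ⟨x, y⟩).im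
    set m := max |(beurlingAhlfors h ⟨x, y⟩).re - h ξ| (beurlingAhlfors h ⟨x, y⟩).im
    have hm0 : 0 ≤ m := (abs_nonneg _).trans v4
    calc h (ξ + (a + y)) - h ξ ≤ (1 + M) * (h (ξ + a) - h ξ) := by linarith
      _ ≤ (1 + M) * (2 * M * m) := by gcongr; exact key.trans (by gcongr)
      _ ≤ 2 * (1 + M) ^ 2 * m := by nlinarith [mul_nonneg hM0.le hm0]
      _ ≤ _ := by gcongr

end IsQuasisymmetricLift

/-- The self-map of the unit disc obtained from the Beurling-Ahlfors extension of `h`. -/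
def discExtension (h : ℝ → ℝ) (z : ℂ) : ℂ :=
  if z = 0 then 0 else Complex.exp (beurlingAhlfors h (-Complex.I * Complex.log z) * Complex.I)

lemma exists_exp_mul_I_eq_of_ne_zero {z : ℂ} (hz : z ≠ 0) :
    ∃ ζ : ℂ, Complex.exp (ζ * Complex.I) = z := by
  refine ⟨-Complex.I * Complex.log z, ?_⟩
  rw [show -Complex.I * Complex.log z * Complex.I = -(Complex.I * Complex.I) * Complex.log z by ring,
    Complex.I_mul_I, neg_neg, one_mul, Complex.exp_log hz]

lemma norm_exp_mul_I' (ζ : ℂ) : ‖Complex.exp (ζ * Complex.I)‖ = Real.exp (-ζ.im) := by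
  rw [Complex.norm_exp]; simp

lemma exp_mul_I_eq_iff {ζ ω : ℂ} : Complex.exp (ζ * Complex.I) = Complex.exp (ω * Complex.I) ↔
    ∃ n : ℤ, ζ = ω + n * (2 * Real.pi) := by
  rw [Complex.exp_eq_exp_iff_exists_int]
  refine exists_congr fun n => ⟨fun h => ?_, fun h => ?_⟩
  · have : (ζ - (ω + n * (2 * Real.pi))) * Complex.I = 0 := by linear_combination h
    rcases mul_eq_zero.1 this with h1 | h1
    · exact sub_eq_zero.1 h1
    · exact absurd h1 Complex.I_ne_zero
  · rw [h]; ring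

lemma dist_exp_mul_I_le_of_im_nonneg {ζ ω : ℂ} (hζ : 0 ≤ ζ.im) (hω : 0 ≤ ω.im) :
    dist (Complex.exp (ζ * Complex.I)) (Complex.exp (ω * Complex.I)) ≤ dist ζ ω := by
  have := Convex.norm_image_sub_le_of_norm_hasDerivWithin_le (𝕜 := ℂ)
    (f := fun z : ℂ => Complex.exp (z * Complex.I))
    (f' := fun z => Complex.exp (z * Complex.I) * Complex.I) (s := {z : ℂ | 0 ≤ z.im}) (C := 1)
    (x := ω) (y := ζ) (fun z _ => by
      have : HasDerivAt (fun z : ℂ => z * Complex.I) Complex.I z := by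
        simpa using (hasDerivAt_id z).mul_const Complex.I
      exact this.cexp.hasDerivWithinAt)
    (fun z hz => by
      rw [norm_mul, norm_exp_mul_I', Complex.norm_I, mul_one, Real.exp_le_one_iff]
      simpa using hz)
    (convex_halfSpace_im_ge 0) hω hζ
  simpa [dist_eq_norm] using this

lemma abs_add_im_le_or_le_dist {ζ : ℂ} {ξ : ℝ} (h0 : 0 ≤ ζ.im) (hπ : |ζ.re - ξ| ≤ Real.pi) :
    |ζ.re - ξ| + ζ.im ≤ 6 * dist (Complex.exp (ζ * Complex.I)) (Complex.exp (ξ * Complex.I)) ∨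
      1 / 2 ≤ dist (Complex.exp (ζ * Complex.I)) (Complex.exp (ξ * Complex.I)) := by
  set δ := dist (Complex.exp (ζ * Complex.I)) (Complex.exp (ξ * Complex.I)) with hδ
  have h1 : 1 - Real.exp (-ζ.im) ≤ δ := by
    have := norm_sub_norm_le (Complex.exp (ξ * Complex.I)) (Complex.exp (ζ * Complex.I))
    rw [Complex.norm_exp_ofReal_mul_I, norm_exp_mul_I'] at this
    rwa [hδ, dist_comm, dist_eq_norm]
  have h2 : Real.exp (-ζ.im) * (1 + ζ.im) ≤ 1 := by
    have := Real.add_one_le_exp ζ.im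
    have h3 := mul_le_mul_of_nonneg_left this (Real.exp_pos (-ζ.im)).le
    rw [← Real.exp_add, neg_add_cancel, Real.exp_zero] at h3
    linarith
  rcases le_or_gt 1 ζ.im with h3 | h3
  · right
    nlinarith [Real.exp_pos (-ζ.im)]
  · left
    have h4 : ζ.im ≤ 2 * δ := by nlinarith [Real.exp_pos (-ζ.im)]
    have h5 : dist (Complex.exp ((ζ.re : ℂ) * Complex.I)) (Complex.exp (ζ * Complex.I)) ≤ δ := by
      have e1 : Complex.exp (ζ * Complex.I) =
          (Real.exp (-ζ.im) : ℂ) * Complex.exp ((ζ.re : ℂ) * Complex.I) := by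
        rw [Complex.ofReal_exp, ← Complex.exp_add]
        congr 1
        nth_rewrite 1 [← Complex.re_add_im ζ]
        rw [add_mul, mul_assoc, Complex.I_mul_I]
        push_cast; ring
      have e2 : Complex.exp ((ζ.re : ℂ) * Complex.I) - Complex.exp (ζ * Complex.I) =
          ((1 - Real.exp (-ζ.im) : ℝ) : ℂ) * Complex.exp ((ζ.re : ℂ) * Complex.I) := by
        rw [e1]; push_cast; ring
      rw [dist_eq_norm, e2, norm_mul, Complex.norm_exp_ofReal_mul_I, mul_one, Complex.norm_real,
        Real.norm_eq_abs, abs_of_nonneg]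
      · exact h1
      · rw [sub_nonneg, Real.exp_le_one_iff]; linarith
    have h6 : dist (Complex.exp ((ζ.re : ℂ) * Complex.I)) (Complex.exp (ξ * Complex.I)) ≤ 2 * δ := by
      have := dist_triangle (Complex.exp ((ζ.re : ℂ) * Complex.I)) (Complex.exp (ζ * Complex.I))
        (Complex.exp (ξ * Complex.I))
      linarith
    have h7 : |ζ.re - ξ| ≤ Real.pi / 2 * (2 * δ) := by
      rcases le_total ξ ζ.re with hle | hle
      · have := le_dist_exp_add_mul_I ξ (t := ζ.re - ξ) (by linarith) ((le_abs_self _).trans hπ)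
        rw [add_sub_cancel] at this
        rw [abs_of_nonneg (by linarith)]
        refine this.trans ?_
        gcongr
      · have := le_dist_exp_add_mul_I ζ.re (t := ξ - ζ.re) (by linarith)
          (by rw [abs_sub_comm] at hπ; exact (le_abs_self _).trans hπ)
        rw [add_sub_cancel, dist_comm] at this
        rw [abs_of_nonpos (by linarith), neg_sub]
        refine this.trans ?_
        gcongr
    have := Real.pi_lt_four
    have hδ0 : 0 ≤ δ := dist_nonneg
    nlinarith

lemma exists_int_abs_sub_le (a b : ℝ) : ∃ n : ℤ, |a + n * (2 * Real.pi) - b| ≤ Real.pi := by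
  have hpi := Real.pi_pos
  refine ⟨round ((b - a) / (2 * Real.pi)), ?_⟩
  have h1 := abs_le.1 (abs_sub_round ((b - a) / (2 * Real.pi)))
  have h2 : b - a = (b - a) / (2 * Real.pi) * (2 * Real.pi) := by field_simp
  rw [abs_le]
  constructor <;> nlinarith

namespace IsCircleLift

variable {h : ℝ → ℝ}

lemma discExtension_exp (H : IsCircleLift h) (ζ : ℂ) :
    discExtension h (Complex.exp (ζ * Complex.I)) =
      Complex.exp (beurlingAhlfors h ζ * Complex.I) := by
  rw [discExtension, if_neg (Complex.exp_ne_zero _)]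
  set ω := -Complex.I * Complex.log (Complex.exp (ζ * Complex.I)) with hω
  have h1 : Complex.exp (ω * Complex.I) = Complex.exp (ζ * Complex.I) := by
    rw [hω, show ∀ z : ℂ, -Complex.I * z * Complex.I = -(Complex.I * Complex.I) * z from
      fun z => by ring, Complex.I_mul_I, neg_neg, one_mul, Complex.exp_log (Complex.exp_ne_zero _)]
  obtain ⟨n, hn⟩ := exp_mul_I_eq_iff.1 h1
  rw [hn, H.beurlingAhlfors_add_int_mul]
  exact exp_mul_I_eq_iff.2 ⟨n, rfl⟩

lemma discExtension_eq_of_ne_zero (H : IsCircleLift h) (ζ : ℂ) {z : ℂ} (hz : z ≠ 0) :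
    discExtension h z = Complex.exp (beurlingAhlfors h
      (ζ - Complex.I * Complex.log (z / Complex.exp (ζ * Complex.I))) * Complex.I) := by
  rw [← H.discExtension_exp]
  congr 1
  rw [show ∀ w : ℂ, (ζ - Complex.I * w) * Complex.I = ζ * Complex.I - (Complex.I * Complex.I) * w
    from fun w => by ring, Complex.I_mul_I, neg_one_mul, sub_neg_eq_add, Complex.exp_add,
    Complex.exp_log (div_ne_zero hz (Complex.exp_ne_zero _))]
  field_simp

lemma norm_discExtension_le (H : IsCircleLift h) (z : ℂ) :
    ‖discExtension h z‖ ≤ Real.exp (4 * Real.pi) * ‖z‖ := by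
  rcases eq_or_ne z 0 with rfl | hz
  · simp [discExtension]
  obtain ⟨ζ, rfl⟩ := exists_exp_mul_I_eq_of_ne_zero hz
  rw [H.discExtension_exp, norm_exp_mul_I', norm_exp_mul_I', ← Real.exp_add, Real.exp_le_exp]
  have := abs_le.1 (H.abs_im_beurlingAhlfors_sub_le ζ)
  linarith

lemma norm_le_norm_discExtension (H : IsCircleLift h) (z : ℂ) :
    ‖z‖ ≤ Real.exp (4 * Real.pi) * ‖discExtension h z‖ := by
  rcases eq_or_ne z 0 with rfl | hz
  · simp [discExtension]
  obtain ⟨ζ, rfl⟩ := exists_exp_mul_I_eq_of_ne_zero hz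
  rw [H.discExtension_exp, norm_exp_mul_I', norm_exp_mul_I', ← Real.exp_add, Real.exp_le_exp]
  have := abs_le.1 (H.abs_im_beurlingAhlfors_sub_le ζ)
  linarith

lemma continuous_discExtension (H : IsCircleLift h) : Continuous (discExtension h) := by
  rw [continuous_iff_continuousAt]
  intro z
  rcases eq_or_ne z 0 with rfl | hz
  · rw [ContinuousAt, show discExtension h 0 = 0 by simp [discExtension],
      tendsto_zero_iff_norm_tendsto_zero]
    refine squeeze_zero (fun _ => norm_nonneg _) H.norm_discExtension_le ?_
    have : Continuous fun z : ℂ => Real.exp (4 * Real.pi) * ‖z‖ := by fun_prop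
    simpa using this.tendsto 0
  · obtain ⟨ζ, hζ⟩ := exists_exp_mul_I_eq_of_ne_zero hz
    have h1 : (fun z => Complex.exp (beurlingAhlfors h
      (ζ - Complex.I * Complex.log (z / Complex.exp (ζ * Complex.I))) * Complex.I)) =ᶠ[𝓝 z]
        discExtension h := by
      filter_upwards [eventually_ne_nhds hz] with y hy
      exact (H.discExtension_eq_of_ne_zero ζ hy).symm
    refine ContinuousAt.congr ?_ h1
    have h2 : ContinuousAt (fun z => Complex.log (z / Complex.exp (ζ * Complex.I))) z := by
      refine ContinuousAt.clog (by fun_prop) ?_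
      rw [hζ, div_self hz]; simp
    have h3 := H.continuous_beurlingAhlfors
    have h4 : ContinuousAt (fun z => beurlingAhlfors h
      (ζ - Complex.I * Complex.log (z / Complex.exp (ζ * Complex.I)))) z :=
      h3.continuousAt.comp (f := fun z => ζ - Complex.I *
        Complex.log (z / Complex.exp (ζ * Complex.I))) (by fun_prop)
    fun_prop

lemma injective_discExtension (H : IsCircleLift h) : Function.Injective (discExtension h) := by
  intro z w hzw
  have h0 : ∀ z, discExtension h z = 0 ↔ z = 0 := fun z => by
    constructor
    · intro h0
      by_contra hz
      rw [discExtension, if_neg hz] at h0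
      exact Complex.exp_ne_zero _ h0
    · rintro rfl; simp [discExtension]
  rcases eq_or_ne z 0 with hz | hz
  · rw [hz, eq_comm, ← h0, ← hzw, h0]; exact hz
  rcases eq_or_ne w 0 with hw | hw
  · rw [hw, ← h0, hzw, h0]; exact hw
  obtain ⟨ζ, rfl⟩ := exists_exp_mul_I_eq_of_ne_zero hz
  obtain ⟨ω, rfl⟩ := exists_exp_mul_I_eq_of_ne_zero hw
  rw [H.discExtension_exp, H.discExtension_exp, exp_mul_I_eq_iff] at hzw
  obtain ⟨n, hn⟩ := hzw
  rw [← H.beurlingAhlfors_add_int_mul] at hn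
  exact exp_mul_I_eq_iff.2 ⟨n, H.injective_beurlingAhlfors hn⟩

lemma bijOn_discExtension (H : IsCircleLift h) :
    BijOn (discExtension h) (ball 0 1) (ball 0 1) := by
  refine ⟨fun z hz => ?_, H.injective_discExtension.injOn, fun z hz => ?_⟩
  · rcases eq_or_ne z 0 with rfl | hz0
    · simp [discExtension]
    · obtain ⟨ζ, rfl⟩ := exists_exp_mul_I_eq_of_ne_zero hz0
      rw [mem_ball_zero_iff, norm_exp_mul_I', Real.exp_lt_one_iff, neg_lt_zero] at hz
      rw [H.discExtension_exp, mem_ball_zero_iff, norm_exp_mul_I', Real.exp_lt_one_iff,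
        neg_lt_zero]
      exact H.im_beurlingAhlfors_pos hz
  · rcases eq_or_ne z 0 with rfl | hz0
    · exact ⟨0, by simp, by simp [discExtension]⟩
    · obtain ⟨ω, rfl⟩ := exists_exp_mul_I_eq_of_ne_zero hz0
      rw [mem_ball_zero_iff, norm_exp_mul_I', Real.exp_lt_one_iff, neg_lt_zero] at hz
      obtain ⟨ζ, hζ, rfl⟩ := H.exists_beurlingAhlfors_eq hz.le
      refine ⟨_, ?_, H.discExtension_exp ζ⟩
      rw [mem_ball_zero_iff, norm_exp_mul_I', Real.exp_lt_one_iff, neg_lt_zero]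
      refine lt_of_le_of_ne hζ fun h0 => ?_
      have : ζ = (ζ.re : ℂ) := by apply Complex.ext <;> simp [← h0]
      rw [this, beurlingAhlfors_ofReal] at hz
      simp at hz

end IsCircleLift

lemma HasQuasiconformalDerivAt.comp_hasDerivAt {K : ℝ} {F φ ψ : ℂ → ℂ} {w a b : ℂ} (ha : a ≠ 0)
    (hb : b ≠ 0) (hφ : HasDerivAt φ a w) (hF : HasQuasiconformalDerivAt K F (φ w))
    (hψ : HasDerivAt ψ b (F (φ w))) : HasQuasiconformalDerivAt K (fun z => ψ (F (φ z))) w := by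
  obtain ⟨A, m, hm, hA, hAm⟩ := hF
  have h1 := (hψ.hasFDerivAt.restrictScalars ℝ).comp w
    (hA.comp w (hφ.hasFDerivAt.restrictScalars ℝ))
  refine ⟨_, ‖b‖ * ‖a‖ * m, by positivity, h1, fun v => ?_⟩
  have h2 := hAm (v * a)
  rw [norm_mul] at h2
  simp only [ContinuousLinearMap.comp_apply, ContinuousLinearMap.coe_restrictScalars',
    ContinuousLinearMap.toSpanSingleton_apply, smul_eq_mul, norm_mul]
  constructor
  · nlinarith [mul_le_mul_of_nonneg_right h2.1 (norm_nonneg b)]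
  · nlinarith [mul_le_mul_of_nonneg_right h2.2 (norm_nonneg b)]

/-- `E` extends `g` from `sphere c r` to `closedBall c r`, with distances to boundary points
controlled by distances between boundary points, and with controlled dilatation inside. -/
structure IsDiscExtension (C : ℝ) (g E : ℂ → ℂ) (c : ℂ) (r : ℝ) (c' : ℂ) (r' : ℝ) : Prop where
  continuousOn : ContinuousOn E (closedBall c r)
  bijOn_ball : BijOn E (ball c r) (ball c' r')
  eqOn : EqOn E g (sphere c r)
  near : ∀ q ∈ closedBall c r, ∀ p ∈ sphere c r, ∃ q' ∈ sphere c r,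
    dist q' p ≤ C * dist q p ∧ dist (E q) (g p) ≤ C * dist (g q') (g p)
  far : ∀ s ∈ closedBall c r, ∀ p ∈ sphere c r, ∃ s' ∈ sphere c r,
    dist s p ≤ C * dist s' p ∧ dist (g s') (g p) ≤ C * dist (E s) (g p)
  dilatation : ∀ w ∈ ball c r, ∃ δ > 0, ∀ q ∈ ball w δ, ∀ s ∈ ball w δ, dist w q ≤ dist w s →
    dist (E w) (E q) ≤ C * dist (E w) (E s)

/-- A similarity of the plane with ratio `k` taking `c` to `c₀`. -/
structure IsSimilarity (φ : ℂ ≃ ℂ) (k : ℝ) (c c₀ : ℂ) : Prop where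
  pos : 0 < k
  dist_eq : ∀ a b, dist (φ a) (φ b) = k * dist a b
  map_center : φ c = c₀

namespace IsSimilarity

variable {φ : ℂ ≃ ℂ} {k : ℝ} {c c₀ : ℂ}

lemma mem_ball_iff (H : IsSimilarity φ k c c₀) {z : ℂ} {r : ℝ} :
    φ z ∈ ball c₀ (k * r) ↔ z ∈ ball c r := by
  rw [mem_ball, mem_ball, ← H.map_center, H.dist_eq, mul_lt_mul_iff_right₀ H.pos]

lemma mem_closedBall_iff (H : IsSimilarity φ k c c₀) {z : ℂ} {r : ℝ} :
    φ z ∈ closedBall c₀ (k * r) ↔ z ∈ closedBall c r := by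
  rw [mem_closedBall, mem_closedBall, ← H.map_center, H.dist_eq, mul_le_mul_iff_right₀ H.pos]

lemma mem_sphere_iff (H : IsSimilarity φ k c c₀) {z : ℂ} {r : ℝ} :
    φ z ∈ sphere c₀ (k * r) ↔ z ∈ sphere c r := by
  rw [mem_sphere, mem_sphere, ← H.map_center, H.dist_eq, mul_right_inj' H.pos.ne']

lemma symm (H : IsSimilarity φ k c c₀) : IsSimilarity φ.symm k⁻¹ c₀ c where
  pos := inv_pos.2 H.pos
  dist_eq a b := by
    have := H.dist_eq (φ.symm a) (φ.symm b)
    rw [φ.apply_symm_apply, φ.apply_symm_apply] at this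
    rw [this, inv_mul_cancel_left₀ H.pos.ne']
  map_center := by rw [← H.map_center, φ.symm_apply_apply]

lemma continuous (H : IsSimilarity φ k c c₀) : Continuous φ := by
  have : LipschitzWith ⟨k, H.pos.le⟩ φ := LipschitzWith.of_dist_le_mul fun a b => (H.dist_eq a b).le
  exact this.continuous

end IsSimilarity

lemma exists_isSimilarity (c : ℂ) {r : ℝ} (hr : 0 < r) :
    ∃ φ : ℂ ≃ ℂ, IsSimilarity φ r⁻¹ c 0 := by
  refine ⟨(Equiv.subRight c).trans (Equiv.mulRight₀ (r : ℂ)⁻¹ (by simp [hr.ne'])),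
    inv_pos.2 hr, fun a b => ?_, by simp⟩
  rw [dist_eq_norm, dist_eq_norm]
  change ‖(a - c) * (r : ℂ)⁻¹ - (b - c) * (r : ℂ)⁻¹‖ = _
  rw [← sub_mul, norm_mul, sub_sub_sub_cancel_right, norm_inv, Complex.norm_real, Real.norm_eq_abs,
    abs_of_pos hr, mul_comm]

lemma isSimilarity_conj :
    IsSimilarity (Complex.conjAe.toEquiv) 1 0 0 := by
  refine ⟨one_pos, fun a b => ?_, by simp⟩
  rw [one_mul]
  exact Complex.isometry_conj.dist_eq a b

/-- Conjugating by similarities preserves the estimates of `IsDiscExtension`. -/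
lemma IsDiscExtension.conj_similarity {C : ℝ} {g E : ℂ → ℂ} {c c' c₀ c₀' : ℂ} {r r' k l : ℝ}
    {φ ψ : ℂ ≃ ℂ}
    (H : IsDiscExtension C (ψ ∘ g ∘ φ.symm) E c₀ (k * r) c₀' (l * r'))
    (hφ : IsSimilarity φ k c c₀) (hψ : IsSimilarity ψ l c' c₀') :
    IsDiscExtension C g (ψ.symm ∘ E ∘ φ) c r c' r' := by
  have hd : ∀ a b, dist a b = l⁻¹ * dist (ψ a) (ψ b) := fun a b => by
    rw [hψ.dist_eq, inv_mul_cancel_left₀ hψ.pos.ne']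
  have hl := inv_pos.2 hψ.pos
  refine ⟨?_, ⟨fun z hz => ?_, ?_, fun z hz => ?_⟩, fun z hz => ?_, ?_, ?_, ?_⟩
  · refine hψ.symm.continuous.comp_continuousOn (H.continuousOn.comp hφ.continuous.continuousOn ?_)
    exact fun z hz => hφ.mem_closedBall_iff.2 hz
  · rw [← hψ.mem_ball_iff]
    simpa using H.bijOn_ball.mapsTo (hφ.mem_ball_iff.2 hz)
  · intro z hz w hw hzw
    exact φ.injective (H.bijOn_ball.injOn (hφ.mem_ball_iff.2 hz) (hφ.mem_ball_iff.2 hw)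
      (ψ.symm.injective hzw))
  · obtain ⟨y, hy, hyz⟩ := H.bijOn_ball.surjOn (hψ.mem_ball_iff.2 hz)
    exact ⟨φ.symm y, by rw [← hφ.mem_ball_iff]; simpa using hy, by simp [hyz]⟩
  · have := H.eqOn (hφ.mem_sphere_iff.2 hz)
    simp [this]
  · intro q hq p hp
    obtain ⟨q', hq', h1, h2⟩ := H.near _ (hφ.mem_closedBall_iff.2 hq) _ (hφ.mem_sphere_iff.2 hp)
    obtain ⟨q', rfl⟩ := φ.surjective q'
    rw [hφ.dist_eq, hφ.dist_eq] at h1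
    refine ⟨q', hφ.mem_sphere_iff.1 hq', ?_, ?_⟩
    · have := hφ.pos
      rw [← mul_le_mul_iff_right₀ this]; linarith
    · rw [hd, hd (g q')]
      simp only [Function.comp_apply, Equiv.apply_symm_apply, Equiv.symm_apply_apply] at h2 ⊢
      nlinarith
  · intro q hq p hp
    obtain ⟨q', hq', h1, h2⟩ := H.far _ (hφ.mem_closedBall_iff.2 hq) _ (hφ.mem_sphere_iff.2 hp)
    obtain ⟨q', rfl⟩ := φ.surjective q'
    rw [hφ.dist_eq, hφ.dist_eq] at h1
    refine ⟨q', hφ.mem_sphere_iff.1 hq', ?_, ?_⟩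
    · have := hφ.pos
      rw [← mul_le_mul_iff_right₀ this]; linarith
    · rw [hd, hd (_ : ℂ) (g p)]
      simp only [Function.comp_apply, Equiv.apply_symm_apply, Equiv.symm_apply_apply] at h2 ⊢
      nlinarith
  · intro w hw
    obtain ⟨δ, hδ, h1⟩ := H.dilatation _ (hφ.mem_ball_iff.2 hw)
    have hk := hφ.pos
    refine ⟨δ / k, by positivity, fun q hq s hs hqs => ?_⟩
    rw [mem_ball, lt_div_iff₀' hk, ← hφ.dist_eq] at hq hs
    have := h1 _ hq _ hs (by rw [hφ.dist_eq, hφ.dist_eq]; gcongr)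
    rw [hd, hd (_ : ℂ) ((ψ.symm ∘ E ∘ φ) s)]
    simp only [Function.comp_apply, Equiv.apply_symm_apply]
    nlinarith

namespace IsCircleLift

variable {h : ℝ → ℝ}

lemma two_pi_le (H : IsCircleLift h) {M : ℝ} (H' : IsQuasisymmetricLift M h) (x : ℝ) :
    2 * Real.pi ≤ (1 + M) * (h (x + Real.pi) - h x) := by
  have h1 := H'.backward_le x Real.pi Real.pi_pos.le
  have h2 := H.add_two_pi (x - Real.pi)
  rw [show x - Real.pi + 2 * Real.pi = x + Real.pi by ring] at h2
  linarith

lemma discExtension_near (H : IsCircleLift h) {M M₀ : ℝ} (H' : IsQuasisymmetricLift M h)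
    (hM : 1 ≤ M) (hM₀ : 1 ≤ M₀)
    {g : ℂ → ℂ} (hgh : ∀ x : ℝ, g (Complex.exp (x * Complex.I)) = Complex.exp (h x * Complex.I))
    (hg : WeaklyQuasisymmetricOn M₀ g (sphere 0 1)) {q p : ℂ} (hq : q ∈ closedBall (0 : ℂ) 1)
    (hp : p ∈ sphere (0 : ℂ) 1) : ∃ q' ∈ sphere (0 : ℂ) 1,
      dist q' p ≤ 8 * (1 + M) * M₀ * dist q p ∧
        dist (discExtension h q) (g p) ≤ 8 * (1 + M) * M₀ * dist (g q') (g p) := by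
  have hpi := Real.pi_pos
  have hpi4 := Real.pi_lt_four
  have hpi3 := Real.pi_gt_three
  obtain ⟨ξ, rfl⟩ := exists_exp_mul_I_eq hp
  have hMM : 2 ≤ (1 + M) * M₀ := by nlinarith
  have hM0 : 0 < 1 + M := by linarith
  have hC : 0 < (1 + M) * M₀ := by linarith
  have arc : ∀ t, 0 ≤ t → t ≤ Real.pi → h (ξ + t) - h ξ ≤ Real.pi * M₀ *
      dist (g (Complex.exp ((ξ + t : ℝ) * Complex.I))) (g (Complex.exp (ξ * Complex.I))) :=
    fun t h0 h1 => H.sub_le_mul_dist hM₀ hgh hg ξ h0 h1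
  have hE1 : ‖discExtension h q‖ ≤ 1 := by
    rcases eq_or_ne q 0 with rfl | hq0
    · simp [discExtension]
    · obtain ⟨ζ, rfl⟩ := exists_exp_mul_I_eq_of_ne_zero hq0
      rw [mem_closedBall_zero_iff, norm_exp_mul_I', Real.exp_le_one_iff, neg_nonpos] at hq
      rw [H.discExtension_exp, norm_exp_mul_I', Real.exp_le_one_iff, neg_nonpos]
      exact H.im_beurlingAhlfors_nonneg hq
  have antipode : 1 / 2 ≤ dist q (Complex.exp (ξ * Complex.I)) → ∃ q' ∈ sphere (0 : ℂ) 1,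
      dist q' (Complex.exp (ξ * Complex.I)) ≤
        8 * (1 + M) * M₀ * dist q (Complex.exp (ξ * Complex.I)) ∧
        dist (discExtension h q) (g (Complex.exp (ξ * Complex.I))) ≤
        8 * (1 + M) * M₀ * dist (g q') (g (Complex.exp (ξ * Complex.I))) := by
    intro hδ
    refine ⟨_, exp_mul_I_mem_sphere (ξ + Real.pi), ?_, ?_⟩
    · have := dist_exp_mul_I_le (ξ + Real.pi) ξ
      rw [add_sub_cancel_left, abs_of_pos hpi] at this
      nlinarith
    · have a1 := H.two_pi_le H' ξ
      have a2 := arc Real.pi hpi.le le_rfl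
      have a3 : dist (discExtension h q) (g (Complex.exp (ξ * Complex.I))) ≤ 2 := by
        rw [dist_eq_norm, hgh]
        refine (norm_sub_le _ _).trans ?_
        rw [Complex.norm_exp_ofReal_mul_I]; linarith
      set d := dist (g (Complex.exp ((ξ + Real.pi : ℝ) * Complex.I)))
        (g (Complex.exp (ξ * Complex.I)))
      have a4 : Real.pi * 2 ≤ Real.pi * ((1 + M) * M₀ * d) := by
        calc Real.pi * 2 = 2 * Real.pi := by ring
          _ ≤ _ := a1
          _ ≤ (1 + M) * (Real.pi * M₀ * d) := by gcongr
          _ = _ := by ring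
      have a5 := le_of_mul_le_mul_left a4 hpi
      nlinarith
  rcases eq_or_ne q 0 with rfl | hq0
  · refine antipode ?_
    rw [dist_eq_norm, zero_sub, norm_neg, Complex.norm_exp_ofReal_mul_I]; norm_num
  obtain ⟨ζ₁, rfl⟩ := exists_exp_mul_I_eq_of_ne_zero hq0
  obtain ⟨n, hn⟩ := exists_int_abs_sub_le ζ₁.re ξ
  obtain ⟨ζ, hζ, hζe⟩ : ∃ ζ : ℂ, |ζ.re - ξ| ≤ Real.pi ∧
      Complex.exp (ζ₁ * Complex.I) = Complex.exp (ζ * Complex.I) :=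
    ⟨ζ₁ + n * (2 * Real.pi), by simpa using hn, (exp_mul_I_eq_iff.2 ⟨n, rfl⟩).symm⟩
  rw [hζe] at hq antipode ⊢
  rw [mem_closedBall_zero_iff, norm_exp_mul_I', Real.exp_le_one_iff, neg_nonpos] at hq
  rcases abs_add_im_le_or_le_dist hq hζ with h1 | h1
  swap
  · exact antipode h1
  rcases le_or_gt (|ζ.re - ξ| + ζ.im) Real.pi with h2 | h2
  swap
  · exact antipode (by linarith)
  set ρ := |ζ.re - ξ| + ζ.im with hρ
  have hρ0 : 0 ≤ ρ := by positivity
  refine ⟨_, exp_mul_I_mem_sphere (ξ + ρ), ?_, ?_⟩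
  · have := dist_exp_mul_I_le (ξ + ρ) ξ
    rw [add_sub_cancel_left, abs_of_nonneg hρ0] at this
    nlinarith [dist_nonneg (x := Complex.exp (ζ * Complex.I)) (y := Complex.exp (ξ * Complex.I))]
  · rw [H.discExtension_exp, hgh ξ]
    have b1 := dist_exp_mul_I_le_of_im_nonneg (H.im_beurlingAhlfors_nonneg hq)
      (show 0 ≤ ((h ξ : ℝ) : ℂ).im by simp)
    have b2 := H'.norm_beurlingAhlfors_sub_le ζ hq ξ
    rw [← dist_eq_norm, ← hρ] at b2
    have b3 := arc ρ hρ0 h2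
    rw [hgh ξ] at b3
    set d := dist (g (Complex.exp ((ξ + ρ : ℝ) * Complex.I))) (Complex.exp (h ξ * Complex.I))
    have hd0 : 0 ≤ d := dist_nonneg
    calc _ ≤ _ := b1.trans b2
      _ ≤ 2 * (1 + M) * (4 * M₀ * d) := by gcongr; exact b3.trans (by gcongr)
      _ = _ := by ring

lemma discExtension_far (H : IsCircleLift h) {M : ℝ} (H' : IsQuasisymmetricLift M h)
    (hM : 1 ≤ M) {g : ℂ → ℂ}
    (hgh : ∀ x : ℝ, g (Complex.exp (x * Complex.I)) = Complex.exp (h x * Complex.I))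
    {s p : ℂ} (hs : s ∈ closedBall (0 : ℂ) 1)
    (hp : p ∈ sphere (0 : ℂ) 1) : ∃ s' ∈ sphere (0 : ℂ) 1,
      dist s p ≤ 12 * (1 + M) ^ 3 * dist s' p ∧
        dist (g s') (g p) ≤ 12 * (1 + M) ^ 3 * dist (discExtension h s) (g p) := by
  have hpi := Real.pi_pos
  have hpi4 := Real.pi_lt_four
  have hpi3 := Real.pi_gt_three
  obtain ⟨ξ, rfl⟩ := exists_exp_mul_I_eq hp
  have hM3 : 1 ≤ (1 + M) ^ 3 := one_le_pow₀ (by linarith)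
  have hm := H.strictMono.monotone
  have chord : ∀ t, 0 ≤ t →
      dist (g (Complex.exp ((ξ + t : ℝ) * Complex.I))) (g (Complex.exp (ξ * Complex.I))) ≤
        h (ξ + t) - h ξ := fun t ht => by
    rw [hgh, hgh]
    refine (dist_exp_mul_I_le _ _).trans_eq (abs_of_nonneg ?_)
    linarith [hm (show ξ ≤ ξ + t by linarith)]
  have antipode : dist s (Complex.exp (ξ * Complex.I)) ≤ 12 * (1 + M) ^ 3 *
      dist (Complex.exp ((ξ + Real.pi : ℝ) * Complex.I)) (Complex.exp (ξ * Complex.I)) := by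
    rw [dist_exp_add_mul_I ξ hpi.le (by linarith), Real.sin_pi_div_two]
    have : dist s (Complex.exp (ξ * Complex.I)) ≤ 2 := by
      rw [dist_eq_norm]
      refine (norm_sub_le _ _).trans ?_
      rw [Complex.norm_exp_ofReal_mul_I]
      linarith [mem_closedBall_zero_iff.1 hs]
    nlinarith
  have far : 1 / 2 ≤ dist (discExtension h s) (g (Complex.exp (ξ * Complex.I))) →
      ∃ s' ∈ sphere (0 : ℂ) 1,
      dist s (Complex.exp (ξ * Complex.I)) ≤
        12 * (1 + M) ^ 3 * dist s' (Complex.exp (ξ * Complex.I)) ∧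
        dist (g s') (g (Complex.exp (ξ * Complex.I))) ≤
        12 * (1 + M) ^ 3 * dist (discExtension h s) (g (Complex.exp (ξ * Complex.I))) := by
    intro hδ
    refine ⟨_, exp_mul_I_mem_sphere (ξ + Real.pi), antipode, ?_⟩
    have : dist (g (Complex.exp ((ξ + Real.pi : ℝ) * Complex.I)))
        (g (Complex.exp (ξ * Complex.I))) ≤ 2 := by
      rw [dist_eq_norm, hgh, hgh]
      refine (norm_sub_le _ _).trans ?_
      rw [Complex.norm_exp_ofReal_mul_I, Complex.norm_exp_ofReal_mul_I]; norm_num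
    nlinarith
  rcases eq_or_ne s 0 with rfl | hs0
  · refine far ?_
    rw [hgh, dist_eq_norm]
    simp [discExtension, Complex.norm_exp_ofReal_mul_I]
    norm_num
  obtain ⟨ζ₁, rfl⟩ := exists_exp_mul_I_eq_of_ne_zero hs0
  obtain ⟨n, hn⟩ := exists_int_abs_sub_le (beurlingAhlfors h ζ₁).re (h ξ)
  obtain ⟨ζ, hζ, hζe⟩ : ∃ ζ : ℂ, |(beurlingAhlfors h ζ).re - h ξ| ≤ Real.pi ∧
      Complex.exp (ζ₁ * Complex.I) = Complex.exp (ζ * Complex.I) :=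
    ⟨ζ₁ + n * (2 * Real.pi), by rw [H.beurlingAhlfors_add_int_mul]; simpa using hn,
      (exp_mul_I_eq_iff.2 ⟨n, rfl⟩).symm⟩
  rw [hζe] at hs antipode far ⊢
  rw [mem_closedBall_zero_iff, norm_exp_mul_I', Real.exp_le_one_iff, neg_nonpos] at hs
  have him := H.im_beurlingAhlfors_nonneg hs
  rw [H.discExtension_exp, hgh ξ] at far ⊢
  rcases abs_add_im_le_or_le_dist him hζ with h1 | h1
  swap
  · exact far h1
  set δ := dist (Complex.exp (beurlingAhlfors h ζ * Complex.I)) (Complex.exp (h ξ * Complex.I))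
  set ρ := |ζ.re - ξ| + ζ.im with hρ
  have hρ0 : 0 ≤ ρ := by positivity
  have b1 := H'.le_norm_beurlingAhlfors_sub hM ζ hs ξ
  rw [← hρ] at b1
  have b2 : h (ξ + ρ) - h ξ ≤ 12 * (1 + M) ^ 3 * δ := by
    have : max |(beurlingAhlfors h ζ).re - h ξ| (beurlingAhlfors h ζ).im ≤ 6 * δ :=
      max_le (by linarith) (by linarith [abs_nonneg ((beurlingAhlfors h ζ).re - h ξ)])
    calc _ ≤ _ := b1
      _ ≤ 2 * (1 + M) ^ 3 * (6 * δ) := by gcongr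
      _ = _ := by ring
  rcases le_or_gt ρ Real.pi with h2 | h2
  · refine ⟨_, exp_mul_I_mem_sphere (ξ + ρ), ?_, ?_⟩
    · have c1 := dist_exp_mul_I_le_of_im_nonneg hs (show 0 ≤ (ξ : ℂ).im by simp)
      have c2 : dist ζ (ξ : ℂ) ≤ ρ := by
        rw [dist_eq_norm]
        refine (Complex.norm_le_abs_re_add_abs_im _).trans_eq ?_
        simp [hρ, abs_of_nonneg hs]
      have c3 := le_dist_exp_add_mul_I ξ hρ0 h2
      have c4 : (0 : ℝ) ≤
          dist (Complex.exp ((ξ + ρ : ℝ) * Complex.I)) (Complex.exp (ξ * Complex.I)) := dist_nonneg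
      calc _ ≤ _ := (c1.trans c2).trans c3
        _ ≤ _ := by gcongr; linarith
    · have := chord ρ hρ0
      rw [hgh ξ] at this
      linarith
  · refine ⟨_, exp_mul_I_mem_sphere (ξ + Real.pi), antipode, ?_⟩
    have := chord Real.pi hpi.le
    rw [hgh ξ] at this
    linarith [hm (show ξ + Real.pi ≤ ξ + ρ by linarith)]

lemma discExtension_dilatation (H : IsCircleLift h) {M : ℝ} (H' : IsQuasisymmetricLift M h)
    (hM : 1 ≤ M) {w : ℂ} (hw : w ∈ ball (0 : ℂ) 1) :
    ∃ δ > 0, ∀ q ∈ ball w δ, ∀ s ∈ ball w δ, dist w q ≤ dist w s →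
      dist (discExtension h w) (discExtension h q) ≤
        (31 * (1 + M) ^ 3 + Real.exp (8 * Real.pi)) *
          dist (discExtension h w) (discExtension h s) := by
  have hM3 : 1 ≤ (1 + M) ^ 3 := one_le_pow₀ (by linarith)
  rcases eq_or_ne w 0 with rfl | hw0
  · refine ⟨1, one_pos, fun q _ s _ hqs => ?_⟩
    have h0 : discExtension h 0 = 0 := by simp [discExtension]
    rw [dist_zero_left, dist_zero_left] at hqs
    rw [h0, dist_zero_left, dist_zero_left]
    calc _ ≤ Real.exp (4 * Real.pi) * (Real.exp (4 * Real.pi) * ‖discExtension h s‖) := by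
          refine (H.norm_discExtension_le q).trans ?_
          gcongr
          exact hqs.trans (H.norm_le_norm_discExtension s)
      _ = Real.exp (8 * Real.pi) * ‖discExtension h s‖ := by
          rw [← mul_assoc, ← Real.exp_add]; ring_nf
      _ ≤ _ := by gcongr; linarith
  · obtain ⟨ζ, rfl⟩ := exists_exp_mul_I_eq_of_ne_zero hw0
    rw [mem_ball_zero_iff, norm_exp_mul_I', Real.exp_lt_one_iff, neg_lt_zero] at hw
    have hne := Complex.exp_ne_zero (ζ * Complex.I)
    have hφ : HasDerivAt (fun z => ζ - Complex.I * Complex.log (z / Complex.exp (ζ * Complex.I)))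
        (-(Complex.I * (1 / Complex.exp (ζ * Complex.I) / (Complex.exp (ζ * Complex.I) /
          Complex.exp (ζ * Complex.I))))) (Complex.exp (ζ * Complex.I)) := by
      refine HasDerivAt.const_sub _ (HasDerivAt.const_mul _ (HasDerivAt.clog ?_ ?_))
      · exact (hasDerivAt_id _).div_const _
      · rw [div_self hne]; simp
    have hφ0 : ζ - Complex.I * Complex.log (Complex.exp (ζ * Complex.I) /
        Complex.exp (ζ * Complex.I)) = ζ := by rw [div_self hne]; simp
    have hψ : ∀ ω : ℂ, HasDerivAt (fun z => Complex.exp (z * Complex.I))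
        (Complex.exp (ω * Complex.I) * Complex.I) ω := fun ω => by
      have : HasDerivAt (fun z : ℂ => z * Complex.I) Complex.I ω := by
        simpa using (hasDerivAt_id ω).mul_const Complex.I
      exact this.cexp
    have key := HasQuasiconformalDerivAt.comp_hasDerivAt
      (by rw [div_self hne]; simp) (mul_ne_zero (Complex.exp_ne_zero _) Complex.I_ne_zero) hφ
      (by rw [hφ0]; exact H'.hasQuasiconformalDerivAt hM hw) (hψ _)
    have key2 : HasQuasiconformalDerivAt (15 * (1 + M) ^ 3) (discExtension h)
        (Complex.exp (ζ * Complex.I)) := by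
      obtain ⟨A, m, hm, hA, hAm⟩ := key
      refine ⟨A, m, hm, hA.congr_of_eventuallyEq ?_, hAm⟩
      filter_upwards [eventually_ne_nhds hne] with y hy
      exact H.discExtension_eq_of_ne_zero ζ hy
    obtain ⟨δ, hδ, hb⟩ := key2.exists_dist_le (by positivity)
    refine ⟨δ, hδ, fun q hq s hs hqs => (hb q hq s hs hqs).trans ?_⟩
    refine mul_le_mul_of_nonneg_right ?_ dist_nonneg
    linarith [Real.add_one_le_exp (8 * Real.pi), Real.pi_pos]

end IsCircleLift

lemma WeaklyQuasisymmetricOn.comp_similarity {M : ℝ} {g : ℂ → ℂ} {φ ψ : ℂ ≃ ℂ} {k l : ℝ}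
    {c c₀ c' c₀' : ℂ} {X Y : Set ℂ} (hg : WeaklyQuasisymmetricOn M g X)
    (hφ : IsSimilarity φ k c c₀) (hψ : IsSimilarity ψ l c' c₀') (hY : MapsTo φ.symm Y X) :
    WeaklyQuasisymmetricOn M (ψ ∘ g ∘ φ.symm) Y := by
  intro p hp q hq s hs hqs
  have := hg _ (hY hp) _ (hY hq) _ (hY hs) (by
    rw [hφ.symm.dist_eq, hφ.symm.dist_eq]
    exact mul_le_mul_of_nonneg_left hqs hφ.symm.pos.le)
  simp only [Function.comp_apply, hψ.dist_eq]
  nlinarith [hψ.pos]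

/-- Weakly quasisymmetric embeddings of circles into circles extend to the discs,
quantitatively. -/
theorem exists_isDiscExtension {M₀ : ℝ} (hM₀ : 1 ≤ M₀) :
    ∃ C : ℝ, 1 ≤ C ∧ ∀ (c : ℂ) (r : ℝ) (c' : ℂ) (r' : ℝ) (g : ℂ → ℂ), 0 < r → 0 < r' →
      ContinuousOn g (sphere c r) → MapsTo g (sphere c r) (sphere c' r') → InjOn g (sphere c r) →
      WeaklyQuasisymmetricOn M₀ g (sphere c r) → ∃ E, IsDiscExtension C g E c r c' r' := by
  set M := 6 * (1 + Real.pi * M₀ ^ 2) with hMdef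
  have hM : 1 ≤ M := by have : 0 ≤ Real.pi * M₀ ^ 2 := by positivity
                        linarith
  set C := 31 * (1 + M) ^ 3 * M₀ + Real.exp (8 * Real.pi) with hC
  have hM3 : (1 + M) ≤ (1 + M) ^ 3 := le_self_pow₀ (by linarith) (by norm_num)
  have hexp := Real.exp_pos (8 * Real.pi)
  have hC1 : 8 * (1 + M) * M₀ ≤ C := by
    have : 8 * (1 + M) * M₀ ≤ 31 * (1 + M) ^ 3 * M₀ := by
      gcongr
      norm_num
    linarith
  have hM3' : (1 + M) ^ 3 ≤ (1 + M) ^ 3 * M₀ := le_mul_of_one_le_right (by positivity) hM₀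
  have hM3pos : 0 < (1 + M) ^ 3 := by positivity
  have hC2 : 12 * (1 + M) ^ 3 ≤ C := by linarith
  have hC3 : 31 * (1 + M) ^ 3 + Real.exp (8 * Real.pi) ≤ C := by linarith
  have increasing : ∀ (g : ℂ → ℂ) (h : ℝ → ℝ), IsCircleLift h →
      (∀ x : ℝ, g (Complex.exp (x * Complex.I)) = Complex.exp (h x * Complex.I)) →
      WeaklyQuasisymmetricOn M₀ g (sphere 0 1) → IsDiscExtension C g (discExtension h) 0 1 0 1 := by
    intro g h H hgh hg
    have H' := H.isQuasisymmetricLift hM₀ hgh hg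
    refine ⟨H.continuous_discExtension.continuousOn, H.bijOn_discExtension, ?_, ?_, ?_, ?_⟩
    · intro z hz
      obtain ⟨x, rfl⟩ := exists_exp_mul_I_eq hz
      rw [H.discExtension_exp, IsCircleLift.beurlingAhlfors_ofReal, hgh]
    · intro q hq p hp
      obtain ⟨q', hq', h1, h2⟩ := H.discExtension_near H' hM hM₀ hgh hg hq hp
      exact ⟨q', hq', h1.trans (by gcongr), h2.trans (by gcongr)⟩
    · intro q hq p hp
      obtain ⟨q', hq', h1, h2⟩ := H.discExtension_far H' hM hgh hq hp
      exact ⟨q', hq', h1.trans (by gcongr), h2.trans (by gcongr)⟩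
    · intro w hw
      obtain ⟨δ, hδ, hb⟩ := H.discExtension_dilatation H' hM hw
      exact ⟨δ, hδ, fun q hq s hs hqs => (hb q hq s hs hqs).trans (by gcongr)⟩
  have unit : ∀ g : ℂ → ℂ, ContinuousOn g (sphere 0 1) → MapsTo g (sphere 0 1) (sphere 0 1) →
      InjOn g (sphere 0 1) → WeaklyQuasisymmetricOn M₀ g (sphere 0 1) →
      ∃ E, IsDiscExtension C g E 0 1 0 1 := by
    intro g hgc hgm hgi hg
    obtain ⟨h, hgh, H | H⟩ := exists_circleLift hgc hgm hgi
    · exact ⟨_, increasing g h H hgh hg⟩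
    · have hid : IsSimilarity (Equiv.refl ℂ) 1 0 0 := ⟨one_pos, by simp, rfl⟩
      have h1 := increasing (Complex.conjAe.toEquiv ∘ g ∘ (Equiv.refl ℂ).symm) _ H
        (fun x => by simp [hgh, ← Complex.exp_conj])
        (hg.comp_similarity hid isSimilarity_conj fun z hz => hz)
      have h2 : IsDiscExtension C (Complex.conjAe.toEquiv ∘ g ∘ (Equiv.refl ℂ).symm)
        (discExtension fun x => -h x) 0 (1 * 1) 0 (1 * 1) := by simpa only [mul_one] using h1
      exact ⟨_, h2.conj_similarity hid isSimilarity_conj⟩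
  refine ⟨C, by nlinarith, fun c r c' r' g hr hr' hgc hgm hgi hg => ?_⟩
  obtain ⟨φ, hφ⟩ := exists_isSimilarity c hr
  obtain ⟨ψ, hψ⟩ := exists_isSimilarity c' hr'
  have hY : MapsTo φ.symm (sphere 0 1) (sphere c r) := fun z hz => by
    rw [← hφ.mem_sphere_iff, inv_mul_cancel₀ hr.ne']; simpa using hz
  obtain ⟨E, hE⟩ := unit (ψ ∘ g ∘ φ.symm)
    (hψ.continuous.comp_continuousOn (hgc.comp hφ.symm.continuous.continuousOn hY))
    (fun z hz => by
      rw [← inv_mul_cancel₀ hr'.ne']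
      exact hψ.mem_sphere_iff.2 (hgm (hY hz)))
    (ψ.injective.injOn.comp (hgi.comp φ.symm.injective.injOn hY) (mapsTo_univ _ _))
    (hg.comp_similarity hφ hψ hY)
  have hE' : IsDiscExtension C (ψ ∘ g ∘ φ.symm) E 0 (r⁻¹ * r) 0 (r'⁻¹ * r') := by
    rwa [inv_mul_cancel₀ hr.ne', inv_mul_cancel₀ hr'.ne']
  exact ⟨_, hE'.conj_similarity hφ hψ⟩

/-- A segment entering a disc meets the boundary circle. -/
lemma exists_mem_sphere_of_mem_ball_of_notMem {c : ℂ} {r : ℝ} {q w : ℂ} (hq : q ∈ ball c r)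
    (hw : w ∉ ball c r) : ∃ p ∈ sphere c r, dist p w ≤ dist q w ∧ dist q p ≤ dist q w := by
  rw [mem_ball] at hq hw
  have hcont : ContinuousOn (fun t : ℝ => dist (AffineMap.lineMap q w t) c) (Icc 0 1) :=
    ((AffineMap.lineMap_continuous (R := ℝ)).dist continuous_const).continuousOn
  obtain ⟨t, ht, htr⟩ := intermediate_value_Icc zero_le_one hcont
    (show r ∈ Icc _ _ by simpa using ⟨hq.le, not_lt.1 hw⟩)
  refine ⟨AffineMap.lineMap q w t, htr, ?_, ?_⟩
  · rw [dist_lineMap_right, Real.norm_eq_abs, abs_of_nonneg (by linarith [ht.2])]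
    nlinarith [ht.1, dist_nonneg (x := q) (y := w)]
  · rw [dist_left_lineMap, Real.norm_eq_abs, abs_of_nonneg ht.1]
    nlinarith [ht.2, dist_nonneg (x := q) (y := w)]

lemma isPreconnected_sphere_complex (c : ℂ) (r : ℝ) : IsPreconnected (sphere c r) :=
  isPreconnected_sphere (by simp [Complex.rank_real_complex]) c r

lemma IsSchottkyFamily.sphere_subset {I : Type*} {Ω : Set ℂ} {c : I → ℂ} {r : I → ℝ}
    (h : IsSchottkyFamily Ω c r) (i : I) : sphere (c i) (r i) ⊆ Ω \ ⋃ i, ball (c i) (r i) := by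
  intro z hz
  refine ⟨h.2.1 i (sphere_subset_closedBall hz), fun hz' => ?_⟩
  obtain ⟨j, hj⟩ := mem_iUnion.1 hz'
  rcases eq_or_ne i j with rfl | hij
  · exact (sphere_disjoint_ball.le_bot ⟨hz, hj⟩ : _)
  · exact (h.2.2 hij).le_bot ⟨sphere_subset_closedBall hz, ball_subset_closedBall hj⟩

lemma IsSchottkyFamily.eq_of_sphere_eq {I : Type*} {Ω : Set ℂ} {c : I → ℂ} {r : I → ℝ}
    (h : IsSchottkyFamily Ω c r) {i j : I} (hij : sphere (c i) (r i) = sphere (c j) (r j)) :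
    i = j := by
  by_contra hne
  obtain ⟨p, hp⟩ := NormedSpace.sphere_nonempty (x := c i) (r := r i) |>.2 (h.1 i).le
  exact (h.2.2 hne).le_bot ⟨sphere_subset_closedBall hp, sphere_subset_closedBall (hij ▸ hp)⟩

/-- Removing disjoint open discs from a domain leaves a connected set. -/
lemma isPreconnected_diff_iUnion_ball {I : Type*} {Ω : Set ℂ} {c : I → ℂ} {r : I → ℝ}
    (hΩ : IsOpen Ω) (hc : IsPreconnected Ω) (h : IsSchottkyFamily Ω c r) :
    IsPreconnected (Ω \ ⋃ i, ball (c i) (r i)) := by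
  have hsphere := h.sphere_subset
  obtain ⟨hr, hsub, hdisj⟩ := h
  set S := Ω \ ⋃ i, ball (c i) (r i) with hS
  intro U V hU hV hUV hSU hSV
  by_contra hne
  have hall : ∀ i, ∀ U V : Set ℂ, IsOpen U → IsOpen V → S ⊆ U ∪ V → ¬ (S ∩ (U ∩ V)).Nonempty →
      (sphere (c i) (r i) ∩ U).Nonempty → sphere (c i) (r i) ⊆ U := by
    intro i U V hU hV hUV hne hi
    by_contra hnot
    obtain ⟨z, hz, hzU⟩ := not_subset.1 hnot
    have hzV := (hUV (hsphere i hz)).resolve_left hzU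
    exact hne ((isPreconnected_sphere_complex (c i) (r i) U V hU hV
      ((hsphere i).trans hUV) hi ⟨z, hz, hzV⟩).mono (inter_subset_inter_left _ (hsphere i)))
  let fill : Set ℂ → Set ℂ := fun U =>
    {z | (z ∈ S ∧ z ∈ U) ∨ ∃ i, z ∈ ball (c i) (r i) ∧ sphere (c i) (r i) ⊆ U}
  have hopen : ∀ U V : Set ℂ, IsOpen U → IsOpen V → S ⊆ U ∪ V → ¬ (S ∩ (U ∩ V)).Nonempty →
      IsOpen (fill U) := by
    intro U V hU hV hUV hne
    rw [isOpen_iff_mem_nhds]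
    rintro z (⟨hzS, hzU⟩ | ⟨i, hzi, hi⟩)
    · obtain ⟨ε, hε, hεU⟩ := Metric.isOpen_iff.1 hU z hzU
      filter_upwards [ball_mem_nhds z hε, hΩ.mem_nhds hzS.1] with q hq hqΩ
      by_cases hqS : q ∈ S
      · exact Or.inl ⟨hqS, hεU hq⟩
      · have : q ∈ ⋃ i, ball (c i) (r i) := by
          by_contra h
          exact hqS ⟨hqΩ, h⟩
        obtain ⟨i, hi⟩ := mem_iUnion.1 this
        obtain ⟨p, hp, hpz, -⟩ := exists_mem_sphere_of_mem_ball_of_notMem hi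
          (fun h => hzS.2 (mem_iUnion.2 ⟨i, h⟩))
        exact Or.inr ⟨i, hi, hall i U V hU hV hUV hne
          ⟨p, hp, hεU (hpz.trans_lt hq)⟩⟩
    · filter_upwards [isOpen_ball.mem_nhds hzi] with q hq
      exact Or.inr ⟨i, hq, hi⟩
  have hVU : S ⊆ V ∪ U := by rwa [union_comm]
  have hne' : ¬ (S ∩ (V ∩ U)).Nonempty := by rwa [inter_comm V]
  have hΩS : ∀ z ∈ Ω, z ∈ S ∨ ∃ i, z ∈ ball (c i) (r i) := by
    intro z hz
    by_cases h : z ∈ ⋃ i, ball (c i) (r i)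
    · exact Or.inr (mem_iUnion.1 h)
    · exact Or.inl ⟨hz, h⟩
  have hcover : Ω ⊆ fill U ∪ fill V := by
    intro z hz
    rcases hΩS z hz with hzS | ⟨i, hi⟩
    · exact (hUV hzS).imp (fun h => Or.inl ⟨hzS, h⟩) (fun h => Or.inl ⟨hzS, h⟩)
    · obtain ⟨p, hp⟩ := NormedSpace.sphere_nonempty (x := c i) (r := r i) |>.2 (hr i).le
      refine (hUV (hsphere i hp)).imp (fun h => Or.inr ⟨i, hi, ?_⟩) (fun h => Or.inr ⟨i, hi, ?_⟩)
      · exact hall i U V hU hV hUV hne ⟨p, hp, h⟩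
      · exact hall i V U hV hU hVU hne' ⟨p, hp, h⟩
  obtain ⟨z, hz, hzU, hzV⟩ := hc (fill U) (fill V) (hopen U V hU hV hUV hne)
    (hopen V U hV hU hVU hne') hcover
    (hSU.mono fun z hz => ⟨hz.1.1, Or.inl hz⟩) (hSV.mono fun z hz => ⟨hz.1.1, Or.inl hz⟩)
  have hSball : ∀ i, z ∈ ball (c i) (r i) → z ∉ S := fun i hi h => h.2 (mem_iUnion.2 ⟨i, hi⟩)
  rcases hzU with ⟨hzS, hzU⟩ | ⟨i, hi, hiU⟩
  · rcases hzV with ⟨-, hzV⟩ | ⟨i, hi, -⟩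
    · exact hne ⟨z, hzS, hzU, hzV⟩
    · exact hSball i hi hzS
  · rcases hzV with ⟨hzS, -⟩ | ⟨j, hj, hjV⟩
    · exact hSball i hi hzS
    · obtain rfl : i = j := by
        by_contra hij
        exact (hdisj hij).le_bot ⟨ball_subset_closedBall hi, ball_subset_closedBall hj⟩
      obtain ⟨p, hp⟩ := NormedSpace.sphere_nonempty (x := c i) (r := r i) |>.2 (hr i).le
      exact hne ⟨p, hsphere i hp, hiU hp, hjV hp⟩

lemma isPreconnected_annulus (c : ℂ) {r ρ : ℝ} (hr : 0 < r) :
    IsPreconnected (ball c ρ \ closedBall c r) := by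
  have : ball c ρ \ closedBall c r =
      (fun x : ℝ × ℝ => c + x.1 * Complex.exp (x.2 * Complex.I)) '' (Ioo r ρ ×ˢ univ) := by
    ext z
    simp only [Set.mem_sdiff, mem_ball, mem_closedBall, not_le, mem_image, mem_prod, mem_Ioo,
      mem_univ, and_true, Prod.exists, dist_eq_norm]
    constructor
    · rintro ⟨h1, h2⟩
      exact ⟨‖z - c‖, (z - c).arg, ⟨h2, h1⟩, by rw [Complex.norm_mul_exp_arg_mul_I]; ring⟩
    · rintro ⟨a, b, ⟨h1, h2⟩, rfl⟩
      rw [add_sub_cancel_left, norm_mul, Complex.norm_exp_ofReal_mul_I, Complex.norm_real, mul_one,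
        Real.norm_eq_abs, abs_of_pos (hr.trans h1)]
      exact ⟨h2, h1⟩
  rw [this]
  refine (isPreconnected_Ioo.prod isPreconnected_univ).image _ (Continuous.continuousOn ?_)
  fun_prop

/-- Removing a closed disc from a domain leaves a connected set. -/
lemma isPreconnected_diff_closedBall {Ω : Set ℂ} {c : ℂ} {r : ℝ} (hr : 0 < r)
    (hΩ : IsOpen Ω) (hc : IsPreconnected Ω) (h : closedBall c r ⊆ Ω) :
    IsPreconnected (Ω \ closedBall c r) := by
  obtain ⟨ε, hε, hεΩ⟩ := (isCompact_closedBall c r).exists_thickening_subset_open hΩ h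
  rw [thickening_closedBall hε hr.le] at hεΩ
  set ρ := ε + r
  set A := ball c ρ \ closedBall c r
  have hA : A ⊆ Ω \ closedBall c r := sdiff_subset_sdiff_left hεΩ
  have main : ∀ U V : Set ℂ, IsOpen U → IsOpen V → Ω \ closedBall c r ⊆ U ∪ V →
      (Ω \ closedBall c r ∩ V).Nonempty → ¬ (A ∩ V).Nonempty →
      (Ω \ closedBall c r ∩ (U ∩ V)).Nonempty := by
    intro U V hU hV hUV hVne hAV
    have hcl : IsOpen (closedBall c r)ᶜ := isClosed_closedBall.isOpen_compl
    obtain ⟨z, hz, hzU, hzV⟩ := hc (U \ closedBall c r ∪ ball c ρ) (V \ closedBall c r)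
      ((hU.inter hcl).union isOpen_ball) (hV.inter hcl) (fun z hz => by
        by_cases hzr : z ∈ closedBall c r
        · exact Or.inl (Or.inr (closedBall_subset_ball (by simp only [ρ]; linarith) hzr))
        · exact (hUV ⟨hz, hzr⟩).imp (fun h => Or.inl ⟨h, hzr⟩) (fun h => ⟨h, hzr⟩))
      ⟨c, h (mem_closedBall_self hr.le), Or.inr (mem_ball_self (by simp only [ρ]; linarith))⟩
      (hVne.mono fun z hz => ⟨hz.1.1, hz.2, hz.1.2⟩)
    rcases hzU with hzU | hzρ
    · exact ⟨z, ⟨hz, hzV.2⟩, hzU.1, hzV.1⟩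
    · exact (hAV ⟨z, ⟨hzρ, hzV.2⟩, hzV.1⟩).elim
  intro U V hU hV hUV hUne hVne
  by_cases hAV : (A ∩ V).Nonempty
  · by_cases hAU : (A ∩ U).Nonempty
    · exact (isPreconnected_annulus c hr U V hU hV (hA.trans hUV) hAU hAV).mono
        (inter_subset_inter_left _ hA)
    · rw [inter_comm U]
      exact main V U hV hU (by rwa [union_comm]) hUne hAU
  · exact main U V hU hV hUV hVne hAV

/-- Removing a peripheral circle does not disconnect a relative Schottky set. -/
lemma isPreconnected_diff_sphere {I : Type*} {Ω : Set ℂ} {c : I → ℂ} {r : I → ℝ}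
    (hΩ : IsOpen Ω) (hc : IsPreconnected Ω) (h : IsSchottkyFamily Ω c r) (i : I) :
    IsPreconnected ((Ω \ ⋃ i, ball (c i) (r i)) \ sphere (c i) (r i)) := by
  have key := isPreconnected_diff_iUnion_ball (I := {j // j ≠ i}) (c := fun j => c j)
    (r := fun j => r j) (hΩ.sdiff isClosed_closedBall)
    (isPreconnected_diff_closedBall (h.1 i) hΩ hc (h.2.1 i))
    ⟨fun j => h.1 j, fun j z hz => ⟨h.2.1 j hz, fun hz' => (h.2.2 j.2).le_bot ⟨hz, hz'⟩⟩,
      fun j k hjk => h.2.2 (Subtype.coe_injective.ne hjk)⟩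
  convert key using 1
  ext z
  rw [← ball_union_sphere]
  simp only [Set.mem_sdiff, mem_iUnion, mem_union, Subtype.exists, not_exists, not_or]
  constructor
  · rintro ⟨⟨h1, h2⟩, h3⟩
    exact ⟨⟨h1, h2 i, h3⟩, fun j _ => h2 j⟩
  · rintro ⟨⟨h1, h2, h3⟩, h4⟩
    refine ⟨⟨h1, fun j => ?_⟩, h3⟩
    rcases eq_or_ne j i with rfl | hj
    · exact h2
    · exact h4 j hj

lemma surjOn_sphere_of_injOn' {c c' : ℂ} {r r' : ℝ} (hr : 0 < r) (hr' : 0 < r') {g : ℂ → ℂ}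
    (hg : ContinuousOn g (sphere c r)) (hmaps : MapsTo g (sphere c r) (sphere c' r'))
    (hinj : InjOn g (sphere c r)) : SurjOn g (sphere c r) (sphere c' r') := by
  obtain ⟨φ, hφ⟩ := exists_isSimilarity c hr
  obtain ⟨ψ, hψ⟩ := exists_isSimilarity c' hr'
  have hφ1 : ∀ z, φ z ∈ sphere (0 : ℂ) 1 ↔ z ∈ sphere c r := fun z => by
    rw [← hφ.mem_sphere_iff, inv_mul_cancel₀ hr.ne']
  have hψ1 : ∀ z, ψ z ∈ sphere (0 : ℂ) 1 ↔ z ∈ sphere c' r' := fun z => by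
    rw [← hψ.mem_sphere_iff, inv_mul_cancel₀ hr'.ne']
  have hY : MapsTo φ.symm (sphere 0 1) (sphere c r) := fun z hz => by
    rw [← hφ1]; simpa using hz
  have key := surjOn_sphere_of_injOn (g := ψ ∘ g ∘ φ.symm)
    (hψ.continuous.comp_continuousOn (hg.comp hφ.symm.continuous.continuousOn hY))
    (fun z hz => (hψ1 _).2 (hmaps (hY hz)))
    (ψ.injective.injOn.comp (hinj.comp φ.symm.injective.injOn hY) (mapsTo_univ _ _))
  intro z hz
  obtain ⟨w, hw, hwz⟩ := key ((hψ1 z).2 hz)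
  exact ⟨φ.symm w, hY hw, ψ.injective hwz⟩

/-- `f` and `g` are mutually inverse homeomorphisms between `S` and `T`. -/
structure IsHomeoPair (f g : ℂ → ℂ) (S T : Set ℂ) : Prop where
  continuousOn : ContinuousOn f S
  continuousOn_inv : ContinuousOn g T
  mapsTo : MapsTo f S T
  mapsTo_inv : MapsTo g T S
  leftInvOn : LeftInvOn g f S
  rightInvOn : LeftInvOn f g T

lemma IsHomeoOn.exists_isHomeoPair {f : ℂ → ℂ} {S T : Set ℂ} (h : IsHomeoOn f S T) :
    ∃ g, IsHomeoPair f g S T := by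
  obtain ⟨e, he⟩ := h
  classical
  let g : ℂ → ℂ := fun z => if hz : z ∈ T then (e.symm ⟨z, hz⟩ : ℂ) else z
  have hg : ∀ z : T, g z = e.symm z := fun z => by simp [g]
  have hfS : ∀ z (hz : z ∈ S), f z = e ⟨z, hz⟩ := fun z hz => (he ⟨z, hz⟩).symm
  have hgT : ∀ z (hz : z ∈ T), g z = e.symm ⟨z, hz⟩ := fun z hz => hg ⟨z, hz⟩
  refine ⟨g, ?_, ?_, ?_, ?_, ?_, ?_⟩
  · rw [continuousOn_iff_continuous_domRestrict]
    exact (continuous_subtype_val.comp e.continuous).congr he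
  · rw [continuousOn_iff_continuous_domRestrict]
    exact (continuous_subtype_val.comp e.symm.continuous).congr fun z => (hg z).symm
  · intro z hz
    rw [hfS z hz]; exact Subtype.coe_prop _
  · intro z hz
    rw [hgT z hz]; exact Subtype.coe_prop _
  · intro z hz
    rw [hfS z hz, hg]; simp
  · intro z hz
    rw [hgT z hz, ← he]; simp

namespace IsHomeoPair

variable {f g : ℂ → ℂ} {S T : Set ℂ}

lemma symm (h : IsHomeoPair f g S T) : IsHomeoPair g f T S :=
  ⟨h.continuousOn_inv, h.continuousOn, h.mapsTo_inv, h.mapsTo, h.rightInvOn, h.leftInvOn⟩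

lemma injOn (h : IsHomeoPair f g S T) : InjOn f S := h.leftInvOn.injOn

lemma image_eq (h : IsHomeoPair f g S T) : f '' S = T :=
  h.mapsTo.image_subset.antisymm fun z hz => ⟨g z, h.mapsTo_inv hz, h.rightInvOn hz⟩

end IsHomeoPair

lemma IsHomeoPair.not_isPreconnected_compl_image_sphere {f g : ℂ → ℂ} {S T : Set ℂ}
    (h : IsHomeoPair f g S T) {c : ℂ} {r : ℝ} (hr : 0 < r) (hS : sphere c r ⊆ S) :
    ¬ IsPreconnected (f '' sphere c r)ᶜ := by
  let e : ℝ → ℂ := fun t => c + r * Complex.exp ((2 * Real.pi * t : ℝ) * Complex.I)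
  have he : Continuous e := by fun_prop
  have hes : ∀ t, e t ∈ sphere c r := fun t => by
    rw [mem_sphere, dist_eq_norm, add_sub_cancel_left, norm_mul, Complex.norm_exp_ofReal_mul_I,
      Complex.norm_real, mul_one, Real.norm_eq_abs, abs_of_pos hr]
  have hper : Function.Periodic e 1 := fun t => by
    have : (((2 * Real.pi * (t + 1) : ℝ) : ℂ) * Complex.I) =
      ((2 * Real.pi * t : ℝ) : ℂ) * Complex.I + 2 * Real.pi * Complex.I := by push_cast; ring
    simp only [e]
    rw [this, Complex.exp_periodic]
  have hinj : InjOn e (Ico 0 1) := by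
    intro a ha b hb hab
    have h1 : Complex.exp ((2 * Real.pi * a : ℝ) * Complex.I) =
        Complex.exp ((2 * Real.pi * b : ℝ) * Complex.I) :=
      mul_left_cancel₀ (Complex.ofReal_ne_zero.2 hr.ne') (add_left_cancel hab)
    obtain ⟨n, hn⟩ := Complex.exp_eq_exp_iff_exists_int.1 h1
    have h2 : (2 * Real.pi * a : ℝ) = 2 * Real.pi * (b + n) := by
      have h3 : ((2 * Real.pi * a : ℝ) : ℂ) * Complex.I =
        ((2 * Real.pi * (b + n) : ℝ) : ℂ) * Complex.I := by rw [hn]; push_cast; ring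
      exact_mod_cast mul_right_cancel₀ Complex.I_ne_zero h3
    have h3 : a = b + n := mul_left_cancel₀ (by positivity) h2
    have h4 : (n : ℝ) < 1 := by linarith [ha.2, hb.1]
    have h5 : (-1 : ℝ) < n := by linarith [ha.1, hb.2]
    have h6 : n = 0 := by
      have : n < 1 := by exact_mod_cast h4
      have : -1 < n := by exact_mod_cast h5
      omega
    simpa [h6] using h3
  have hrange : range e = sphere c r := by
    refine (range_subset_iff.2 hes).antisymm fun z hz => ⟨(z - c).arg / (2 * Real.pi), ?_⟩
    have : ‖z - c‖ = r := by rwa [mem_sphere, dist_eq_norm] at hz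
    simp only [e]
    rw [mul_div_cancel₀ _ (by positivity), ← this, Complex.norm_mul_exp_arg_mul_I]
    ring
  have key := not_isPreconnected_compl_of_closed_curve (γ := f ∘ e)
    (h.continuousOn.comp_continuous he fun t => hS (hes t))
    (fun t => congrArg f (hper t))
    (h.injOn.comp hinj fun t _ => hS (hes t))
  rwa [range_comp, hrange] at key

/-- A homeomorphism between relative Schottky sets maps peripheral circles to peripheral
circles. -/
lemma IsHomeoPair.exists_image_sphere_eq {I J : Type*} {f g : ℂ → ℂ} {Ω Ω' : Set ℂ}
    {c : I → ℂ} {r : I → ℝ} {c' : J → ℂ} {r' : J → ℝ}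
    (h : IsHomeoPair f g (Ω \ ⋃ i, ball (c i) (r i)) (Ω' \ ⋃ j, ball (c' j) (r' j)))
    (hΩ : IsPlaneDomain Ω) (hΩ' : IsPlaneDomain Ω') (hc : IsSchottkyFamily Ω c r)
    (hc' : IsSchottkyFamily Ω' c' r') (i : I) :
    ∃ j, f '' sphere (c i) (r i) = sphere (c' j) (r' j) := by
  set S := Ω \ ⋃ i, ball (c i) (r i) with hS
  set S' := Ω' \ ⋃ j, ball (c' j) (r' j) with hS'
  have hiS := hc.sphere_subset i
  set K := f '' sphere (c i) (r i) with hK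
  have hKS' : K ⊆ S' := (image_mono hiS).trans h.mapsTo.image_subset
  have hKcl : IsClosed K := ((isCompact_sphere _ _).image_of_continuousOn
    (h.continuousOn.mono hiS)).isClosed
  have hpre : IsPreconnected (S' \ K) := by
    have : S' \ K = f '' (S \ sphere (c i) (r i)) := by
      rw [h.injOn.image_sdiff_subset hiS, h.image_eq]
    rw [this]
    exact (isPreconnected_diff_sphere hΩ.1 hΩ.2.isPreconnected hc i).image f
      (h.continuousOn.mono sdiff_subset)
  have main : ∀ U V : Set ℂ, IsOpen U → IsOpen V → Disjoint U V → U ∪ V = Kᶜ → U.Nonempty →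
      V.Nonempty → Disjoint S' U → ∃ j, K = sphere (c' j) (r' j) := by
    intro U V hU hV hUV hUVK hUne hVne hSU
    have hfr : frontier U ⊆ K := by
      intro z hz
      by_contra hzK
      rw [hU.frontier_eq] at hz
      have hzV : z ∈ V := ((hUVK ▸ hzK : z ∈ U ∪ V)).resolve_left hz.2
      obtain ⟨y, hyV, hyU⟩ := mem_closure_iff.1 hz.1 V hV hzV
      exact hUV.le_bot ⟨hyU, hyV⟩
    have hfrne : (frontier U).Nonempty := by
      rw [nonempty_iff_ne_empty, Ne, ← isClopen_iff_frontier_eq_empty, isClopen_iff]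
      rintro (h | h)
      · exact hUne.ne_empty h
      · obtain ⟨z, hz⟩ := hVne
        exact hUV.le_bot ⟨h ▸ mem_univ z, hz⟩
    obtain ⟨x, hx⟩ := hfrne
    obtain ⟨y, hyΩ, hyU⟩ := mem_closure_iff.1 (frontier_subset_closure hx) Ω' hΩ'.1
      (hKS' (hfr hx)).1
    have hy : y ∈ ⋃ j, ball (c' j) (r' j) := by
      by_contra hy
      exact hSU.le_bot ⟨⟨hyΩ, hy⟩, hyU⟩
    obtain ⟨j, hj⟩ := mem_iUnion.1 hy
    have hjS : sphere (c' j) (r' j) ⊆ S' := hc'.sphere_subset j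
    have hballU : ball (c' j) (r' j) ⊆ U := by
      have hsub : ball (c' j) (r' j) ⊆ U ∪ V := by
        rw [hUVK]
        exact fun z hz hzK => (hKS' hzK).2 (mem_iUnion.2 ⟨j, hz⟩)
      exact (convex_ball _ _).isPreconnected.subset_left_of_subset_union hU hV hUV hsub ⟨y, hj, hyU⟩
    have hsphK : sphere (c' j) (r' j) ⊆ K := by
      refine fun z hz => hfr ?_
      rw [hU.frontier_eq]
      refine ⟨closure_mono hballU ?_, fun hzU => hSU.le_bot ⟨hjS hz, hzU⟩⟩
      rw [closure_ball _ (hc'.1 j).ne']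
      exact sphere_subset_closedBall hz
    refine ⟨j, Subset.antisymm ?_ hsphK⟩
    have hgm : MapsTo g (sphere (c' j) (r' j)) (sphere (c i) (r i)) := by
      intro z hz
      obtain ⟨w, hw, rfl⟩ := hsphK hz
      rwa [h.leftInvOn (hiS hw)]
    have hsurj := surjOn_sphere_of_injOn' (hc'.1 j) (hc.1 i) (h.continuousOn_inv.mono hjS) hgm
      (h.symm.injOn.mono hjS)
    rintro _ ⟨w, hw, rfl⟩
    obtain ⟨z, hz, rfl⟩ := hsurj hw
    rwa [h.rightInvOn (hjS hz)]
  have hJ : ¬ IsPreconnected Kᶜ := h.not_isPreconnected_compl_image_sphere (hc.1 i) hiS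
  simp only [IsPreconnected, not_forall] at hJ
  obtain ⟨U, V, hU, hV, hUV, hKU, hKV, hne⟩ := hJ
  have hKo := hKcl.isOpen_compl
  have hd : Disjoint (Kᶜ ∩ U) (Kᶜ ∩ V) := by
    rw [disjoint_left]
    exact fun z hz hz' => hne ⟨z, hz.1, hz.2, hz'.2⟩
  have hun : (Kᶜ ∩ U) ∪ (Kᶜ ∩ V) = Kᶜ := by
    rw [← inter_union_distrib_left, inter_eq_left]; exact hUV
  have hsplit : S' \ K ⊆ (Kᶜ ∩ U) ∪ (Kᶜ ∩ V) := by
    rw [hun]; exact fun z hz => hz.2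
  have hdis : ∀ A B : Set ℂ, Disjoint (Kᶜ ∩ A) (Kᶜ ∩ B) → S' \ K ⊆ Kᶜ ∩ A →
      Disjoint S' (Kᶜ ∩ B) := by
    intro A B hAB hA
    rw [disjoint_left]
    exact fun z hz hzB => hAB.le_bot ⟨hA ⟨hz, hzB.1⟩, hzB⟩
  rcases hpre.subset_or_subset (hKo.inter hU) (hKo.inter hV) hd hsplit with hsub | hsub
  · exact main _ _ (hKo.inter hV) (hKo.inter hU) hd.symm (by rw [union_comm, hun]) hKV hKU
      (hdis U V hd hsub)
  · exact main _ _ (hKo.inter hU) (hKo.inter hV) hd hun hKU hKV (hdis V U hd.symm hsub)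

/-- The correspondence between peripheral circles induced by a homeomorphism. -/
lemma IsHomeoPair.exists_bijective_image_sphere_eq {I J : Type*} {f g : ℂ → ℂ} {Ω Ω' : Set ℂ}
    {c : I → ℂ} {r : I → ℝ} {c' : J → ℂ} {r' : J → ℝ}
    (h : IsHomeoPair f g (Ω \ ⋃ i, ball (c i) (r i)) (Ω' \ ⋃ j, ball (c' j) (r' j)))
    (hΩ : IsPlaneDomain Ω) (hΩ' : IsPlaneDomain Ω') (hc : IsSchottkyFamily Ω c r)
    (hc' : IsSchottkyFamily Ω' c' r') :
    ∃ σ : I → J, Function.Bijective σ ∧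
      ∀ i, f '' sphere (c i) (r i) = sphere (c' (σ i)) (r' (σ i)) := by
  choose σ hσ using h.exists_image_sphere_eq hΩ hΩ' hc hc'
  refine ⟨σ, ⟨fun i j hij => hc.eq_of_sphere_eq ?_, fun j => ?_⟩, hσ⟩
  · have : f '' sphere (c i) (r i) = f '' sphere (c j) (r j) := by rw [hσ, hσ, hij]
    exact (h.injOn.image_eq_image_iff (hc.sphere_subset i) (hc.sphere_subset j)).1 this
  · obtain ⟨i, hi⟩ := h.symm.exists_image_sphere_eq hΩ' hΩ hc' hc j
    have hj := hc'.sphere_subset j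
    refine ⟨i, hc'.eq_of_sphere_eq ?_⟩
    rw [← hσ, ← hi, (h.rightInvOn.mono hj).image_image]

lemma IsDiscExtension.congr {C : ℝ} {g E F : ℂ → ℂ} {c c' : ℂ} {r r' : ℝ}
    (H : IsDiscExtension C g E c r c' r') (hF : EqOn F E (closedBall c r)) :
    IsDiscExtension C F F c r c' r' := by
  have hg : EqOn g F (sphere c r) := fun z hz => by
    rw [hF (sphere_subset_closedBall hz), H.eqOn hz]
  refine ⟨H.continuousOn.congr hF, H.bijOn_ball.congr (hF.mono ball_subset_closedBall).symm,
    fun _ _ => rfl, ?_, ?_, ?_⟩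
  · intro q hq p hp
    obtain ⟨q', hq', h1, h2⟩ := H.near q hq p hp
    exact ⟨q', hq', h1, by rwa [hF hq, ← hg hp, ← hg hq']⟩
  · intro q hq p hp
    obtain ⟨q', hq', h1, h2⟩ := H.far q hq p hp
    exact ⟨q', hq', h1, by rwa [hF hq, ← hg hp, ← hg hq']⟩
  · intro w hw
    obtain ⟨δ, hδ, h⟩ := H.dilatation w hw
    obtain ⟨ε, hε, hsub⟩ := Metric.isOpen_iff.1 isOpen_ball w hw
    have hF' := hF.mono ball_subset_closedBall
    refine ⟨min δ ε, lt_min hδ hε, fun q hq s hs hqs => ?_⟩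
    rw [hF' hw, hF' (hsub (ball_subset_ball (min_le_right _ _) hq)),
      hF' (hsub (ball_subset_ball (min_le_right _ _) hs))]
    exact h q (ball_subset_ball (min_le_left _ _) hq) s (ball_subset_ball (min_le_left _ _) hs) hqs

/-- `F` maps `Ω` to `Ω'`, restricts to a homeomorphism with inverse `g` between the relative
Schottky sets given by two families of discs, and maps discs to corresponding discs in a
controlled way. -/
structure IsDiscwiseExtension {I : Type*} (C : ℝ) (F g : ℂ → ℂ) (Ω Ω' : Set ℂ)
    (c : I → ℂ) (r : I → ℝ) (c' : I → ℂ) (r' : I → ℝ) : Prop where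
  one_le : 1 ≤ C
  source : IsSchottkyFamily Ω c r
  target : IsSchottkyFamily Ω' c' r'
  homeo : IsHomeoPair F g (Ω \ ⋃ i, ball (c i) (r i)) (Ω' \ ⋃ i, ball (c' i) (r' i))
  image_sphere : ∀ i, F '' sphere (c i) (r i) = sphere (c' i) (r' i)
  disc : ∀ i, IsDiscExtension C F F (c i) (r i) (c' i) (r' i)

lemma mem_diff_iUnion_or {I : Type*} {Ω : Set ℂ} (B : I → Set ℂ) {z : ℂ} (hz : z ∈ Ω) :
    z ∈ Ω \ ⋃ i, B i ∨ ∃ i, z ∈ B i := by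
  by_cases h : z ∈ ⋃ i, B i
  · exact Or.inr (mem_iUnion.1 h)
  · exact Or.inl ⟨hz, h⟩

lemma IsSchottkyFamily.eq_of_mem {I : Type*} {Ω : Set ℂ} {c : I → ℂ} {r : I → ℝ}
    (h : IsSchottkyFamily Ω c r) {i j : I} {z : ℂ} (hi : z ∈ closedBall (c i) (r i))
    (hj : z ∈ closedBall (c j) (r j)) : i = j := by
  by_contra hne
  exact (h.2.2 hne).le_bot ⟨hi, hj⟩

lemma exists_isDiscwiseExtension {I J : Type*} {C : ℝ} {f g : ℂ → ℂ} {Ω Ω' : Set ℂ}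
    {c : I → ℂ} {r : I → ℝ} {c' : J → ℂ} {r' : J → ℝ} {σ : I → J} (hC : 1 ≤ C)
    (hc : IsSchottkyFamily Ω c r) (hc' : IsSchottkyFamily Ω' c' r')
    (h : IsHomeoPair f g (Ω \ ⋃ i, ball (c i) (r i)) (Ω' \ ⋃ j, ball (c' j) (r' j)))
    (hσ : Function.Bijective σ)
    (hf : ∀ i, f '' sphere (c i) (r i) = sphere (c' (σ i)) (r' (σ i)))
    (hE : ∀ i, ∃ E, IsDiscExtension C f E (c i) (r i) (c' (σ i)) (r' (σ i))) :
    ∃ F, EqOn F f (Ω \ ⋃ i, ball (c i) (r i)) ∧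
      IsDiscwiseExtension C F g Ω Ω' c r (c' ∘ σ) (r' ∘ σ) := by
  classical
  choose E hE using hE
  let F : ℂ → ℂ := fun z =>
    if hz : ∃ i, z ∈ ball (c i) (r i) then E hz.choose z else f z
  have hFS : EqOn F f (Ω \ ⋃ i, ball (c i) (r i)) := fun z hz =>
    dif_neg fun ⟨i, hi⟩ => hz.2 (mem_iUnion.2 ⟨i, hi⟩)
  have hFE : ∀ i, EqOn F (E i) (closedBall (c i) (r i)) := by
    intro i z hz
    rw [← ball_union_sphere] at hz
    rcases hz with hz | hz
    · have hex : ∃ i, z ∈ ball (c i) (r i) := ⟨i, hz⟩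
      have hi : hex.choose = i := hc.eq_of_mem (ball_subset_closedBall hex.choose_spec)
        (ball_subset_closedBall hz)
      simp only [F]
      rw [dif_pos hex, hi]
    · rw [hFS (hc.sphere_subset i hz), (hE i).eqOn hz]
  have htarget : (⋃ i, ball ((c' ∘ σ) i) ((r' ∘ σ) i)) = ⋃ j, ball (c' j) (r' j) :=
    hσ.surjective.iUnion_comp fun j => ball (c' j) (r' j)
  refine ⟨F, hFS, hC, hc, ⟨fun i => hc'.1 _, fun i => hc'.2.1 _,
    fun i j hij => hc'.2.2 (hσ.injective.ne hij)⟩, ?_, fun i => ?_, fun i => (hE i).congr (hFE i)⟩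
  · rw [htarget]
    exact ⟨h.continuousOn.congr hFS, h.continuousOn_inv, h.mapsTo.congr hFS.symm, h.mapsTo_inv,
      fun z hz => by rw [hFS hz, h.leftInvOn hz],
      fun z hz => by rw [hFS (h.mapsTo_inv hz), h.rightInvOn hz]⟩
  · rw [(hFS.mono (hc.sphere_subset i)).image_eq, hf i]; rfl

namespace IsDiscwiseExtension

variable {I : Type*} {C : ℝ} {F g : ℂ → ℂ} {Ω Ω' : Set ℂ} {c : I → ℂ} {r : I → ℝ}
  {c' : I → ℂ} {r' : I → ℝ}

lemma mem_ball_iff (H : IsDiscwiseExtension C F g Ω Ω' c r c' r') {z : ℂ} (hz : z ∈ Ω) (i : I) :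
    F z ∈ ball (c' i) (r' i) ↔ z ∈ ball (c i) (r i) := by
  refine ⟨fun h => ?_, fun h => (H.disc i).bijOn_ball.mapsTo h⟩
  rcases mem_diff_iUnion_or (fun i => ball (c i) (r i)) hz with hS | ⟨j, hj⟩
  · exact ((H.homeo.mapsTo hS).2 (mem_iUnion.2 ⟨i, h⟩)).elim
  · obtain rfl : i = j := H.target.eq_of_mem (ball_subset_closedBall h)
      (ball_subset_closedBall ((H.disc j).bijOn_ball.mapsTo hj))
    exact hj

lemma bijOn (H : IsDiscwiseExtension C F g Ω Ω' c r c' r') : BijOn F Ω Ω' := by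
  refine ⟨fun z hz => ?_, fun z hz w hw hzw => ?_, fun z hz => ?_⟩
  · rcases mem_diff_iUnion_or (fun i => ball (c i) (r i)) hz with hS | ⟨j, hj⟩
    · exact (H.homeo.mapsTo hS).1
    · exact H.target.2.1 j (ball_subset_closedBall ((H.disc j).bijOn_ball.mapsTo hj))
  · rcases mem_diff_iUnion_or (fun i => ball (c i) (r i)) hz with hS | ⟨j, hj⟩
    · rcases mem_diff_iUnion_or (fun i => ball (c i) (r i)) hw with hS' | ⟨j, hj⟩
      · exact H.homeo.injOn hS hS' hzw
      · rw [← H.mem_ball_iff hw, ← hzw, H.mem_ball_iff hz] at hj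
        exact (hS.2 (mem_iUnion.2 ⟨j, hj⟩)).elim
    · have hj' := hj
      rw [← H.mem_ball_iff hz, hzw, H.mem_ball_iff hw] at hj'
      exact (H.disc j).bijOn_ball.injOn hj hj' hzw
  · rcases mem_diff_iUnion_or (fun i => ball (c' i) (r' i)) hz with hS | ⟨j, hj⟩
    · exact ⟨g z, (H.homeo.mapsTo_inv hS).1, H.homeo.rightInvOn hS⟩
    · obtain ⟨w, hw, hwz⟩ := (H.disc j).bijOn_ball.surjOn hj
      exact ⟨w, H.source.2.1 j (ball_subset_closedBall hw), hwz⟩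

lemma near (H : IsDiscwiseExtension C F g Ω Ω' c r c' r') {w q : ℂ}
    (hw : w ∈ Ω \ ⋃ i, ball (c i) (r i)) (hq : q ∈ Ω) :
    ∃ q' ∈ Ω \ ⋃ i, ball (c i) (r i), dist q' w ≤ (2 * C + 1) * dist q w ∧
      dist (F q) (F w) ≤ (2 * C + 1) * dist (F q') (F w) := by
  have hC := H.one_le
  rcases mem_diff_iUnion_or (fun i => ball (c i) (r i)) hq with hS | ⟨i, hi⟩
  · exact ⟨q, hS, by nlinarith [dist_nonneg (x := q) (y := w)],
      by nlinarith [dist_nonneg (x := F q) (y := F w)]⟩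
  obtain ⟨p, hp, hpw, hqp⟩ := exists_mem_sphere_of_mem_ball_of_notMem hi
    fun h => hw.2 (mem_iUnion.2 ⟨i, h⟩)
  obtain ⟨q', hq', h1, h2⟩ := (H.disc i).near q (ball_subset_closedBall hi) p hp
  have hS := H.source.sphere_subset i
  have t1 := dist_triangle q' p w
  have t2 := dist_triangle (F q) (F p) (F w)
  have t3 := dist_triangle_right (F q') (F p) (F w)
  have n1 := dist_nonneg (x := q) (y := w)
  have e2 : dist q' w ≤ (C + 1) * dist q w := by nlinarith
  have e1 : dist (F q) (F w) ≤ C * dist (F q') (F w) + (C + 1) * dist (F p) (F w) := by nlinarith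
  rcases le_total (dist (F p) (F w)) (dist (F q') (F w)) with hle | hle
  · exact ⟨q', hS hq', by nlinarith, by nlinarith⟩
  · exact ⟨p, hS hp, by nlinarith, by nlinarith⟩

lemma far (H : IsDiscwiseExtension C F g Ω Ω' c r c' r') {w s : ℂ}
    (hw : w ∈ Ω \ ⋃ i, ball (c i) (r i)) (hs : s ∈ Ω) :
    ∃ s' ∈ Ω \ ⋃ i, ball (c i) (r i), dist s w ≤ (2 * C + 1) * dist s' w ∧
      dist (F s') (F w) ≤ (2 * C + 1) * dist (F s) (F w) := by
  have hC := H.one_le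
  rcases mem_diff_iUnion_or (fun i => ball (c i) (r i)) hs with hS | ⟨i, hi⟩
  · exact ⟨s, hS, by nlinarith [dist_nonneg (x := s) (y := w)],
      by nlinarith [dist_nonneg (x := F s) (y := F w)]⟩
  obtain ⟨p', hp', hpw, hqp⟩ := exists_mem_sphere_of_mem_ball_of_notMem
    ((H.disc i).bijOn_ball.mapsTo hi) fun h => (H.homeo.mapsTo hw).2 (mem_iUnion.2 ⟨i, h⟩)
  rw [← H.image_sphere] at hp'
  obtain ⟨p, hp, rfl⟩ := hp'
  obtain ⟨s', hs', h1, h2⟩ := (H.disc i).far s (ball_subset_closedBall hi) p hp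
  have hS := H.source.sphere_subset i
  have t1 := dist_triangle (F s') (F p) (F w)
  have t2 := dist_triangle s p w
  have t3 := dist_triangle_right s' p w
  have n1 := dist_nonneg (x := F s) (y := F w)
  have e2 : dist (F s') (F w) ≤ (C + 1) * dist (F s) (F w) := by nlinarith
  have e1 : dist s w ≤ C * dist s' w + (C + 1) * dist p w := by nlinarith
  rcases le_total (dist p w) (dist s' w) with hle | hle
  · exact ⟨s', hS hs', by nlinarith, by nlinarith⟩
  · exact ⟨p, hS hp, by nlinarith, by nlinarith⟩

lemma continuousOn (H : IsDiscwiseExtension C F g Ω Ω' c r c' r') : ContinuousOn F Ω := by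
  intro w hwΩ
  rcases mem_diff_iUnion_or (fun i => ball (c i) (r i)) hwΩ with hw | ⟨i, hi⟩
  · rw [Metric.continuousWithinAt_iff]
    intro ε hε
    have hC : 0 < 2 * C + 1 := by linarith [H.one_le]
    obtain ⟨δ, hδ, h⟩ := Metric.continuousWithinAt_iff.1 (H.homeo.continuousOn w hw)
      (ε / (2 * C + 1)) (by positivity)
    refine ⟨δ / (2 * C + 1), by positivity, fun {q} hq hqw => ?_⟩
    obtain ⟨q', hq', h1, h2⟩ := H.near hw hq
    rw [lt_div_iff₀' hC] at hqw
    have := h hq' (h1.trans_lt hqw)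
    rw [lt_div_iff₀' hC] at this
    exact h2.trans_lt this
  · exact ((H.disc i).continuousOn.continuousAt
      (mem_of_superset (isOpen_ball.mem_nhds hi) ball_subset_closedBall)).continuousWithinAt

lemma exists_dist_lt (H : IsDiscwiseExtension C F g Ω Ω' c r c' r') {w : ℂ} (hwΩ : w ∈ Ω)
    {ε : ℝ} (hε : 0 < ε) : ∃ δ > 0, ∀ q ∈ Ω, dist (F q) (F w) < δ → dist q w < ε := by
  rcases mem_diff_iUnion_or (fun i => ball (c i) (r i)) hwΩ with hw | ⟨i, hi⟩
  · have hC : 0 < 2 * C + 1 := by linarith [H.one_le]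
    obtain ⟨δ, hδ, h⟩ := Metric.continuousWithinAt_iff.1
      (H.homeo.continuousOn_inv _ (H.homeo.mapsTo hw)) (ε / (2 * C + 1)) (by positivity)
    refine ⟨δ / (2 * C + 1), by positivity, fun q hq hqw => ?_⟩
    obtain ⟨q', hq', h1, h2⟩ := H.far hw hq
    rw [lt_div_iff₀' hC] at hqw
    have := h (H.homeo.mapsTo hq') (h2.trans_lt hqw)
    rw [H.homeo.leftInvOn hq', H.homeo.leftInvOn hw, lt_div_iff₀' hC] at this
    exact h1.trans_lt this
  · have hsub := H.source.2.1 i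
    have hK : IsClosed (F '' (closedBall (c i) (r i) \ ball w ε)) :=
      (((isCompact_closedBall _ _).diff isOpen_ball).image_of_continuousOn
        ((H.disc i).continuousOn.mono sdiff_subset)).isClosed
    have hwK : F w ∉ F '' (closedBall (c i) (r i) \ ball w ε) := by
      rintro ⟨q, hq, hqw⟩
      rw [H.bijOn.injOn (hsub hq.1) hwΩ hqw] at hq
      exact hq.2 (mem_ball_self hε)
    obtain ⟨δ, hδ, h⟩ := Metric.isOpen_iff.1
      ((isOpen_ball (x := c' i) (ε := r' i)).inter hK.isOpen_compl) (F w)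
      ⟨(H.mem_ball_iff hwΩ i).2 hi, hwK⟩
    refine ⟨δ, hδ, fun q hq hqw => ?_⟩
    obtain ⟨h1, h2⟩ := h hqw
    by_contra hne
    exact h2 ⟨q, ⟨ball_subset_closedBall ((H.mem_ball_iff hq i).1 h1), hne⟩, rfl⟩

lemma isHomeoOn (H : IsDiscwiseExtension C F g Ω Ω' c r c' r') : IsHomeoOn F Ω Ω' := by
  refine ⟨(BijOn.equiv F H.bijOn).toHomeomorphOfIsInducing ⟨?_⟩, fun z => rfl⟩
  refine le_antisymm (continuous_iff_le_induced.1
    (H.continuousOn.mapsToRestrict H.bijOn.mapsTo)) ?_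
  rw [le_iff_nhds]
  intro w
  rw [nhds_induced]
  intro U hU
  obtain ⟨ε, hε, hU⟩ := Metric.mem_nhds_iff.1 hU
  obtain ⟨δ, hδ, h⟩ := H.exists_dist_lt w.2 hε
  exact ⟨ball _ δ, ball_mem_nhds _ hδ, fun q hq => hU (h q q.2 hq)⟩

end IsDiscwiseExtension

/-- A local three-point condition at `w` bounds the dilatation at `w`. -/
lemma dilatationOn_le {F : ℂ → ℂ} {Ω : Set ℂ} {w : ℂ} {K δ : ℝ} (hK : 0 < K) (hδ : 0 < δ)
    (hcont : ContinuousWithinAt F Ω w)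
    (hinv : ∃ ε > 0, ∀ q ∈ Ω, dist (F q) (F w) < ε → dist q w < δ)
    (h : ∀ q ∈ Ω, ∀ s ∈ Ω, q ∈ ball w δ → s ∈ ball w δ → dist w q ≤ dist w s →
      dist (F w) (F q) ≤ K * dist (F w) (F s)) :
    dilatationOn F Ω w ≤ ENNReal.ofReal K := by
  obtain ⟨ε, hε, hinv⟩ := hinv
  obtain ⟨δ', hδ', hF⟩ := Metric.continuousWithinAt_iff.1 hcont (K * ε) (by positivity)
  refine limsup_le_of_le (by isBoundedDefault) ?_
  filter_upwards [Ioo_mem_nhdsGT (lt_min hδ hδ')] with ρ hρ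
  refine ENNReal.div_le_of_le_mul (iSup₂_le fun q hq => ?_)
  rw [mul_comm, mul_comm, ← ENNReal.div_le_iff' (by simpa using hK) ENNReal.ofReal_ne_top]
  refine le_iInf₂ fun s hs => ?_
  rw [ENNReal.div_le_iff' (by simpa using hK) ENNReal.ofReal_ne_top, edist_dist, edist_dist,
    ← ENNReal.ofReal_mul hK.le]
  refine ENNReal.ofReal_le_ofReal ?_
  have hqρ : dist q w < min δ δ' := by
    rw [dist_comm]; exact hq.2.trans_lt hρ.2
  by_cases hsδ : s ∈ ball w δ
  · exact h q hq.1 s hs.1 (hqρ.trans_le (min_le_left _ _)) hsδ (hq.2.trans hs.2)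
  · have h1 : ε ≤ dist (F s) (F w) := by
      by_contra! hlt
      exact hsδ (hinv s hs.1 hlt)
    have h2 := hF hq.1 (hqρ.trans_le (min_le_right _ _))
    rw [dist_comm (F w), dist_comm (F w)]
    nlinarith

lemma IsDiscwiseExtension.dilatationOn_le {I : Type*} {C K : ℝ} {F g : ℂ → ℂ} {Ω Ω' : Set ℂ}
    {c : I → ℂ} {r : I → ℝ} {c' : I → ℂ} {r' : I → ℝ}
    (H : IsDiscwiseExtension C F g Ω Ω' c r c' r') {η : ℝ≥0 → ℝ≥0} {t : ℝ≥0}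
    (hη : ∀ p ∈ Ω \ ⋃ i, ball (c i) (r i), ∀ q ∈ Ω \ ⋃ i, ball (c i) (r i),
      ∀ s ∈ Ω \ ⋃ i, ball (c i) (r i), dist p q ≤ (t : ℝ) * dist p s →
        dist (F p) (F q) ≤ (η t : ℝ) * dist (F p) (F s))
    (ht : (t : ℝ) = (2 * C + 1) ^ 2) (hCK : C ≤ K) (hK : (2 * C + 1) ^ 2 * η t ≤ K)
    {w : ℂ} (hwΩ : w ∈ Ω) : dilatationOn F Ω w ≤ ENNReal.ofReal K := by
  have hC := H.one_le
  rcases mem_diff_iUnion_or (fun i => ball (c i) (r i)) hwΩ with hw | ⟨i, hi⟩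
  · refine _root_.dilatationOn_le (by linarith) one_pos (H.continuousOn w hwΩ)
      (H.exists_dist_lt hwΩ one_pos) fun q hq s hs _ _ hqs => ?_
    obtain ⟨q', hq', h1, h2⟩ := H.near hw hq
    obtain ⟨s', hs', h3, h4⟩ := H.far hw hs
    rw [dist_comm w, dist_comm w] at hqs
    have h5 := hη w hw q' hq' s' hs' (by
      rw [ht, dist_comm w, dist_comm w]
      nlinarith [mul_le_mul_of_nonneg_left (hqs.trans h3) (show 0 ≤ 2 * C + 1 by linarith)])
    rw [dist_comm (F w), dist_comm (F w)] at h5 ⊢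
    have hη0 := (η t).coe_nonneg
    calc dist (F q) (F w) ≤ (2 * C + 1) * dist (F q') (F w) := h2
      _ ≤ (2 * C + 1) * (η t * dist (F s') (F w)) := by gcongr
      _ ≤ (2 * C + 1) * (η t * ((2 * C + 1) * dist (F s) (F w))) := by gcongr
      _ = ((2 * C + 1) ^ 2 * η t) * dist (F s) (F w) := by ring
      _ ≤ K * dist (F s) (F w) := by gcongr
  · obtain ⟨δ, hδ, h⟩ := (H.disc i).dilatation w hi
    exact _root_.dilatationOn_le (by linarith) hδ (H.continuousOn w hwΩ)
      (H.exists_dist_lt hwΩ hδ) fun q _ s _ hq hs hqs => (h q hq s hs hqs).trans (by gcongr)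

lemma QuasisymmetricWith.weaklyQuasisymmetricOn {η : ℝ≥0 ≃ₜ ℝ≥0} {f : ℂ → ℂ} {X Y : Set ℂ}
    (h : QuasisymmetricWith η f X) (hY : Y ⊆ X) : WeaklyQuasisymmetricOn (max 1 (η 1)) f Y := by
  intro p hp q hq s hs hqs
  refine (h p (hY hp) q (hY hq) s (hY hs) 1 (by simpa using hqs)).trans ?_
  gcongr
  exact le_max_right _ _

/-- Every `η`-quasisymmetric homeomorphism between relative Schottky sets
extends to an `H`-quasiconformal homeomorphism of the ambient domains, with `H`
depending only on `η`. -/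
theorem quasisymmetric_schottky_qc_extension (η : ℝ≥0 ≃ₜ ℝ≥0) :
    ∃ H : ℝ, 1 ≤ H ∧
      ∀ (Ω Ωt S St : Set ℂ),
        IsRelativeSchottkySet Ω S → IsRelativeSchottkySet Ωt St →
        ∀ f : ℂ → ℂ, IsHomeoOn f S St → QuasisymmetricWith η f S →
          ∃ F : ℂ → ℂ, IsHomeoOn F Ω Ωt ∧ (∀ w ∈ S, F w = f w) ∧
            ∀ w ∈ Ω, dilatationOn F Ω w ≤ ENNReal.ofReal H := by
  obtain ⟨C, hC, hext⟩ := exists_isDiscExtension (le_max_left (1 : ℝ) (η 1))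
  lift C to ℝ≥0 using by linarith
  refine ⟨max C ((2 * C + 1) ^ 2 * η ((2 * C + 1) ^ 2)), hC.trans (le_max_left _ _), ?_⟩
  rintro Ω Ωt S St ⟨hΩ, I, c, r, hc, rfl⟩ ⟨hΩt, J, c', r', hc', rfl⟩ f hf hη
  obtain ⟨g, hfg⟩ := hf.exists_isHomeoPair
  obtain ⟨σ, hσ, hσf⟩ := hfg.exists_bijective_image_sphere_eq hΩ hΩt hc hc'
  obtain ⟨F, hF, H⟩ := exists_isDiscwiseExtension hC hc hc' hfg hσ hσf fun i =>
    hext (c i) (r i) (c' (σ i)) (r' (σ i)) f (hc.1 i) (hc'.1 _)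
      (hfg.continuousOn.mono (hc.sphere_subset i)) (mapsTo_iff_image_subset.2 (hσf i).subset)
      (hfg.injOn.mono (hc.sphere_subset i))
      (hη.weaklyQuasisymmetricOn (hc.sphere_subset i))
  refine ⟨F, H.isHomeoOn, hF, fun w hw => H.dilatationOn_le (η := η) (t := (2 * C + 1) ^ 2) ?_
    (by push_cast; rfl) (le_max_left _ _) (le_max_right _ _) hw⟩
  intro p hp q hq s hs hpqs
  rw [hF hp, hF hq, hF hs]
  exact hη p hp q hq s hs _ hpqs
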